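/- arXiv:1906.10772 — 7 statements merged into one kernel-verified Lean document; each statement's English description precedes it below -/
import Mathlib

section
/- Let β, μ be real numbers with 0 < β < μ. Then for every ξ ∈ ℝ, the Fourier transform of φ_{β,μ} satisfies ∫_ℝ e^{−iξt} e^{βt}/(1+e^{t})^{μ} dt = Γ(β−iξ)Γ(μ−β+iξ)/Γ(μ), and in particular this integral converges absolutely. -/
noncomputable def phi (β μ : ℝ) : ℝ → ℝ :=
  fun t => Real.exp (β * t) / (1 + Real.exp t) ^ μ

open MeasureTheory Set in
theorem aux_image : (fun t : ℝ => Real.exp t / (1 + Real.exp t)) '' univ = Ioo 0 1 := by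
  ext x
  constructor
  · rintro ⟨t, -, rfl⟩
    have := Real.exp_pos t
    constructor
    · positivity
    · simp only
      rw [div_lt_one (by positivity)]
      linarith
  · rintro ⟨h0, h1⟩
    have h2 : 0 < 1 - x := by linarith
    refine ⟨Real.log (x / (1 - x)), trivial, ?_⟩
    simp only
    rw [Real.exp_log (by positivity)]
    field_simp
    ring

theorem aux_deriv (t : ℝ) : HasDerivAt (fun t : ℝ => Real.exp t / (1 + Real.exp t))
    (Real.exp t / (1 + Real.exp t) ^ 2) t := by
  have := Real.exp_pos t
  have h := (Real.hasDerivAt_exp t).div ((Real.hasDerivAt_exp t).const_add 1)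
    (by positivity)
  refine h.congr_deriv ?_
  congr 1
  ring

theorem aux_inj : Function.Injective (fun t : ℝ => Real.exp t / (1 + Real.exp t)) := by
  intro a b h
  have := Real.exp_pos a
  have := Real.exp_pos b
  simp only at h
  rw [div_eq_div_iff (by positivity) (by positivity)] at h
  apply Real.exp_injective
  linarith

theorem aux_cpow (L : ℝ) (s : ℂ) :
    ((Real.exp L : ℝ) : ℂ) ^ s = Complex.exp (L * s) := by
  rw [Complex.cpow_def_of_ne_zero (by exact_mod_cast (Real.exp_pos L).ne'),
    ← Complex.ofReal_log (Real.exp_pos L).le, Real.log_exp]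

theorem aux_fun (β μ ξ t : ℝ) :
    |Real.exp t / (1 + Real.exp t) ^ 2| •
      (((Real.exp t / (1 + Real.exp t) : ℝ) : ℂ) ^ (((β : ℂ) - Complex.I * ξ) - 1) *
        (1 - ((Real.exp t / (1 + Real.exp t) : ℝ) : ℂ)) ^ (((μ : ℂ) - β + Complex.I * ξ) - 1)) =
    Complex.exp (-(Complex.I * ξ * t)) * (phi β μ t : ℂ) := by
  have h0 := Real.exp_pos t
  have hp : 0 < 1 + Real.exp t := by positivity
  obtain ⟨L, hL⟩ : ∃ L, 1 + Real.exp t = Real.exp L := ⟨_, (Real.exp_log hp).symm⟩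
  have e2 : (1 - ((Real.exp t / (1 + Real.exp t) : ℝ) : ℂ)) = ((Real.exp (-L) : ℝ) : ℂ) := by
    rw [Real.exp_neg, ← hL]
    norm_cast
    field_simp
    ring
  have e3 : Real.exp t / (1 + Real.exp t) ^ 2 = Real.exp (t - 2 * L) := by
    rw [hL, Real.exp_sub, two_mul, Real.exp_add, sq]
  rw [abs_of_pos (by positivity), e2, e3, phi, hL, ← Real.exp_sub, aux_cpow, aux_cpow,
    ← Real.exp_mul, ← Real.exp_sub, Complex.real_smul, Complex.ofReal_exp, Complex.ofReal_exp,
    ← Complex.exp_add, ← Complex.exp_add, ← Complex.exp_add]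
  congr 1
  push_cast
  ring

theorem stmt2 (β μ : ℝ) (h1 : 0 < β) (h2 : β < μ) (ξ : ℝ) :
    MeasureTheory.Integrable
      (fun t : ℝ => Complex.exp (-(Complex.I * ξ * t)) * (phi β μ t : ℂ)) ∧
    ∫ t : ℝ, Complex.exp (-(Complex.I * ξ * t)) * (phi β μ t : ℂ) =
      Complex.Gamma ((β : ℂ) - Complex.I * ξ) *
        Complex.Gamma ((μ : ℂ) - β + Complex.I * ξ) / Complex.Gamma (μ : ℂ) := by
  have hu : 0 < ((β : ℂ) - Complex.I * ξ).re := by simpa using h1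
  have hv : 0 < ((μ : ℂ) - β + Complex.I * ξ).re := by simpa using h2
  have hc := Complex.betaIntegral_convergent hu hv
  have hb := Complex.betaIntegral_eq_Gamma_mul_div _ _ hu hv
  rw [intervalIntegrable_iff_integrableOn_Ioo_of_le zero_le_one, ← aux_image,
    MeasureTheory.integrableOn_image_iff_integrableOn_abs_deriv_smul MeasurableSet.univ
      (fun x _ => (aux_deriv x).hasDerivWithinAt) aux_inj.injOn] at hc
  rw [Complex.betaIntegral, intervalIntegral.integral_of_le zero_le_one,
    MeasureTheory.integral_Ioc_eq_integral_Ioo, ← aux_image,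
    MeasureTheory.integral_image_eq_integral_abs_deriv_smul MeasurableSet.univ
      (fun x _ => (aux_deriv x).hasDerivWithinAt) aux_inj.injOn] at hb
  simp only [aux_fun, MeasureTheory.integrableOn_univ, MeasureTheory.setIntegral_univ] at hc hb
  refine ⟨hc, hb.trans ?_⟩
  congr 2
  ring
end

section
/- Let 0 < β < 1. Then for every real t ≠ 0, the convolution of φ_{β,1} with itself satisfies (φ_{β,1} ∗ φ_{β,1})(t) = t e^{−(1−β)t}/(1 − e^{−t}). -/
open Filter Topology MeasureTheory in
theorem stmt3_aux (t : ℝ) (ht : t ≠ 0) :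
    ∫ s : ℝ, Real.exp s / ((1 + Real.exp s) * (Real.exp s + Real.exp t)) =
      t / (Real.exp t - 1) := by
  have hT : Real.exp t - 1 ≠ 0 := by
    intro h
    exact ht (Real.exp_eq_one_iff t |>.1 (by linarith))
  have hd : ∀ s : ℝ, HasDerivAt
      (fun s => (Real.log (1 + Real.exp s) - Real.log (Real.exp s + Real.exp t)) / (Real.exp t - 1))
      (Real.exp s / ((1 + Real.exp s) * (Real.exp s + Real.exp t))) s := by
    intro s
    have p1 : 1 + Real.exp s ≠ 0 := by positivity
    have p2 : Real.exp s + Real.exp t ≠ 0 := by positivity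
    have := ((((Real.hasDerivAt_exp s).const_add 1).log p1).sub
      (((Real.hasDerivAt_exp s).add_const (Real.exp t)).log p2)).div_const (Real.exp t - 1)
    refine this.congr_deriv ?_
    field_simp
    ring
  have hbot : Tendsto
      (fun s => (Real.log (1 + Real.exp s) - Real.log (Real.exp s + Real.exp t)) / (Real.exp t - 1))
      atBot (𝓝 (-t / (Real.exp t - 1))) := by
    have h1 : Tendsto (fun s => Real.log (1 + Real.exp s)) atBot (𝓝 (Real.log (1 + 0))) :=
      (Real.tendsto_exp_atBot.const_add 1).log (by norm_num)
    have h2 : Tendsto (fun s => Real.log (Real.exp s + Real.exp t)) atBot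
        (𝓝 (Real.log (0 + Real.exp t))) :=
      (Real.tendsto_exp_atBot.add_const _).log (by positivity)
    have := (h1.sub h2).div_const (Real.exp t - 1)
    simpa using this
  have htop : Tendsto
      (fun s => (Real.log (1 + Real.exp s) - Real.log (Real.exp s + Real.exp t)) / (Real.exp t - 1))
      atTop (𝓝 0) := by
    have he : Tendsto (fun s : ℝ => Real.exp (-s)) atTop (𝓝 0) := 
      Real.tendsto_exp_neg_atTop_nhds_zero
    have h1 : Tendsto (fun s => Real.log (Real.exp (-s) + 1)) atTop (𝓝 (Real.log (0 + 1))) :=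
      (he.add_const 1).log (by norm_num)
    have h2 : Tendsto (fun s => Real.log (1 + Real.exp t * Real.exp (-s))) atTop
        (𝓝 (Real.log (1 + Real.exp t * 0))) :=
      ((he.const_mul _).const_add _).log (by norm_num)
    have := (h1.sub h2).div_const (Real.exp t - 1)
    simp only [zero_add, mul_zero, add_zero, sub_self, zero_div] at this
    refine this.congr fun s => ?_
    have e1 : 1 + Real.exp s = Real.exp s * (Real.exp (-s) + 1) := by
      rw [mul_add, ← Real.exp_add]; simp
    have e2 : Real.exp s + Real.exp t = Real.exp s * (1 + Real.exp t * Real.exp (-s)) := by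
      rw [mul_add, mul_left_comm, ← Real.exp_add s]; simp
    rw [e1, e2, Real.log_mul (by positivity) (by positivity),
      Real.log_mul (by positivity) (by positivity)]
    ring
  have hnn : ∀ s : ℝ, 0 ≤ Real.exp s / ((1 + Real.exp s) * (Real.exp s + Real.exp t)) :=
    fun s => by positivity
  have hint : Integrable
      (fun s : ℝ => Real.exp s / ((1 + Real.exp s) * (Real.exp s + Real.exp t))) := by
    have hi : IntegrableOn
      (fun s : ℝ => Real.exp s / ((1 + Real.exp s) * (Real.exp s + Real.exp t))) (Set.Ioi 0) :=
      integrableOn_Ioi_deriv_of_nonneg' (fun x _ => hd x) (fun x _ => hnn x) htop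
    have hi2 : IntegrableOn
      (fun s : ℝ => Real.exp s / ((1 + Real.exp s) * (Real.exp s + Real.exp t))) (Set.Iic 0) := by
      have hb : IntegrableOn (fun s : ℝ => Real.exp s * Real.exp (-t)) (Set.Iic 0) :=
        (integrableOn_exp_Iic 0).mul_const _
      refine Integrable.mono' hb ?_ (ae_of_all _ fun s => ?_)
      · refine Continuous.aestronglyMeasurable ?_
        exact Real.continuous_exp.div (by fun_prop) (fun s => by positivity)
      · rw [Real.norm_of_nonneg (hnn s), Real.exp_neg, ← div_eq_mul_inv]
        have a1 := Real.exp_pos s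
        have a2 := Real.exp_pos t
        gcongr
        nlinarith [mul_pos a1 a2]
    rw [← integrableOn_univ, ← Set.Iic_union_Ioi (a := (0:ℝ))]
    exact hi2.union hi
  rw [integral_of_hasDerivAt_of_tendsto hd hint hbot htop]
  ring

theorem stmt3 (β : ℝ) (h1 : 0 < β) (h2 : β < 1) (t : ℝ) (ht : t ≠ 0) :
    ∫ s : ℝ, phi β 1 (t - s) * phi β 1 s =
      t * Real.exp (-((1 - β) * t)) / (1 - Real.exp (-t)) := by
  have hT : Real.exp t - 1 ≠ 0 := by
    intro h
    exact ht (Real.exp_eq_one_iff t |>.1 (by linarith))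
  have hT' : 1 - Real.exp (-t) ≠ 0 := by
    intro h
    exact ht (neg_eq_zero.1 (Real.exp_eq_one_iff (-t) |>.1 (by linarith)))
  have key : ∀ s : ℝ, phi β 1 (t - s) * phi β 1 s =
      Real.exp (β * t) * (Real.exp s / ((1 + Real.exp s) * (Real.exp s + Real.exp t))) := by
    intro s
    have e : Real.exp (β * t) = Real.exp (β * (t - s)) * Real.exp (β * s) := by
      rw [← Real.exp_add]; ring_nf
    simp only [phi, Real.rpow_one]
    rw [e, Real.exp_sub t s]
    field_simp
  simp_rw [key]
  rw [MeasureTheory.integral_const_mul, stmt3_aux t ht]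
  have e : Real.exp (-((1 - β) * t)) = Real.exp (β * t) * Real.exp (-t) := by
    rw [← Real.exp_add]; ring_nf
  have e3 : Real.exp t * Real.exp (-t) = 1 := by rw [← Real.exp_add]; simp
  rw [e, mul_div_assoc', div_eq_div_iff hT hT']
  linear_combination (-Real.exp (β * t) * t) * e3
end

section
/- Let β, μ be real numbers with 0 < β and β + 1/2 < μ. Then for every t ∈ ℝ, (φ_{β+1/2,μ} ∗ φ_{β,μ})(t) = √π · (Γ(μ−1/2)/Γ(μ)) · φ_{2β,2μ−1}(t/2), i.e. ∫_ℝ φ_{β+1/2,μ}(t−s)φ_{β,μ}(s) ds = √π (Γ(μ−1/2)/Γ(μ)) e^{βt}/(1+e^{t/2})^{2μ−1}. -/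
open MeasureTheory Set in
lemma real_beta (a : ℝ) (ha : 0 < a) :
    ∫ y in Ioo (0:ℝ) 1, (y * (1 - y)) ^ (a - 1) =
      Real.Gamma a * Real.Gamma a / Real.Gamma (2 * a) := by
  have h := ProbabilityTheory.beta_eq_betaIntegralReal a a ha ha
  rw [ProbabilityTheory.beta, ← two_mul] at h
  rw [h, Complex.betaIntegral, intervalIntegral.integral_of_le zero_le_one,
    integral_Ioc_eq_integral_Ioo]
  have : ∫ x in Ioo (0:ℝ) 1, (x : ℂ) ^ ((a:ℂ) - 1) * (1 - (x : ℂ)) ^ ((a:ℂ) - 1)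
      = ∫ x in Ioo (0:ℝ) 1, (((x * (1 - x)) ^ (a - 1) : ℝ) : ℂ) := by
    refine setIntegral_congr_fun measurableSet_Ioo ?_
    intro x hx
    have h0 : 0 ≤ x := hx.1.le
    have h1 : 0 ≤ 1 - x := by linarith [hx.2]
    simp only
    rw [Real.mul_rpow h0 h1, Complex.ofReal_mul, Complex.ofReal_cpow h0, Complex.ofReal_cpow h1]
    push_cast
    rfl
  rw [this, integral_complex_ofReal, Complex.ofReal_re]

open MeasureTheory Set in
lemma student_int (μ : ℝ) (hμ : 1/2 < μ) :
    ∫ x : ℝ, (1 + x ^ 2) ^ (-μ) =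
      Real.sqrt Real.pi * (Real.Gamma (μ - 1/2) / Real.Gamma μ) := by
  set Y : ℝ → ℝ := fun x => (1 + x / √(1 + x ^ 2)) / 2 with hY
  have hd : ∀ x, HasDerivAt Y ((1 + x ^ 2) ^ (-(3/2) : ℝ) / 2) x := by
    intro x
    have hp : 0 < 1 + x ^ 2 := by positivity
    have h1 : HasDerivAt (fun x : ℝ => 1 + x ^ 2) (2 * x) x := by
      simpa using (hasDerivAt_pow 2 x).const_add 1
    have h2 := (((hasDerivAt_id x).div (h1.sqrt hp.ne') (Real.sqrt_pos.2 hp).ne').const_add 1).div_const 2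
    refine HasDerivAt.congr_deriv (f := Y) h2 ?_
    have e : (1 + x ^ 2) ^ (-(3/2) : ℝ) = 1 / (√(1 + x ^ 2)) ^ 3 := by
      rw [Real.rpow_neg hp.le, Real.sqrt_eq_rpow, ← Real.rpow_natCast _ 3, ← Real.rpow_mul hp.le]
      norm_num
    rw [e]
    have hs := Real.sq_sqrt hp.le
    have hs0 := Real.sqrt_pos.2 hp
    simp only [id]
    field_simp
    rw [hs]; ring
  have hmono : StrictMono Y := by
    apply strictMono_of_deriv_pos
    intro x
    rw [(hd x).deriv]; positivity
  have hprod : ∀ x, Y x * (1 - Y x) = (4 * (1 + x ^ 2))⁻¹ := by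
    intro x
    have hp : 0 < 1 + x ^ 2 := by positivity
    have hs := Real.sq_sqrt hp.le
    have hs0 := Real.sqrt_pos.2 hp
    simp only [hY]
    have : (1 + x / √(1 + x ^ 2)) / 2 * (1 - (1 + x / √(1 + x ^ 2)) / 2)
      = (1 - x^2 / (√(1 + x ^ 2))^2)/4 := by ring
    rw [this, hs]
    field_simp
    ring
  have himg : Y '' univ = Ioo 0 1 := by
    ext y
    constructor
    · rintro ⟨x, -, rfl⟩
      have h := hprod x
      have hpos : 0 < Y x * (1 - Y x) := by rw [h]; positivity
      constructor <;> nlinarith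
    · rintro ⟨h0, h1⟩
      have hq : 0 < y * (1 - y) := mul_pos h0 (by linarith)
      have hs := Real.sq_sqrt hq.le
      have hs0 := Real.sqrt_pos.2 hq
      refine ⟨(2 * y - 1) / (2 * √(y * (1 - y))), trivial, ?_⟩
      have e : 1 + ((2 * y - 1) / (2 * √(y * (1 - y)))) ^ 2 = (1 / (2 * √(y * (1 - y)))) ^ 2 := by
        rw [div_pow, div_pow, mul_pow, hs]
        field_simp
        ring
      simp only [hY]
      rw [e, Real.sqrt_sq (by positivity)]
      field_simp
      ring
  have hB := real_beta (μ - 1/2) (by linarith)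
  rw [← himg, integral_image_eq_integral_abs_deriv_smul MeasurableSet.univ
    (fun x _ => (hd x).hasDerivWithinAt) hmono.injective.injOn, setIntegral_univ] at hB
  have hfun : ∀ x : ℝ, |(1 + x ^ 2) ^ (-(3/2) : ℝ) / 2| • (Y x * (1 - Y x)) ^ (μ - 1/2 - 1)
      = (2:ℝ) ^ (2 - 2 * μ) * (1 + x ^ 2) ^ (-μ) := by
    intro x
    have hp : 0 < 1 + x ^ 2 := by positivity
    rw [hprod, abs_of_pos (by positivity), smul_eq_mul, Real.inv_rpow (by positivity),
      ← Real.rpow_neg (by positivity), Real.mul_rpow (by norm_num) hp.le,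
      show (4:ℝ) = 2 ^ (2:ℝ) by norm_num, ← Real.rpow_mul (by norm_num)]
    rw [show -μ = -(3/2) + -(μ - 1/2 - 1) by ring, Real.rpow_add hp,
      show 2 - 2 * μ = 2 * -(μ - 1/2-1) + -1 by ring, Real.rpow_add (by norm_num : (0:ℝ) < 2),
      Real.rpow_neg_one]
    ring
  simp_rw [hfun] at hB
  rw [integral_const_mul] at hB
  have hdup := Real.Gamma_mul_Gamma_add_half (μ - 1/2)
  rw [sub_add_cancel, show 1 - 2 * (μ - 1/2) = 2 - 2 * μ by ring] at hdup
  have g1 := Real.Gamma_pos_of_pos (show 0 < μ by linarith)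
  have g2 := Real.Gamma_pos_of_pos (show 0 < μ - 1/2 by linarith)
  have g3 := Real.Gamma_pos_of_pos (show 0 < 2 * (μ - 1/2) by linarith)
  have g4 : (0:ℝ) < 2 ^ (2 - 2 * μ) := by positivity
  generalize (∫ x : ℝ, (1 + x ^ 2) ^ (-μ)) = I at *
  generalize Real.Gamma (2 * (μ - 1/2)) = C at *
  generalize Real.Gamma (μ - 1/2) = A at *
  generalize Real.Gamma μ = B at *
  generalize (2:ℝ) ^ (2 - 2 * μ) = D at *
  rw [eq_div_iff g3.ne'] at hB
  rw [← mul_div_assoc, eq_div_iff g1.ne']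
  have : (D * C * A) * (I * B) = (D * C * A) * (√Real.pi * A) := by
    calc _ = (D * I * C) * (A * B) := by ring
      _ = _ := by rw [hB, hdup]; ring
  exact mul_left_cancel₀ (by positivity) this

open MeasureTheory Set in
theorem stmt4_aux (μ t : ℝ) (h2 : 1/2 < μ) :
    ∫ s : ℝ, Real.exp ((t - s)/2) * ((1 + Real.exp (t/2)) ^ 2
      + (Real.exp (s/2) - Real.exp ((t-s)/2)) ^ 2) ^ (-μ) =
      Real.sqrt Real.pi * (Real.Gamma (μ - 1/2) / Real.Gamma μ) *
        (1 + Real.exp (t/2)) ^ (1 - 2 * μ) := by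
  set c := 1 + Real.exp (t/2) with hc
  have hc0 : 0 < c := by positivity
  set W : ℝ → ℝ := fun s => (Real.exp (s/2) - Real.exp ((t-s)/2)) / c with hW
  set D : ℝ → ℝ := fun s => (Real.exp (s/2) + Real.exp ((t-s)/2)) / (2 * c) with hD
  have hd : ∀ s, HasDerivAt W (D s) s := by
    intro s
    have a1 : HasDerivAt (fun s : ℝ => s/2) (1/2) s := (hasDerivAt_id s).div_const 2
    have a2 : HasDerivAt (fun s : ℝ => (t-s)/2) (-1/2) s :=
      ((hasDerivAt_id s).const_sub t).div_const 2
    refine HasDerivAt.congr_deriv (f := W) ((a1.exp.sub a2.exp).div_const c) ?_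
    simp only [hD]
    field_simp
    ring
  have hDpos : ∀ s, 0 < D s := fun s => by positivity
  have hmono : StrictMono W := by
    apply strictMono_of_deriv_pos
    intro x
    rw [(hd x).deriv]; exact hDpos x
  have hsurj : Function.Surjective W := by
    have hcont : Continuous W := by fun_prop
    have e1 : Filter.Tendsto (fun s : ℝ => s/2) Filter.atTop Filter.atTop :=
      Filter.tendsto_id.atTop_div_const (by norm_num)
    have e1' : Filter.Tendsto (fun s : ℝ => s/2) Filter.atBot Filter.atBot :=
      Filter.tendsto_id.atBot_div_const (by norm_num)
    have e2 : Filter.Tendsto (fun s : ℝ => (t-s)/2) Filter.atTop Filter.atBot :=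
      (Filter.tendsto_atBot_add_const_left _ t Filter.tendsto_neg_atTop_atBot).atBot_div_const (by norm_num)
    have e2' : Filter.Tendsto (fun s : ℝ => (t-s)/2) Filter.atBot Filter.atTop :=
      (Filter.tendsto_atTop_add_const_left _ t Filter.tendsto_neg_atBot_atTop).atTop_div_const (by norm_num)
    apply hcont.surjective
    · apply Filter.Tendsto.atTop_div_const hc0
      exact (Real.tendsto_exp_atTop.comp e1).atTop_add (Real.tendsto_exp_atBot.comp e2).neg
    · apply Filter.Tendsto.atBot_div_const hc0
      exact (Real.tendsto_exp_atBot.comp e1').add_atBot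
        (Filter.tendsto_neg_atTop_atBot.comp (Real.tendsto_exp_atTop.comp e2'))
  have hst := student_int μ h2
  have hint : Integrable (fun x : ℝ => (1 + x ^ 2) ^ (-μ)) := by
    have := integrable_rpow_neg_one_add_norm_sq (E := ℝ) (μ := volume) (r := 2 * μ)
      (by simp; linarith)
    convert this using 3 with x
    · simp
    · ring
  have himg : W '' univ = univ := by rw [image_univ, hsurj.range_eq]
  have hI1 := (integrableOn_image_iff_integrableOn_abs_deriv_smul MeasurableSet.univ
    (fun x _ => (hd x).hasDerivWithinAt) hmono.injective.injOn (fun x : ℝ => (1 + x ^ 2) ^ (-μ))).1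
    (by rw [himg]; exact hint.integrableOn)
  have hE1 := integral_image_eq_integral_abs_deriv_smul MeasurableSet.univ
    (fun x _ => (hd x).hasDerivWithinAt) hmono.injective.injOn (fun x : ℝ => (1 + x ^ 2) ^ (-μ))
  rw [himg, setIntegral_univ, setIntegral_univ, hst] at hE1
  rw [integrableOn_univ] at hI1
  set f : ℝ → ℝ := fun s => Real.exp ((t - s)/2) * (c ^ 2
      + (Real.exp (s/2) - Real.exp ((t-s)/2)) ^ 2) ^ (-μ) with hf
  have key : ∀ s, f s + f (t - s) =
      (2 * c ^ (1 - 2 * μ)) * (|D s| • (1 + W s ^ 2) ^ (-μ)) := by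
    intro s
    simp only [hf, sub_sub_cancel]
    rw [abs_of_pos (hDpos s), smul_eq_mul]
    have e : c ^ 2 + (Real.exp (s/2) - Real.exp ((t-s)/2)) ^ 2 = c ^ 2 * (1 + W s ^ 2) := by
      simp only [hW]; field_simp
    have e' : c ^ 2 + (Real.exp ((t-s)/2) - Real.exp (s/2)) ^ 2 = c ^ 2 * (1 + W s ^ 2) := by
      rw [← e]; ring
    rw [e, e', Real.mul_rpow (by positivity) (by positivity), ← Real.rpow_natCast c 2,
      ← Real.rpow_mul hc0.le, show 1 - 2 * μ = 1 + ((2:ℕ):ℝ) * -μ by push_cast; ring,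
      Real.rpow_add hc0, Real.rpow_one]
    simp only [hD]
    field_simp
    ring
  have hfpos : ∀ s, 0 ≤ f s := fun s => by simp only [hf]; positivity
  have hsum : Integrable (fun s => f s + f (t - s)) := by
    simp_rw [key]
    exact hI1.const_mul _
  have hfc : Continuous f := by
    simp only [hf]
    refine Continuous.mul (by fun_prop) (Continuous.rpow_const (by fun_prop) ?_)
    intro s; left; positivity
  have hfint : Integrable f := by
    refine hsum.mono' hfc.aestronglyMeasurable (Filter.Eventually.of_forall fun s => ?_)
    rw [Real.norm_of_nonneg (hfpos s)]
    linarith [hfpos (t - s)]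
  have h3 : ∫ s, (f s + f (t - s)) = 2 * ∫ s, f s := by
    rw [integral_add hfint (hfint.comp_sub_left t), integral_sub_left_eq_self, two_mul]
  simp_rw [key] at h3
  rw [integral_const_mul, ← hE1] at h3
  linarith

theorem stmt4 (β μ : ℝ) (h1 : 0 < β) (h2 : β + 1/2 < μ) (t : ℝ) :
    ∫ s : ℝ, phi (β + 1/2) μ (t - s) * phi β μ s =
      Real.sqrt Real.pi * (Real.Gamma (μ - 1/2) / Real.Gamma μ) *
        phi (2 * β) (2 * μ - 1) (t / 2) := by
  have key : ∀ s, phi (β + 1/2) μ (t - s) * phi β μ s = Real.exp (β * t) *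
      (Real.exp ((t - s)/2) * ((1 + Real.exp (t/2)) ^ 2
      + (Real.exp (s/2) - Real.exp ((t-s)/2)) ^ 2) ^ (-μ)) := by
    intro s
    have e : (1 + Real.exp (t/2)) ^ 2 + (Real.exp (s/2) - Real.exp ((t-s)/2)) ^ 2
        = (1 + Real.exp (t - s)) * (1 + Real.exp s) := by
      have a1 : Real.exp s = Real.exp (s/2) ^ 2 := by rw [← Real.exp_nat_mul]; congr 1; push_cast; ring
      have a2 : Real.exp (t - s) = Real.exp ((t - s)/2) ^ 2 := by
        rw [← Real.exp_nat_mul]; congr 1; push_cast; ring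
      have a3 : Real.exp (t/2) = Real.exp (s/2) * Real.exp ((t - s)/2) := by
        rw [← Real.exp_add]; congr 1; ring
      rw [a1, a2, a3]; ring
    rw [e, Real.rpow_neg (by positivity), Real.mul_rpow (by positivity) (by positivity)]
    simp only [phi]
    have b : Real.exp ((β + 1/2) * (t - s)) * Real.exp (β * s)
        = Real.exp (β * t) * Real.exp ((t - s)/2) := by
      rw [← Real.exp_add, ← Real.exp_add]; congr 1; ring
    rw [div_mul_div_comm, b]
    ring
  simp_rw [key]
  rw [MeasureTheory.integral_const_mul, stmt4_aux μ t (by linarith)]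
  simp only [phi]
  rw [show 1 - 2 * μ = -(2 * μ - 1) by ring, Real.rpow_neg (by positivity),
    show 2 * β * (t/2) = β * t by ring]
  ring
end

section
/- Let β, γ > 0 and λ > β. Then for every t ∈ ℝ, the convolution identity φ_{β,λ+γ} ∗ ψ_{γ,λ−β} = γ B(γ,λ) φ_{β,λ} holds, i.e. ∫₀^∞ (e^{β(t−s)}/(1+e^{t−s})^{λ+γ}) · γ(1−e^{−s})^{γ−1}e^{−(λ−β)s} ds = γ B(γ,λ) e^{βt}/(1+e^{t})^{λ}. -/
open MeasureTheory in
lemma beta_real_aux (u v : ℝ) (hu : 0 < u) (hv : 0 < v) :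
    ∫ x in Set.Ioo (0 : ℝ) 1, x ^ (u - 1) * (1 - x) ^ (v - 1) =
      Real.Gamma u * Real.Gamma v / Real.Gamma (u + v) := by
  have h := Complex.betaIntegral_eq_Gamma_mul_div (u : ℂ) (v : ℂ) (by simpa) (by simpa)
  rw [Complex.betaIntegral, intervalIntegral.integral_of_le (by norm_num),
    integral_Ioc_eq_integral_Ioo] at h
  have h2 : ∫ x in Set.Ioo (0 : ℝ) 1, (x : ℂ) ^ ((u : ℂ) - 1) * (1 - (x : ℂ)) ^ ((v : ℂ) - 1) =
      ((∫ x in Set.Ioo (0 : ℝ) 1, x ^ (u - 1) * (1 - x) ^ (v - 1) : ℝ) : ℂ) := by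
    rw [← integral_complex_ofReal]
    refine setIntegral_congr_fun measurableSet_Ioo fun x hx => ?_
    have h1 : (0 : ℝ) ≤ 1 - x := by linarith [hx.2]
    rw [Complex.ofReal_mul, Complex.ofReal_cpow hx.1.le, Complex.ofReal_cpow h1]
    push_cast
    rfl
  rw [h2, ← Complex.ofReal_add, Complex.Gamma_ofReal, Complex.Gamma_ofReal,
    Complex.Gamma_ofReal] at h
  exact_mod_cast h

theorem stmt8 (β γ lam : ℝ) (hβ : 0 < β) (hγ : 0 < γ) (hlam : β < lam) (t : ℝ) :
    ∫ s in Set.Ioi (0 : ℝ),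
        (Real.exp (β * (t - s)) / (1 + Real.exp (t - s)) ^ (lam + γ)) *
          (γ * (1 - Real.exp (-s)) ^ (γ - 1) * Real.exp (-((lam - β) * s))) =
      γ * (Real.Gamma γ * Real.Gamma lam / Real.Gamma (γ + lam)) *
        (Real.exp (β * t) / (1 + Real.exp t) ^ lam) := by
  have ha : 0 < Real.exp t := Real.exp_pos t
  set a := Real.exp t with hadef
  have hb := beta_real_aux lam γ (by linarith) hγ
  have himg : (fun s => (1 + a) / (Real.exp s + a)) '' Set.Ioi (0 : ℝ) = Set.Ioo (0 : ℝ) 1 := by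
    ext x
    constructor
    · rintro ⟨s, hs, rfl⟩
      have h1 : 1 < Real.exp s := Real.one_lt_exp_iff.2 hs
      refine ⟨by positivity, ?_⟩
      simp only
      rw [div_lt_one (by positivity)]
      linarith
    · rintro ⟨h0, h1⟩
      have h2 : 1 < (1 + a) / x - a := by
        rw [lt_sub_iff_add_lt, lt_div_iff₀ h0]
        nlinarith
      refine ⟨Real.log ((1 + a) / x - a), Real.log_pos h2, ?_⟩
      simp only
      have hA : 1 + a ≠ 0 := by positivity
      rw [Real.exp_log (by linarith), sub_add_cancel, div_div_cancel₀ hA]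
  have hcv := MeasureTheory.integral_image_eq_integral_abs_deriv_smul
    (s := Set.Ioi (0 : ℝ)) (f := fun s => (1 + a) / (Real.exp s + a))
    (f' := fun s => -((1 + a) * Real.exp s) / (Real.exp s + a) ^ 2) measurableSet_Ioi
    (by
      intro s _
      have hne : Real.exp s + a ≠ 0 := by positivity
      have := ((hasDerivAt_const s (1 + a)).div ((Real.hasDerivAt_exp s).add_const a) hne)
      refine HasDerivAt.hasDerivWithinAt ?_
      convert! this using 1
      ring)
    (by
      intro s _ r _ h
      simp only at h
      rw [div_eq_div_iff (by positivity) (by positivity)] at h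
      have := mul_left_cancel₀ (by positivity) h
      exact Real.exp_injective (by linarith))
    (fun x => x ^ (lam - 1) * (1 - x) ^ (γ - 1))
  rw [himg, hb] at hcv
  have key : ∀ s ∈ Set.Ioi (0 : ℝ),
      (Real.exp (β * (t - s)) / (1 + Real.exp (t - s)) ^ (lam + γ)) *
          (γ * (1 - Real.exp (-s)) ^ (γ - 1) * Real.exp (-((lam - β) * s))) =
      (γ * (Real.exp (β * t) / (1 + a) ^ lam)) *
        (|-((1 + a) * Real.exp s) / (Real.exp s + a) ^ 2| •
          (((1 + a) / (Real.exp s + a)) ^ (lam - 1) *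
            (1 - (1 + a) / (Real.exp s + a)) ^ (γ - 1))) := by
    intro s hs
    have h1 : 0 < Real.exp s - 1 := by
      have := Real.one_lt_exp_iff.2 hs
      linarith
    have hE := Real.exp_pos s
    have hD : 0 < Real.exp s + a := by positivity
    have hA : 0 < 1 + a := by positivity
    have e1 : 1 + Real.exp (t - s) = (Real.exp s + a) / Real.exp s := by
      rw [Real.exp_sub]; field_simp; rfl
    have e2 : 1 - Real.exp (-s) = (Real.exp s - 1) / Real.exp s := by
      rw [Real.exp_neg]; field_simp
    have e3 : 1 - (1 + a) / (Real.exp s + a) = (Real.exp s - 1) / (Real.exp s + a) := by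
      field_simp; ring
    rw [e1, e2, e3, neg_div, abs_neg, abs_of_pos (by positivity), smul_eq_mul,
      Real.div_rpow hD.le hE.le, Real.div_rpow h1.le hE.le, Real.div_rpow h1.le hD.le,
      Real.div_rpow hA.le hD.le, ← Real.exp_mul, ← Real.exp_mul, Real.rpow_sub hD,
      Real.rpow_sub hD, Real.rpow_sub hA, Real.rpow_add hD, Real.rpow_one, Real.rpow_one]
    have e4 : Real.exp (β * (t - s)) * Real.exp (-((lam - β) * s)) * Real.exp (s * (lam + γ)) =
        Real.exp (β * t) * Real.exp s * Real.exp (s * (γ - 1)) := by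
      rw [← Real.exp_add, ← Real.exp_add, ← Real.exp_add, ← Real.exp_add]
      congr 1; ring
    have p1 : 0 < (Real.exp s + a) ^ lam := by positivity
    have p2 : 0 < (Real.exp s + a) ^ γ := by positivity
    have p3 : 0 < (1 + a) ^ lam := by positivity
    have p4 := Real.exp_pos (s * (lam + γ))
    have p5 := Real.exp_pos (s * (γ - 1))
    generalize Real.exp (β * (t - s)) = X1 at *
    generalize Real.exp (-((lam - β) * s)) = X2 at *
    generalize Real.exp (s * (lam + γ)) = X3 at *
    generalize Real.exp (s * (γ - 1)) = X4 at *
    generalize Real.exp (β * t) = X5 at *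
    generalize (Real.exp s + a) ^ lam = Y1 at *
    generalize (Real.exp s + a) ^ γ = Y2 at *
    generalize (1 + a) ^ lam = Y3 at *
    generalize (Real.exp s - 1) ^ (γ - 1) = Y4 at *
    calc _ = (X1 * X2 * X3) * γ * Y4 / (Y1 * Y2 * X4) := by field_simp
      _ = _ := by rw [e4]; field_simp
  rw [MeasureTheory.setIntegral_congr_fun measurableSet_Ioi key,
    MeasureTheory.integral_const_mul, ← hcv, add_comm γ lam]
  ring
end

section
/- Let 1 ≤ p < ∞ and β, μ ∈ ℝ with 0 < β − 1/p < μ. Then there exists a bounded linear operator T on the complex Lebesgue space L^p(0,∞) such that for every f ∈ L^p(0,∞) and almost every t > 0 the integral defining S_{β,μ}f(t) converges absolutely and (Tf)(t) = S_{β,μ}f(t); moreover the operator norm of T equals B(β − 1/p, μ − β + 1/p). -/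
open MeasureTheory

/-- The generalized Stieltjes operator `S_{β,μ}` acting pointwise on functions on `(0,∞)`. -/
noncomputable def SOp (β μ : ℝ) (f : ℝ → ℂ) (t : ℝ) : ℂ :=
  ((t ^ (μ - β) : ℝ) : ℂ) *
    ∫ s in Set.Ioi (0 : ℝ), ((s ^ (β - 1) * (t + s) ^ (-μ) : ℝ) : ℂ) * f s

lemma st_scale {t : ℝ} (ht : 0 < t) (F : ℝ → ENNReal) :
    ∫⁻ s in Set.Ioi (0:ℝ), F s = ENNReal.ofReal t * ∫⁻ u in Set.Ioi (0:ℝ), F (t * u) := by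
  have him : (fun u => t * u) '' Set.Ioi (0:ℝ) = Set.Ioi 0 := by
    ext x
    simp only [Set.mem_image, Set.mem_Ioi]
    constructor
    · rintro ⟨u, hu, rfl⟩; positivity
    · intro hx; exact ⟨x / t, by positivity, by field_simp⟩
  have h := lintegral_image_eq_lintegral_abs_deriv_mul (f := fun u => t * u) (f' := fun _ => t)
    (measurableSet_Ioi (a := (0:ℝ)))
    (fun x _ => by simpa using ((hasDerivAt_id x).const_mul t).hasDerivWithinAt)
    (fun x _ y _ h => mul_left_cancel₀ ht.ne' h) F
  rw [him] at h
  rw [h, lintegral_const_mul' _ _ ENNReal.ofReal_ne_top, abs_of_pos ht]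

lemma st_gamma {a r : ℝ} (ha : 0 < a) (hr : 0 < r) :
    ∫⁻ x in Set.Ioi (0:ℝ), ENNReal.ofReal (x ^ (a - 1) * Real.exp (-(r * x)))
      = ENNReal.ofReal ((1 / r) ^ a * Real.Gamma a) := by
  have h := Real.integral_rpow_mul_exp_neg_mul_Ioi ha hr
  have hG := Real.Gamma_pos_of_pos ha
  rw [← h, ofReal_integral_eq_lintegral_ofReal]
  · by_contra hn
    rw [integral_undef hn] at h
    have : 0 < (1 / r) ^ a * Real.Gamma a := by positivity
    linarith
  · filter_upwards [ae_restrict_mem measurableSet_Ioi] with x hx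
    have : (0:ℝ) < x := hx
    positivity

lemma st_beta {a b : ℝ} (ha : 0 < a) (hb : 0 < b) :
    ∫⁻ u in Set.Ioi (0:ℝ), ENNReal.ofReal (u ^ (a - 1) * (1 + u) ^ (-(a + b)))
      = ENNReal.ofReal (Real.Gamma a * Real.Gamma b / Real.Gamma (a + b)) := by
  have hA := Real.Gamma_pos_of_pos ha
  have hB := Real.Gamma_pos_of_pos hb
  have hAB := Real.Gamma_pos_of_pos (add_pos ha hb)
  have key : ENNReal.ofReal (Real.Gamma (a + b)) *
      ∫⁻ u in Set.Ioi (0:ℝ), ENNReal.ofReal (u ^ (a - 1) * (1 + u) ^ (-(a + b)))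
      = ENNReal.ofReal (Real.Gamma a * Real.Gamma b) := by
    calc _ = ∫⁻ u in Set.Ioi (0:ℝ), ∫⁻ x in Set.Ioi (0:ℝ), ENNReal.ofReal (u ^ (a - 1)) *
          ENNReal.ofReal (x ^ (a + b - 1) * Real.exp (-((1 + u) * x))) := by
          rw [← lintegral_const_mul' _ _ ENNReal.ofReal_ne_top]
          refine setLIntegral_congr_fun measurableSet_Ioi fun u hu => ?_
          have hu : (0:ℝ) < u := hu
          rw [lintegral_const_mul' _ _ ENNReal.ofReal_ne_top, st_gamma (add_pos ha hb) (by positivity),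
            ← ENNReal.ofReal_mul (by positivity), ← ENNReal.ofReal_mul (by positivity)]
          congr 1
          rw [Real.rpow_neg (by positivity), one_div, Real.inv_rpow (by positivity)]
          ring
      _ = ∫⁻ x in Set.Ioi (0:ℝ), ∫⁻ u in Set.Ioi (0:ℝ), ENNReal.ofReal (u ^ (a - 1)) *
          ENNReal.ofReal (x ^ (a + b - 1) * Real.exp (-((1 + u) * x))) := by
          apply lintegral_lintegral_swap
          apply Measurable.aemeasurable
          unfold Function.uncurry
          fun_prop
      _ = ∫⁻ x in Set.Ioi (0:ℝ), ENNReal.ofReal (Real.Gamma a) *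
            ENNReal.ofReal (x ^ (b - 1) * Real.exp (-(1 * x))) := by
          refine setLIntegral_congr_fun measurableSet_Ioi fun x hx => ?_
          have hx : (0:ℝ) < x := hx
          have : ∀ u ∈ Set.Ioi (0:ℝ), ENNReal.ofReal (u ^ (a - 1)) *
              ENNReal.ofReal (x ^ (a + b - 1) * Real.exp (-((1 + u) * x)))
              = ENNReal.ofReal (x ^ (a + b - 1) * Real.exp (-x)) *
                ENNReal.ofReal (u ^ (a - 1) * Real.exp (-(x * u))) := by
            intro u hu
            have hu : (0:ℝ) < u := hu
            rw [← ENNReal.ofReal_mul (by positivity), ← ENNReal.ofReal_mul (by positivity)]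
            congr 1
            rw [show -((1 + u) * x) = -x + -(x * u) by ring, Real.exp_add]
            ring
          rw [setLIntegral_congr_fun measurableSet_Ioi this,
            lintegral_const_mul' _ _ ENNReal.ofReal_ne_top, st_gamma ha hx,
            ← ENNReal.ofReal_mul (by positivity), ← ENNReal.ofReal_mul (by positivity)]
          congr 1
          rw [show a + b - 1 = a + (b - 1) by ring, Real.rpow_add hx, one_div,
            Real.inv_rpow hx.le, one_mul]
          have : x ^ a ≠ 0 := by positivity
          field_simp
      _ = _ := by
          rw [lintegral_const_mul' _ _ ENNReal.ofReal_ne_top, st_gamma hb one_pos,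
            ← ENNReal.ofReal_mul (by positivity)]
          simp
  rw [ENNReal.ofReal_div_of_pos hAB, ← key, mul_comm, ENNReal.mul_div_cancel_right]
  · simpa using hAB
  · exact ENNReal.ofReal_ne_top

lemma st_jensen {α : Type*} [MeasurableSpace α] (ν : Measure α) {p : ℝ} (hp : 1 ≤ p)
    (g : α → ENNReal) (hg : AEMeasurable g ν) :
    (∫⁻ x, g x ∂ν) ^ p ≤ (ν Set.univ) ^ (p - 1) * ∫⁻ x, g x ^ p ∂ν := by
  have h := eLpNorm'_le_eLpNorm'_mul_rpow_measure_univ (p := 1) (q := p) one_pos hp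
    (f := g) (μ := ν) hg.aestronglyMeasurable
  simp only [eLpNorm'] at h
  simp only [enorm_eq_self, ENNReal.rpow_one, div_one, one_div] at h
  have hp0 : 0 < p := by linarith
  calc _ ≤ _ := ENNReal.rpow_le_rpow h hp0.le
    _ = _ := by
      rw [ENNReal.mul_rpow_of_nonneg _ _ hp0.le, ← ENNReal.rpow_mul, ← ENNReal.rpow_mul,
        inv_mul_cancel₀ hp0.ne', ENNReal.rpow_one, mul_comm, sub_mul, one_mul, inv_mul_cancel₀ hp0.ne']

lemma st_upper {p β μ : ℝ} (hp : 1 ≤ p) (h1 : 0 < β - 1 / p) (h2 : β - 1 / p < μ)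
    (g : ℝ → ENNReal) (hg : Measurable g) :
    ∫⁻ t in Set.Ioi (0:ℝ), (∫⁻ u in Set.Ioi (0:ℝ),
        ENNReal.ofReal (u ^ (β - 1) * (1 + u) ^ (-μ)) * g (t * u)) ^ p
    ≤ ENNReal.ofReal (Real.Gamma (β - 1 / p) * Real.Gamma (μ - β + 1 / p) /
        Real.Gamma ((β - 1 / p) + (μ - β + 1 / p))) ^ p * ∫⁻ t in Set.Ioi (0:ℝ), g t ^ p := by
  have hb : 0 < μ - β + 1 / p := by linarith
  have hbeta := st_beta h1 hb
  set B := ENNReal.ofReal (Real.Gamma (β - 1 / p) * Real.Gamma (μ - β + 1 / p) /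
        Real.Gamma ((β - 1 / p) + (μ - β + 1 / p))) with hB
  have hp0 : 0 < p := by linarith
  set w : ℝ → ENNReal := fun u => ENNReal.ofReal (u ^ (β - 1 / p - 1) *
    (1 + u) ^ (-(β - 1 / p + (μ - β + 1 / p)))) with hw
  have hwm : Measurable w := by rw [hw]; fun_prop
  set ν := (volume.restrict (Set.Ioi (0:ℝ))).withDensity w with hν
  have hνu : ν Set.univ = B := by
    rw [hν, withDensity_apply _ MeasurableSet.univ, Measure.restrict_univ, ← hbeta]
  have hin : ∀ t : ℝ, (∫⁻ u in Set.Ioi (0:ℝ),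
        ENNReal.ofReal (u ^ (β - 1) * (1 + u) ^ (-μ)) * g (t * u)) ^ p
      ≤ B ^ (p - 1) * ∫⁻ u in Set.Ioi (0:ℝ), w u * (ENNReal.ofReal u * g (t * u) ^ p) := by
    intro t
    have h := st_jensen ν hp (fun u => ENNReal.ofReal (u ^ (1 / p)) * g (t * u))
      (by apply Measurable.aemeasurable; fun_prop)
    rw [hνu, hν, lintegral_withDensity_eq_lintegral_mul _ hwm (by fun_prop),
      lintegral_withDensity_eq_lintegral_mul _ hwm (by fun_prop)] at h
    convert h using 2
    · refine setLIntegral_congr_fun measurableSet_Ioi fun u hu => ?_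
      have hu : (0:ℝ) < u := hu
      simp only [Pi.mul_apply, hw]
      rw [← mul_assoc, ← ENNReal.ofReal_mul (by positivity)]
      congr 2
      rw [show β - 1 = (β - 1 / p - 1) + 1 / p by ring, Real.rpow_add hu]
      ring_nf
    · refine setLIntegral_congr_fun measurableSet_Ioi fun u hu => ?_
      have hu : (0:ℝ) < u := hu
      simp only [Pi.mul_apply]
      rw [ENNReal.mul_rpow_of_nonneg _ _ hp0.le, ENNReal.ofReal_rpow_of_nonneg (by positivity) hp0.le,
        ← Real.rpow_mul hu.le, one_div_mul_cancel hp0.ne', Real.rpow_one]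
  calc _ ≤ ∫⁻ t in Set.Ioi (0:ℝ), B ^ (p - 1) * ∫⁻ u in Set.Ioi (0:ℝ),
          w u * (ENNReal.ofReal u * g (t * u) ^ p) := lintegral_mono fun t => hin t
    _ = B ^ (p - 1) * ∫⁻ t in Set.Ioi (0:ℝ), ∫⁻ u in Set.Ioi (0:ℝ),
          w u * (ENNReal.ofReal u * g (t * u) ^ p) := by
        rw [lintegral_const_mul' _ _ (ENNReal.rpow_ne_top_of_nonneg (by linarith)
          ENNReal.ofReal_ne_top)]
    _ = B ^ (p - 1) * ∫⁻ u in Set.Ioi (0:ℝ), ∫⁻ t in Set.Ioi (0:ℝ),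
          w u * (ENNReal.ofReal u * g (t * u) ^ p) := by
        rw [lintegral_lintegral_swap]
        apply Measurable.aemeasurable
        unfold Function.uncurry
        fun_prop
    _ = B ^ (p - 1) * ∫⁻ u in Set.Ioi (0:ℝ), w u * ∫⁻ t in Set.Ioi (0:ℝ), g t ^ p := by
        congr 1
        refine setLIntegral_congr_fun measurableSet_Ioi fun u hu => ?_
        have hu : (0:ℝ) < u := hu
        rw [lintegral_const_mul' _ _ ENNReal.ofReal_ne_top,
          lintegral_const_mul' _ _ ENNReal.ofReal_ne_top,
          st_scale hu (fun t => g t ^ p)]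
        simp only [mul_comm]
        rfl
    _ = _ := by
        rw [lintegral_mul_const _ hwm, hbeta, ← mul_assoc]
        congr 1
        rcases eq_or_ne B 0 with h0 | h0
        · rw [h0, mul_zero, ENNReal.zero_rpow_of_pos hp0]
        · nth_rewrite 2 [← ENNReal.rpow_one B]
          rw [← ENNReal.rpow_add _ _ h0 ENNReal.ofReal_ne_top]
          simp

lemma st_enorm (β μ : ℝ) (f : ℝ → ℂ) {t : ℝ} (ht : 0 < t) :
    ENNReal.ofReal (t ^ (μ - β)) *
      ∫⁻ s in Set.Ioi (0:ℝ), ‖((s ^ (β - 1) * (t + s) ^ (-μ) : ℝ) : ℂ) * f s‖ₑ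
    = ∫⁻ u in Set.Ioi (0:ℝ), ENNReal.ofReal (u ^ (β - 1) * (1 + u) ^ (-μ)) * ‖f (t * u)‖ₑ := by
  rw [st_scale ht, ← mul_assoc, ← ENNReal.ofReal_mul (by positivity),
    ← lintegral_const_mul' _ _ ENNReal.ofReal_ne_top]
  refine setLIntegral_congr_fun measurableSet_Ioi fun u hu => ?_
  have hu : (0:ℝ) < u := hu
  have h0 : 0 ≤ (t * u) ^ (β - 1) * (t + t * u) ^ (-μ) := by positivity
  rw [enorm_mul, ← mul_assoc]
  congr 1
  rw [← ofReal_norm, Complex.norm_real, Real.norm_of_nonneg h0,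
    ← ENNReal.ofReal_mul (by positivity)]
  congr 1
  rw [show t + t * u = t * (1 + u) by ring, Real.mul_rpow ht.le hu.le,
    Real.mul_rpow ht.le (by positivity)]
  have : t ^ (μ - β) * t * t ^ (β - 1) * t ^ (-μ) = 1 := by
    nth_rewrite 2 [← Real.rpow_one t]
    rw [← Real.rpow_add ht, ← Real.rpow_add ht, ← Real.rpow_add ht,
      show μ - β + 1 + (β - 1) + -μ = 0 by ring, Real.rpow_zero]
  linear_combination (u ^ (β - 1) * (1 + u) ^ (-μ)) * this

lemma st_SOp_le (β μ : ℝ) (f : ℝ → ℂ) {t : ℝ} (ht : 0 < t) :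
    ‖SOp β μ f t‖ₑ ≤
      ∫⁻ u in Set.Ioi (0:ℝ), ENNReal.ofReal (u ^ (β - 1) * (1 + u) ^ (-μ)) * ‖f (t * u)‖ₑ := by
  have h0 : 0 ≤ t ^ (μ - β) := by positivity
  rw [← st_enorm β μ f ht, SOp, enorm_mul, ← ofReal_norm, Complex.norm_real,
    Real.norm_of_nonneg h0]
  gcongr
  exact enorm_integral_le_lintegral_enorm _

lemma st_meas (β μ : ℝ) (f : ℝ → ℂ) (hf : StronglyMeasurable f) :
    StronglyMeasurable (SOp β μ f) := by
  unfold SOp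
  apply StronglyMeasurable.mul
  · apply Measurable.stronglyMeasurable; fun_prop
  · apply StronglyMeasurable.integral_prod_right
    apply Measurable.stronglyMeasurable
    have := hf.measurable
    unfold Function.uncurry
    fun_prop

lemma st_finite {p β μ : ℝ} (hp : 1 ≤ p) (h1 : 0 < β - 1 / p) (h2 : β - 1 / p < μ)
    (f : ℝ → ℂ) (hf : StronglyMeasurable f)
    (hfp : MemLp f (ENNReal.ofReal p) (volume.restrict (Set.Ioi (0 : ℝ)))) :
    ∀ᵐ t ∂(volume.restrict (Set.Ioi (0 : ℝ))),
          IntegrableOn (fun s : ℝ => ((s ^ (β - 1) * (t + s) ^ (-μ) : ℝ) : ℂ) * f s)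
            (Set.Ioi 0) := by
  have hp0 : 0 < p := by linarith
  have hfm := hf.measurable
  have hlt := lintegral_rpow_enorm_lt_top_of_eLpNorm_lt_top (by simpa using hp0)
    ENNReal.ofReal_ne_top hfp.2
  rw [ENNReal.toReal_ofReal hp0.le] at hlt
  have hu := st_upper hp h1 h2 (fun t => ‖f t‖ₑ) (by fun_prop)
  have hfin := ne_of_lt (hu.trans_lt (ENNReal.mul_lt_top (ENNReal.rpow_lt_top_of_nonneg hp0.le
    ENNReal.ofReal_ne_top) hlt))
  have hae := ae_lt_top (by
    apply Measurable.pow_const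
    apply Measurable.lintegral_prod_right
    unfold Function.uncurry
    fun_prop) hfin
  filter_upwards [hae, ae_restrict_mem measurableSet_Ioi] with t ht ht0
  have ht0 : (0:ℝ) < t := ht0
  rw [← st_enorm β μ f ht0, ENNReal.rpow_lt_top_iff_of_pos hp0] at ht
  refine ⟨by apply Measurable.aestronglyMeasurable; fun_prop, ?_⟩
  rw [hasFiniteIntegral_iff_enorm]
  by_contra hn
  rw [not_lt, top_le_iff] at hn
  rw [hn, ENNReal.mul_top] at ht
  · exact lt_irrefl _ ht
  · have : 0 < t ^ (μ - β) := by positivity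
    simpa using this

lemma st_bound {p β μ : ℝ} (hp : 1 ≤ p) (h1 : 0 < β - 1 / p) (h2 : β - 1 / p < μ)
    (f : ℝ → ℂ) (hf : StronglyMeasurable f) :
    eLpNorm (SOp β μ f) (ENNReal.ofReal p) (volume.restrict (Set.Ioi (0 : ℝ))) ≤
      ENNReal.ofReal (Real.Gamma (β - 1 / p) * Real.Gamma (μ - β + 1 / p) /
        Real.Gamma ((β - 1 / p) + (μ - β + 1 / p))) *
      eLpNorm f (ENNReal.ofReal p) (volume.restrict (Set.Ioi (0 : ℝ))) := by
  have hp0 : 0 < p := by linarith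
  have hfm := hf.measurable
  have hu := st_upper hp h1 h2 (fun t => ‖f t‖ₑ) (by fun_prop)
  have hz : ENNReal.ofReal p ≠ 0 := by simpa using hp0
  rw [eLpNorm_eq_lintegral_rpow_enorm_toReal hz ENNReal.ofReal_ne_top,
    eLpNorm_eq_lintegral_rpow_enorm_toReal hz ENNReal.ofReal_ne_top, ENNReal.toReal_ofReal hp0.le]
  have := ENNReal.rpow_le_rpow hu (z := 1 / p) (by positivity)
  rw [ENNReal.mul_rpow_of_nonneg _ _ (by positivity), ← ENNReal.rpow_mul,
    mul_one_div_cancel hp0.ne', ENNReal.rpow_one] at this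
  refine le_trans ?_ this
  gcongr 1
  refine setLIntegral_mono' measurableSet_Ioi fun t ht => ?_
  gcongr
  exact st_SOp_le β μ f ht

lemma st_SOp_congr (β μ : ℝ) {f g : ℝ → ℂ} (h : f =ᵐ[volume.restrict (Set.Ioi (0 : ℝ))] g) :
    SOp β μ f = SOp β μ g := by
  funext t
  unfold SOp
  congr 1
  apply integral_congr_ae
  filter_upwards [h] with s hs
  rw [hs]

lemma st_op (p β μ : ℝ) (hp : 1 ≤ p) [Fact (1 ≤ ENNReal.ofReal p)]
    (h1 : 0 < β - 1 / p) (h2 : β - 1 / p < μ) :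
    ∃ T : Lp ℂ (ENNReal.ofReal p) (volume.restrict (Set.Ioi (0 : ℝ))) →L[ℂ]
          Lp ℂ (ENNReal.ofReal p) (volume.restrict (Set.Ioi (0 : ℝ))),
      (∀ f : Lp ℂ (ENNReal.ofReal p) (volume.restrict (Set.Ioi (0 : ℝ))),
        (T f) =ᵐ[volume.restrict (Set.Ioi (0 : ℝ))] SOp β μ f) ∧
      ‖T‖ ≤ Real.Gamma (β - 1 / p) * Real.Gamma (μ - β + 1 / p) /
        Real.Gamma ((β - 1 / p) + (μ - β + 1 / p)) := by
  have hb : 0 < μ - β + 1 / p := by linarith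
  have hA := Real.Gamma_pos_of_pos h1
  have hB := Real.Gamma_pos_of_pos hb
  have hAB := Real.Gamma_pos_of_pos (add_pos h1 hb)
  have hmem : ∀ f : Lp ℂ (ENNReal.ofReal p) (volume.restrict (Set.Ioi (0 : ℝ))),
      MemLp (SOp β μ f) (ENNReal.ofReal p) (volume.restrict (Set.Ioi (0 : ℝ))) := fun f =>
    ⟨(st_meas β μ f (Lp.stronglyMeasurable f)).aestronglyMeasurable,
      (st_bound hp h1 h2 f (Lp.stronglyMeasurable f)).trans_lt
        (ENNReal.mul_lt_top ENNReal.ofReal_lt_top (Lp.memLp f).2)⟩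
  have hIntegrable := fun f : Lp ℂ (ENNReal.ofReal p) (volume.restrict (Set.Ioi (0 : ℝ))) =>
    st_finite hp h1 h2 f (Lp.stronglyMeasurable f) (Lp.memLp f)
  let L : Lp ℂ (ENNReal.ofReal p) (volume.restrict (Set.Ioi (0 : ℝ))) →ₗ[ℂ]
          Lp ℂ (ENNReal.ofReal p) (volume.restrict (Set.Ioi (0 : ℝ))) :=
    { toFun := fun f => (hmem f).toLp
      map_add' := by
        intro f g
        rw [← MemLp.toLp_add]
        apply MemLp.toLp_congr
        rw [st_SOp_congr β μ (Lp.coeFn_add f g)]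
        filter_upwards [hIntegrable f, hIntegrable g] with t hf hg
        simp only [SOp, Pi.add_apply, mul_add]
        rw [integral_add hf hg, mul_add]
      map_smul' := by
        intro c f
        simp only [RingHom.id_apply]
        rw [← MemLp.toLp_const_smul]
        apply MemLp.toLp_congr
        rw [st_SOp_congr β μ (Lp.coeFn_smul c f)]
        refine Filter.Eventually.of_forall fun t => ?_
        simp only [SOp, Pi.smul_apply, smul_eq_mul]
        rw [mul_left_comm c, ← integral_const_mul c]
        congr 2
        funext s
        ring }
  refine ⟨L.mkContinuous _ ?_, ?_, L.mkContinuous_norm_le (by positivity) ?_⟩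
  rotate_left
  · intro f
    exact (hmem f).coeFn_toLp
  rotate_left
  all_goals
    intro f
    change ‖(hmem f).toLp‖ ≤ _
    rw [Lp.norm_toLp, Lp.norm_def]
    have := ENNReal.toReal_mono (ENNReal.mul_ne_top ENNReal.ofReal_ne_top (Lp.memLp f).2.ne)
      (st_bound hp h1 h2 f (Lp.stronglyMeasurable f))
    rwa [ENNReal.toReal_mul, ENNReal.toReal_ofReal (by positivity)] at this

lemma st_lower_aux {p β μ : ℝ} (hp : 1 ≤ p) [Fact (1 ≤ ENNReal.ofReal p)]
    (h1 : 0 < β - 1 / p) (h2 : β - 1 / p < μ)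
    (T : Lp ℂ (ENNReal.ofReal p) (volume.restrict (Set.Ioi (0 : ℝ))) →L[ℂ]
          Lp ℂ (ENNReal.ofReal p) (volume.restrict (Set.Ioi (0 : ℝ))))
    (hT : ∀ f : Lp ℂ (ENNReal.ofReal p) (volume.restrict (Set.Ioi (0 : ℝ))),
        (T f) =ᵐ[volume.restrict (Set.Ioi (0 : ℝ))] SOp β μ f)
    {a ε : ℝ} (ha : 0 < a) (hε : 0 < ε) :
    ENNReal.ofReal (a ^ ε) * (∫⁻ u in Set.Ioi a, ENNReal.ofReal
      (u ^ (β - 1) * (1 + u) ^ (-μ) * u ^ (-1 / p - ε))) ≤ ‖T‖ₑ := by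
  have hp0 : 0 < p := by linarith
  have hz : ENNReal.ofReal p ≠ 0 := by simpa using hp0
  set C := ∫⁻ u in Set.Ioi a, ENNReal.ofReal
      (u ^ (β - 1) * (1 + u) ^ (-μ) * u ^ (-1 / p - ε)) with hC
  -- the test function
  set h : ℝ → ℝ := (Set.Ioi (1:ℝ)).indicator (fun s => s ^ (-1 / p - ε)) with hh
  have hhm : Measurable h := by
    rw [hh]
    exact Measurable.indicator (by fun_prop) measurableSet_Ioi
  have hh0 : ∀ s, 0 ≤ h s := by
    intro s
    apply Set.indicator_nonneg
    intro s hs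
    have : (1:ℝ) < s := hs
    positivity
  have hpow : ∀ c : ℝ, 0 < c → ∫⁻ s in Set.Ioi c, ENNReal.ofReal (s ^ (-1 / p - ε)) ^ p
      = ENNReal.ofReal (c ^ (-(ε * p)) / (ε * p)) := by
    intro c hc
    have hεp : 0 < ε * p := by positivity
    have e1 : ∀ s ∈ Set.Ioi c, ENNReal.ofReal (s ^ (-1 / p - ε)) ^ p
        = ENNReal.ofReal (s ^ (-1 - ε * p)) := by
      intro s hs
      have hs : 0 < s := hc.trans hs
      rw [ENNReal.ofReal_rpow_of_nonneg (by positivity) hp0.le, ← Real.rpow_mul hs.le]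
      congr 2
      field_simp
    rw [setLIntegral_congr_fun measurableSet_Ioi e1, ← ofReal_integral_eq_lintegral_ofReal
      (integrableOn_Ioi_rpow_of_lt (by linarith) hc),
      integral_Ioi_rpow_of_lt (by linarith) hc]
    · congr 1
      rw [show -1 - ε * p + 1 = -(ε * p) by ring]
      rw [neg_div_neg_eq]
    · filter_upwards [ae_restrict_mem measurableSet_Ioi] with x hx
      have : (0:ℝ) < x := hc.trans hx
      positivity
  have hfnorm : ∀ s, ‖(h s : ℂ)‖ₑ = ENNReal.ofReal (h s) := by
    intro s
    rw [← ofReal_norm, Complex.norm_real, Real.norm_of_nonneg (hh0 s)]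
  have hfint : ∫⁻ s in Set.Ioi (0:ℝ), ‖(h s : ℂ)‖ₑ ^ p = ENNReal.ofReal (1 / (ε * p)) := by
    have e2 : ∀ s, ‖(h s : ℂ)‖ₑ ^ p = (Set.Ioi (1:ℝ)).indicator
        (fun s => ENNReal.ofReal (s ^ (-1 / p - ε)) ^ p) s := by
      intro s
      rw [hfnorm, hh]
      by_cases hs : s ∈ Set.Ioi (1:ℝ)
      · simp [hs]
      · simp [hs, hp0]
    simp_rw [e2]
    rw [setLIntegral_indicator measurableSet_Ioi, Set.inter_eq_left.mpr
      (Set.Ioi_subset_Ioi zero_le_one), hpow 1 one_pos, Real.one_rpow]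
  have hfm : StronglyMeasurable (fun s => (h s : ℂ)) := by
    apply Measurable.stronglyMeasurable; fun_prop
  have hfe : eLpNorm (fun s => (h s : ℂ)) (ENNReal.ofReal p) (volume.restrict (Set.Ioi (0 : ℝ)))
      = ENNReal.ofReal (1 / (ε * p)) ^ (1 / p) := by
    rw [eLpNorm_eq_lintegral_rpow_enorm_toReal hz ENNReal.ofReal_ne_top,
      ENNReal.toReal_ofReal hp0.le, hfint]
  have hmem : MemLp (fun s => (h s : ℂ)) (ENNReal.ofReal p)
      (volume.restrict (Set.Ioi (0 : ℝ))) := by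
    refine ⟨hfm.aestronglyMeasurable, ?_⟩
    rw [hfe]
    exact ENNReal.rpow_lt_top_of_nonneg (by positivity) ENNReal.ofReal_ne_top
  have hle := T.le_opENorm hmem.toLp
  rw [Lp.enorm_def, Lp.enorm_def, eLpNorm_congr_ae hmem.coeFn_toLp, eLpNorm_congr_ae (hT _),
    st_SOp_congr β μ hmem.coeFn_toLp, hfe,
    eLpNorm_eq_lintegral_rpow_enorm_toReal hz ENNReal.ofReal_ne_top,
    ENNReal.toReal_ofReal hp0.le] at hle
  have hle2 := ENNReal.rpow_le_rpow hle hp0.le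
  rw [ENNReal.mul_rpow_of_nonneg _ _ hp0.le, ← ENNReal.rpow_mul, ← ENNReal.rpow_mul,
    one_div_mul_cancel hp0.ne', ENNReal.rpow_one, ENNReal.rpow_one] at hle2
  have hlow : C ^ p * ENNReal.ofReal ((1 / a) ^ (-(ε * p)) / (ε * p)) ≤
      ∫⁻ t in Set.Ioi (0:ℝ), ‖SOp β μ (fun s => (h s : ℂ)) t‖ₑ ^ p := by
    have hsub : Set.Ioi (1 / a) ⊆ Set.Ioi (0:ℝ) := Set.Ioi_subset_Ioi (by positivity)
    refine le_trans ?_ (lintegral_mono_set hsub)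
    rw [← hpow (1 / a) (by positivity)]
    rw [← lintegral_const_mul _ (by fun_prop)]
    refine lintegral_mono_ae ?_
    filter_upwards [ae_restrict_mem measurableSet_Ioi,
      ae_restrict_of_ae_restrict_of_subset hsub (st_finite hp h1 h2 _ hfm hmem)] with t ht hti
    have ht1 : 1 / a < t := ht
    have ht0 : 0 < t := hsub ht
    rw [← ENNReal.mul_rpow_of_nonneg _ _ hp0.le]
    gcongr
    have hS : ‖SOp β μ (fun s => (h s : ℂ)) t‖ₑ = ∫⁻ u in Set.Ioi (0:ℝ),
        ENNReal.ofReal (u ^ (β - 1) * (1 + u) ^ (-μ)) * ‖(h (t * u) : ℂ)‖ₑ := by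
      have h0 : 0 ≤ t ^ (μ - β) := by positivity
      rw [← st_enorm β μ (fun s => (h s : ℂ)) ht0, SOp, enorm_mul, ← ofReal_norm,
        Complex.norm_real, Real.norm_of_nonneg h0]
      congr 1
      have e3 : ∀ s : ℝ, ((s ^ (β - 1) * (t + s) ^ (-μ) : ℝ) : ℂ) * (h s : ℂ) =
        ((s ^ (β - 1) * (t + s) ^ (-μ) * h s : ℝ) : ℂ) := fun s => by push_cast; ring
      have e4 : 0 ≤ᵐ[volume.restrict (Set.Ioi (0:ℝ))]
          fun s => s ^ (β - 1) * (t + s) ^ (-μ) * h s := by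
        filter_upwards [ae_restrict_mem measurableSet_Ioi] with s hs
        have hs : (0:ℝ) < s := hs
        have := hh0 s
        positivity
      simp_rw [e3] at hti ⊢
      rw [integral_complex_ofReal, ← ofReal_norm, Complex.norm_real,
        Real.norm_of_nonneg (integral_nonneg_of_ae e4), ofReal_integral_eq_lintegral_ofReal
        (by simpa using hti.re) e4]
      refine lintegral_congr_ae ?_
      filter_upwards [e4] with s hs
      rw [← ofReal_norm, Complex.norm_real, Real.norm_of_nonneg hs]
    rw [hS, hC]
    refine le_trans ?_ (lintegral_mono_set (Set.Ioi_subset_Ioi ha.le))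
    rw [← lintegral_mul_const' _ _ ENNReal.ofReal_ne_top]
    refine setLIntegral_mono' measurableSet_Ioi fun u hu => ?_
    have hua : a < u := hu
    have hu0 : 0 < u := ha.trans hua
    have hmem1 : t * u ∈ Set.Ioi (1:ℝ) := by
      have : 1 < t * a := by rwa [div_lt_iff₀ ha] at ht1
      have : t * a < t * u := by gcongr
      simp only [Set.mem_Ioi]; linarith
    rw [hfnorm, hh, Set.indicator_of_mem hmem1, ← ENNReal.ofReal_mul (by positivity),
      ← ENNReal.ofReal_mul (by positivity), Real.mul_rpow ht0.le hu0.le]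
    apply le_of_eq
    congr 1
    ring
  have hfinal := hlow.trans hle2
  have hεp : 0 < ε * p := by positivity
  rw [show (1 / a) ^ (-(ε * p)) / (ε * p) = (a ^ ε) ^ p * (1 / (ε * p)) by
      rw [one_div, Real.inv_rpow ha.le, Real.rpow_neg ha.le, inv_inv, ← Real.rpow_mul ha.le]; ring,
    ENNReal.ofReal_mul (by positivity), ← mul_assoc,
    ENNReal.mul_le_mul_iff_left (ENNReal.ofReal_pos.mpr (by positivity)).ne' ENNReal.ofReal_ne_top,
    ← ENNReal.ofReal_rpow_of_nonneg (by positivity) hp0.le,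
    ← ENNReal.mul_rpow_of_nonneg _ _ hp0.le, ENNReal.rpow_le_rpow_iff hp0, mul_comm] at hfinal
  exact hfinal

lemma st_lower {p β μ : ℝ} (hp : 1 ≤ p) [Fact (1 ≤ ENNReal.ofReal p)]
    (h1 : 0 < β - 1 / p) (h2 : β - 1 / p < μ)
    (T : Lp ℂ (ENNReal.ofReal p) (volume.restrict (Set.Ioi (0 : ℝ))) →L[ℂ]
          Lp ℂ (ENNReal.ofReal p) (volume.restrict (Set.Ioi (0 : ℝ))))
    (hT : ∀ f : Lp ℂ (ENNReal.ofReal p) (volume.restrict (Set.Ioi (0 : ℝ))),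
        (T f) =ᵐ[volume.restrict (Set.Ioi (0 : ℝ))] SOp β μ f) :
    Real.Gamma (β - 1 / p) * Real.Gamma (μ - β + 1 / p) /
        Real.Gamma ((β - 1 / p) + (μ - β + 1 / p)) ≤ ‖T‖ := by
  have hb : 0 < μ - β + 1 / p := by linarith
  rw [← ENNReal.ofReal_le_ofReal_iff (norm_nonneg _), ofReal_norm, ← st_beta h1 hb]
  set a : ℕ → ℝ := fun n => Real.exp (-((n:ℝ) + 1)) with ha
  set ε : ℕ → ℝ := fun n => 1 / ((n:ℝ) + 1) * (1 / ((n:ℝ) + 1)) with hε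
  set F : ℕ → ℝ → ENNReal := fun n => (Set.Ioi (a n)).indicator fun u =>
    ENNReal.ofReal (a n ^ ε n) * ENNReal.ofReal
      (u ^ (β - 1) * (1 + u) ^ (-μ) * u ^ (-1 / p - ε n)) with hF
  have ha0 : ∀ n, 0 < a n := fun n => Real.exp_pos _
  have hε0 : ∀ n, 0 < ε n := fun n => by simp only [hε]; positivity
  have hFm : ∀ n, Measurable (F n) := fun n =>
    Measurable.indicator (by fun_prop) measurableSet_Ioi
  have hFi : ∀ n, ∫⁻ u in Set.Ioi (0:ℝ), F n u ≤ ‖T‖ₑ := by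
    intro n
    simp only [hF]
    rw [setLIntegral_indicator measurableSet_Ioi, Set.inter_eq_left.mpr
      (Set.Ioi_subset_Ioi (ha0 n).le), lintegral_const_mul' _ _ ENNReal.ofReal_ne_top]
    exact st_lower_aux hp h1 h2 T hT (ha0 n) (hε0 n)
  have hlim1 : Filter.Tendsto (fun n : ℕ => 1 / ((n:ℝ) + 1)) Filter.atTop (nhds 0) :=
    tendsto_one_div_add_atTop_nhds_zero_nat
  have hlime : Filter.Tendsto ε Filter.atTop (nhds 0) := by
    have := hlim1.mul hlim1
    rwa [mul_zero] at this
  have hlima : Filter.Tendsto (fun n => a n ^ ε n) Filter.atTop (nhds 1) := by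
    have e : ∀ n, a n ^ ε n = Real.exp (-(1 / ((n:ℝ) + 1))) := by
      intro n
      simp only [ha, hε]
      rw [← Real.exp_mul]
      congr 1
      have : (n:ℝ) + 1 ≠ 0 := by positivity
      field_simp
    simp_rw [e]
    have := (Real.continuous_exp.tendsto _).comp hlim1.neg
    rwa [neg_zero, Real.exp_zero] at this
  have hlima0 : Filter.Tendsto a Filter.atTop (nhds 0) := by
    refine Real.tendsto_exp_neg_atTop_nhds_zero.comp ?_
    exact Filter.tendsto_atTop_add_const_right _ _ tendsto_natCast_atTop_atTop
  have hpt : ∀ u ∈ Set.Ioi (0:ℝ), ENNReal.ofReal (u ^ (β - 1 / p - 1) *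
      (1 + u) ^ (-(β - 1 / p + (μ - β + 1 / p)))) =
      Filter.liminf (fun n => F n u) Filter.atTop := by
    intro u hu
    have hu : (0:ℝ) < u := hu
    symm
    apply Filter.Tendsto.liminf_eq
    have hev : ∀ᶠ n in Filter.atTop, ENNReal.ofReal (a n ^ ε n *
      (u ^ (β - 1) * (1 + u) ^ (-μ) * u ^ (-1 / p - ε n))) = F n u := by
      filter_upwards [hlima0.eventually_lt_const hu] with n hn
      simp only [hF]
      rw [Set.indicator_of_mem (show u ∈ Set.Ioi (a n) from hn), ENNReal.ofReal_mul]
      exact (Real.rpow_pos_of_pos (ha0 n) _).le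
    refine Filter.Tendsto.congr' hev ?_
    apply ENNReal.tendsto_ofReal
    have hc : Filter.Tendsto (fun n => u ^ (-1 / p - ε n)) Filter.atTop (nhds (u ^ (-1 / p - 0))) :=
      (Real.continuous_const_rpow hu.ne').continuousAt.tendsto.comp (tendsto_const_nhds.sub hlime)
    convert hlima.mul (hc.const_mul (u ^ (β - 1) * (1 + u) ^ (-μ))) using 2
    rw [show β - 1 / p - 1 = (β - 1) + (-1 / p - 0) by ring, Real.rpow_add hu,
      show -(β - 1 / p + (μ - β + 1 / p)) = -μ by ring]
    ring
  rw [setLIntegral_congr_fun measurableSet_Ioi hpt]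
  refine (lintegral_liminf_le hFm).trans ?_
  refine (Filter.liminf_le_liminf (Filter.Eventually.of_forall hFi)).trans ?_
  simp

theorem stmt11 (p β μ : ℝ) (hp : 1 ≤ p) [Fact (1 ≤ ENNReal.ofReal p)]
    (h1 : 0 < β - 1 / p) (h2 : β - 1 / p < μ) :
    ∃ T : Lp ℂ (ENNReal.ofReal p) (volume.restrict (Set.Ioi (0 : ℝ))) →L[ℂ]
          Lp ℂ (ENNReal.ofReal p) (volume.restrict (Set.Ioi (0 : ℝ))),
      (∀ f : Lp ℂ (ENNReal.ofReal p) (volume.restrict (Set.Ioi (0 : ℝ))),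
        ∀ᵐ t ∂(volume.restrict (Set.Ioi (0 : ℝ))),
          IntegrableOn (fun s : ℝ => ((s ^ (β - 1) * (t + s) ^ (-μ) : ℝ) : ℂ) * f s)
            (Set.Ioi 0) ∧
          (T f) t = SOp β μ f t) ∧
      ‖T‖ = Real.Gamma (β - 1 / p) * Real.Gamma (μ - β + 1 / p) /
        Real.Gamma ((β - 1 / p) + (μ - β + 1 / p)) := by
  obtain ⟨T, hT, hle⟩ := st_op p β μ hp h1 h2
  refine ⟨T, fun f => ?_, le_antisymm hle (st_lower hp h1 h2 T hT)⟩
  exact (st_finite hp h1 h2 f (Lp.stronglyMeasurable f) (Lp.memLp f)).and (hT f)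
end

section
/- Let 1 ≤ p < ∞, β, μ ∈ ℝ with 0 < β − 1/p < μ, and let T be a bounded linear operator on the complex Lebesgue space L^p(0,∞) such that for every f ∈ L^p(0,∞), (Tf)(t) = S_{β,μ}f(t) for almost every t > 0. Then the spectrum of T equals { Γ(β−1/p+iξ)Γ(μ−β+1/p−iξ)/Γ(μ) : ξ ∈ ℝ } ∪ {0}. -/
open MeasureTheory

lemma aux_exists_char {B : Type*} [NormedRing B] [NormedAlgebra ℂ B] [CompleteSpace B]
    (S : Set B) (hS : ∀ x ∈ S, ∀ y ∈ S, x * y = y * x) (a : B) (ha : a ∈ S) (z : ℂ)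
    (hz : z ∈ spectrum ℂ a) :
    ∃ A : Subalgebra ℂ B, S ⊆ A ∧ ∃ φ : B →L[ℂ] ℂ, φ 1 = 1 ∧
      (∀ x ∈ A, ∀ y ∈ A, φ (x * y) = φ x * φ y) ∧ φ a = z ∧
      ∀ x ∈ A, ‖φ x‖ ≤ ‖x‖ * ‖(1 : B)‖ := by
  let A : Subalgebra ℂ B := Subalgebra.centralizer ℂ (Set.centralizer S)
  have hSA : S ⊆ A := Set.subset_centralizer_centralizer
  have hcl : IsClosed (A : Set B) := Set.isClosed_centralizer _
  have hcomm : ∀ x y : A, x * y = y * x := by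
    rintro ⟨x, hx⟩ ⟨y, hy⟩
    exact Subtype.ext (Set.centralizer_centralizer_comm_of_comm hS x hx y hy)
  let _ : NormedCommRing A := { (inferInstance : NormedRing A) with mul_comm := hcomm }
  have : CompleteSpace A := hcl.completeSpace_coe
  have hz' : z ∈ spectrum ℂ (⟨a, hSA ha⟩ : A) := by
    exact AlgHom.spectrum_apply_subset A.val (⟨a, hSA ha⟩ : A) hz
  have : Nontrivial A := by
    by_contra h
    rw [not_nontrivial_iff_subsingleton] at h
    have : spectrum ℂ (⟨a, hSA ha⟩ : A) = ∅ := spectrum.of_subsingleton _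
    rw [this] at hz'
    exact hz'
  obtain ⟨f, hf⟩ := WeakDual.CharacterSpace.mem_spectrum_iff_exists.1 hz'
  obtain ⟨φ, hφ, -⟩ := exists_extension_norm_eq (Subalgebra.toSubmodule A)
    (WeakDual.CharacterSpace.toCLM f)
  have hφ' : ∀ x (hx : x ∈ A), φ x = f ⟨x, hx⟩ := fun x hx => hφ ⟨x, hx⟩
  refine ⟨A, hSA, φ, ?_, ?_, ?_, ?_⟩
  · rw [hφ' 1 A.one_mem]; exact map_one f
  · intro x hx y hy
    rw [hφ' _ hx, hφ' _ hy, hφ' _ (A.mul_mem hx hy)]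
    exact map_mul f ⟨x, hx⟩ ⟨y, hy⟩
  · rw [hφ' _ (hSA ha)]; exact hf
  · intro x hx
    rw [hφ' _ hx]
    exact AlgHom.norm_apply_le_self_mul_norm_one (𝕜 := ℂ) f (⟨x, hx⟩ : A)

lemma aux_char_real (c : ℝ → ℂ) (hc : Continuous c) (hadd : ∀ x y, c (x + y) = c x * c y)
    (h0 : c 0 = 1) (hb : ∀ x, ‖c x‖ ≤ 1) :
    ∃ ξ : ℝ, ∀ x : ℝ, c x = Complex.exp (-(Complex.I * ξ * x)) := by
  let F : ℝ → ℂ := fun x => ∫ u in (0 : ℝ)..x, c u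
  have hF : ∀ x, HasDerivAt F (c x) x := fun x =>
    intervalIntegral.integral_hasDerivAt_right (hc.intervalIntegrable _ _)
      (hc.stronglyMeasurableAtFilter _ _) hc.continuousAt
  obtain ⟨δ, hδ⟩ : ∃ δ, F δ ≠ 0 := by
    by_contra! h
    have : F = fun _ => 0 := funext h
    have h1 := hF 0
    rw [this, h0] at h1
    exact one_ne_zero (h1.unique (hasDerivAt_const _ _))
  have hFa : ∀ x, c x * F δ = F (x + δ) - F x := by
    intro x
    have : F (x + δ) - F x = ∫ u in x..(x + δ), c u :=
      intervalIntegral.integral_interval_sub_left (hc.intervalIntegrable _ _)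
        (hc.intervalIntegrable _ _)
    rw [this]
    have h2 := intervalIntegral.integral_comp_add_left (a := 0) (b := δ) (fun u => c u) x
    rw [add_zero] at h2
    rw [← h2]
    simp only [hadd, intervalIntegral.integral_const_mul, F]
  have hder : ∀ x, HasDerivAt c ((c (x + δ) - c x) / F δ) x := by
    intro x
    have e : c = fun x => (F (x + δ) - F x) / F δ := by
      funext x; rw [← hFa, mul_div_cancel_right₀ _ hδ]
    have h3 : HasDerivAt (fun x => F (x + δ)) (c (x + δ)) x := (hF (x + δ)).comp_add_const x δ
    have := (h3.sub (hF x)).div_const (F δ)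
    rw [e]
    rw [e] at this
    exact this
  set l : ℂ := (c δ - 1) / F δ with hl
  have hder' : ∀ x, HasDerivAt c (l * c x) x := by
    intro x
    have := hder x
    rw [hadd] at this
    convert this using 1
    rw [hl]; ring
  have hexp : ∀ x : ℝ, c x = Complex.exp (l * x) := by
    have hg : ∀ x : ℝ, HasDerivAt (fun x : ℝ => c x * Complex.exp (-(l * x))) 0 x := by
      intro x
      have h4 : HasDerivAt (fun x : ℝ => Complex.exp (-(l * x)))
          (Complex.exp (-(l * x)) * (-(l * 1))) x := by
        have h5 : HasDerivAt (fun x : ℝ => (x : ℂ)) 1 x := Complex.ofRealCLM.hasDerivAt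
        exact ((h5.const_mul l).neg).cexp
      exact ((hder' x).mul h4).congr_deriv (by ring)
    intro x
    have h6 := is_const_of_deriv_eq_zero (fun y => (hg y).differentiableAt)
      (fun y => (hg y).deriv) x 0
    simp only [h0, Complex.ofReal_zero, mul_zero, neg_zero, Complex.exp_zero, mul_one] at h6
    rw [Complex.exp_neg] at h6
    field_simp at h6
    exact h6
  have hre : l.re = 0 := by
    have h1 := hb 1
    have h2 := hb (-1)
    rw [hexp, Complex.norm_exp, Real.exp_le_one_iff] at h1 h2
    simp at h1 h2
    linarith
  refine ⟨-l.im, fun x => ?_⟩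
  rw [hexp]
  congr 1
  have : l = Complex.I * l.im := by
    apply Complex.ext <;> simp [hre]
  rw [this]
  push_cast
  simp

noncomputable def kk (a b x : ℝ) : ℝ := Real.sigmoid x ^ b * Real.sigmoid (-x) ^ a

lemma kk_pos (a b x : ℝ) : 0 < kk a b x :=
  mul_pos (Real.rpow_pos_of_pos (Real.sigmoid_pos _) _) (Real.rpow_pos_of_pos (Real.sigmoid_pos _) _)

lemma kk_continuous (a b : ℝ) : Continuous (kk a b) := by
  have h : Continuous Real.sigmoid := by fun_prop
  unfold kk
  refine Continuous.mul ?_ ?_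
  · exact h.rpow_const (fun x => Or.inl (Real.sigmoid_pos x).ne')
  · exact (h.comp continuous_neg).rpow_const (fun x => Or.inl (Real.sigmoid_pos (-x)).ne')

lemma sig_eq (x : ℝ) : Real.sigmoid x = Real.exp x * Real.sigmoid (-x) := by
  have := Real.sigmoid_mul_rexp_neg (-x)
  rw [neg_neg] at this
  rw [← this, mul_comm]

lemma kk_mul_exp (a b d x : ℝ) : kk a b x * Real.exp (d * x) = kk (a - d) (b + d) x := by
  unfold kk
  have h1 := Real.sigmoid_pos x
  have h2 := Real.sigmoid_pos (-x)
  rw [Real.rpow_add h1, Real.rpow_sub h2]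
  have : Real.sigmoid x ^ d = Real.exp (d * x) * Real.sigmoid (-x) ^ d := by
    conv_lhs => rw [sig_eq x]
    rw [Real.mul_rpow (Real.exp_pos _).le h2.le, ← Real.exp_mul, mul_comm x d]
  rw [this]
  have := (Real.rpow_pos_of_pos h2 d).ne'
  field_simp

lemma kk_integrable_of_eq (a b : ℝ) (ha : 0 < a) (hb : 0 < b) (ξ : ℝ) :
    Integrable (fun x => (kk a b x : ℂ) * Complex.exp (-(Complex.I * ξ * x))) ∧
    ∫ x, (kk a b x : ℂ) * Complex.exp (-(Complex.I * ξ * x)) =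
      Complex.Gamma (a + Complex.I * ξ) * Complex.Gamma (b - Complex.I * ξ) /
        Complex.Gamma (a + b) := by
  have hre1 : 0 < (b - Complex.I * ξ : ℂ).re := by simpa using hb
  have hre2 : 0 < (a + Complex.I * ξ : ℂ).re := by simpa using ha
  let g : ℝ → ℂ := fun s => (s : ℂ) ^ ((b - Complex.I * ξ : ℂ) - 1) *
    (1 - (s : ℂ)) ^ ((a + Complex.I * ξ : ℂ) - 1)
  have himg : Real.sigmoid '' Set.univ = Set.Ioo 0 1 := by
    rw [Set.image_univ, Real.range_sigmoid]
  have hpt : ∀ x : ℝ, |Real.sigmoid x * (1 - Real.sigmoid x)| • g (Real.sigmoid x) =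
      (kk a b x : ℂ) * Complex.exp (-(Complex.I * ξ * x)) := by
    intro x
    have h1 := Real.sigmoid_pos x
    have h2 := Real.sigmoid_pos (-x)
    have h3 : 1 - Real.sigmoid x = Real.sigmoid (-x) := (Real.sigmoid_neg x).symm
    have h1' : (Real.sigmoid x : ℂ) ≠ 0 := by exact_mod_cast h1.ne'
    have h2' : (Real.sigmoid (-x) : ℂ) ≠ 0 := by exact_mod_cast h2.ne'
    have h3' : 1 - (Real.sigmoid x : ℂ) = (Real.sigmoid (-x) : ℂ) := by rw [← h3]; push_cast; rfl
    simp only [g]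
    rw [h3', h3, abs_of_pos (mul_pos h1 h2), Complex.real_smul, kk]
    push_cast
    rw [Complex.cpow_sub _ _ h1', Complex.cpow_sub _ _ h2', Complex.cpow_one, Complex.cpow_one,
      Complex.ofReal_cpow h1.le, Complex.ofReal_cpow h2.le, Complex.cpow_sub _ _ h1',
      Complex.cpow_add _ _ h2']
    have : (Real.sigmoid x : ℂ) ^ (Complex.I * ξ) =
        Complex.exp (Complex.I * ξ * x) * (Real.sigmoid (-x) : ℂ) ^ (Complex.I * ξ) := by
      conv_lhs => rw [sig_eq x]
      push_cast
      rw [← Complex.ofReal_exp, Complex.mul_cpow_ofReal_nonneg (Real.exp_pos _).le h2.le]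
      congr 1
      rw [Complex.cpow_def_of_ne_zero (by exact_mod_cast (Real.exp_pos x).ne'),
        ← Complex.ofReal_log (Real.exp_pos x).le, Real.log_exp]
      congr 1; ring
    rw [this, Complex.exp_neg]
    have h5 := Complex.exp_ne_zero (Complex.I * ξ * x)
    have h6 : (Real.sigmoid (-x) : ℂ) ^ (Complex.I * ξ) ≠ 0 := by
      rw [Ne, Complex.cpow_eq_zero_iff]; tauto
    field_simp
  have hconv := Complex.betaIntegral_convergent hre1 hre2
  rw [intervalIntegrable_iff_integrableOn_Ioo_of_le zero_le_one] at hconv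
  have hd : ∀ x ∈ Set.univ, HasDerivWithinAt Real.sigmoid
      (Real.sigmoid x * (1 - Real.sigmoid x)) Set.univ x :=
    fun x _ => (Real.hasDerivAt_sigmoid x).hasDerivWithinAt
  have hi : Integrable (fun x => (kk a b x : ℂ) * Complex.exp (-(Complex.I * ξ * x))) := by
    have := (integrableOn_image_iff_integrableOn_abs_deriv_smul MeasurableSet.univ hd
      Real.sigmoid_injective.injOn g).1 (by rw [himg]; exact hconv)
    rw [integrableOn_univ] at this
    simpa only [hpt] using this
  refine ⟨hi, ?_⟩
  have := integral_image_eq_integral_abs_deriv_smul MeasurableSet.univ hd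
      Real.sigmoid_injective.injOn g
  rw [himg, Measure.restrict_univ] at this
  simp only [hpt] at this
  rw [← this]
  have h7 := Complex.Gamma_mul_Gamma_eq_betaIntegral hre1 hre2
  have e1 : (b - Complex.I * ξ : ℂ) + (a + Complex.I * ξ) = a + b := by ring
  rw [e1] at h7
  have h8 : Complex.Gamma (a + b) ≠ 0 := by
    apply Complex.Gamma_ne_zero_of_re_pos
    simp; linarith
  rw [mul_comm (Complex.Gamma _), h7, mul_div_cancel_left₀ _ h8, Complex.betaIntegral,
    intervalIntegral.integral_of_le zero_le_one, integral_Ioc_eq_integral_Ioo]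

lemma kk_integrable (a b : ℝ) (ha : 0 < a) (hb : 0 < b) : Integrable (kk a b) := by
  have := (kk_integrable_of_eq a b ha hb 0).1.norm
  simpa [abs_of_pos (kk_pos a b _)] using this

lemma sig_shift (x y : ℝ) : Real.sigmoid (x - y) ≤ Real.exp |y| * Real.sigmoid x := by
  rw [Real.sigmoid_def, Real.sigmoid_def, ← div_eq_mul_inv, le_div_iff₀ (by positivity),
    inv_mul_le_iff₀ (by positivity)]
  have h1 : 1 ≤ Real.exp |y| := Real.one_le_exp (abs_nonneg y)
  have h2 : Real.exp (-x) ≤ Real.exp (-(x-y)) * Real.exp |y| := by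
    rw [← Real.exp_add, Real.exp_le_exp]
    have := neg_abs_le y
    linarith
  nlinarith

lemma kk_shift (a b : ℝ) (ha : 0 < a) (hb : 0 < b) (x y : ℝ) :
    kk a b (x - y) ≤ Real.exp ((a + b) * |y|) * kk a b x := by
  unfold kk
  have h1 := sig_shift x y
  have h2 := sig_shift (-x) (-y)
  rw [abs_neg, show -x - -y = -(x - y) by ring] at h2
  have h1' := Real.rpow_le_rpow (Real.sigmoid_nonneg _) h1 hb.le
  have h2' := Real.rpow_le_rpow (Real.sigmoid_nonneg _) h2 ha.le
  rw [Real.mul_rpow (Real.exp_pos _).le (Real.sigmoid_nonneg _), ← Real.exp_mul] at h1' h2'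
  refine (mul_le_mul h1' h2' (Real.rpow_nonneg (Real.sigmoid_nonneg _) _)
    (mul_nonneg (Real.exp_pos _).le (Real.rpow_nonneg (Real.sigmoid_nonneg _) _))).trans
    (le_of_eq ?_)
  rw [show (a + b) * |y| = |y| * b + |y| * a by ring, Real.exp_add]
  ring

lemma kk_lip (a b : ℝ) (ha : 0 < a) (hb : 0 < b) (x y : ℝ) :
    |kk a b (x - y) - kk a b x| ≤ (Real.exp ((a + b) * |y|) - 1) * kk a b x := by
  have h1 := kk_shift a b ha hb x y
  have h2 := kk_shift a b ha hb (x - y) (-y)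
  rw [abs_neg, sub_neg_eq_add, sub_add_cancel] at h2
  set E := Real.exp ((a + b) * |y|)
  have hE : 1 ≤ E := Real.one_le_exp (by positivity)
  have hx := kk_pos a b x
  have hxy := kk_pos a b (x - y)
  rw [abs_le]
  constructor
  · by_cases h : kk a b x ≤ kk a b (x-y)
    · nlinarith
    · push Not at h
      nlinarith
  · linarith

lemma kk_exp_integrable (a b : ℝ) (ha : 0 < a) (hb : 0 < b) :
    ∃ d > 0, Integrable (fun x => kk a b x * Real.exp (d * |x|)) := by
  refine ⟨min a b / 2, by positivity, ?_⟩
  set d := min a b / 2 with hd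
  have hd0 : 0 < d := by positivity
  have h1 : d < a := by
    have := min_le_left a b; linarith
  have h2 : d < b := by
    have := min_le_right a b; linarith
  have i1 := kk_integrable (a - d) (b + d) (by linarith) (by linarith)
  have i2 := kk_integrable (a - -d) (b + -d) (by linarith) (by linarith)
  refine (i1.add i2).mono' ?_ (Filter.Eventually.of_forall fun x => ?_)
  · exact ((kk_continuous a b).mul (by fun_prop)).aestronglyMeasurable
  · simp only [Pi.add_apply]
    rw [← kk_mul_exp, ← kk_mul_exp, Real.norm_of_nonneg (mul_pos (kk_pos _ _ _) (Real.exp_pos _)).le,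
      ← mul_add]
    refine mul_le_mul_of_nonneg_left ?_ (kk_pos _ _ _).le
    rcases abs_cases x with ⟨h, _⟩ | ⟨h, _⟩ <;> rw [h]
    · linarith [Real.exp_pos (-d * x)]
    · rw [show d * -x = -d * x by ring]; linarith [Real.exp_pos (d * x)]

lemma kk_eps (a b : ℝ) (ha : 0 < a) (hb : 0 < b) (ε : ℝ) (hε : 0 < ε) :
    ∃ d > 0, Integrable (fun x => kk a b x * (Real.exp (d * |x|) - 1)) ∧
      ∫ x, kk a b x * (Real.exp (d * |x|) - 1) < ε := by
  obtain ⟨d, hd, hi⟩ := kk_exp_integrable a b ha hb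
  have hle : ∀ n : ℕ, ∀ x : ℝ, ‖kk a b x * (Real.exp (d / (n + 1) * |x|) - 1)‖ ≤
      kk a b x * Real.exp (d * |x|) := by
    intro n x
    have h1 : 1 ≤ Real.exp (d / (n + 1) * |x|) := Real.one_le_exp (by positivity)
    have h2 : Real.exp (d / (n + 1) * |x|) ≤ Real.exp (d * |x|) := by
      apply Real.exp_le_exp.2
      apply mul_le_mul_of_nonneg_right _ (abs_nonneg x)
      exact div_le_self hd.le (by linarith [n.cast_nonneg (α := ℝ)])
    rw [Real.norm_of_nonneg (mul_nonneg (kk_pos _ _ _).le (by linarith))]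
    exact mul_le_mul_of_nonneg_left (by linarith) (kk_pos _ _ _).le
  have hm : ∀ n : ℕ, AEStronglyMeasurable
      (fun x => kk a b x * (Real.exp (d / (n + 1) * |x|) - 1)) volume := fun n =>
    ((kk_continuous a b).mul (by fun_prop)).aestronglyMeasurable
  have hlim := tendsto_integral_of_dominated_convergence
    (F := fun (n : ℕ) x => kk a b x * (Real.exp (d / (n + 1) * |x|) - 1)) (f := fun _ => 0)
    _ hm hi
    (fun n => Filter.Eventually.of_forall (hle n)) (Filter.Eventually.of_forall fun x => by
      have h1 : Filter.Tendsto (fun n : ℕ => d / ((n : ℝ) + 1)) Filter.atTop (nhds 0) :=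
        by
          have := (tendsto_const_div_atTop_nhds_zero_nat d).comp (Filter.tendsto_add_atTop_nat 1)
          refine this.congr fun n => ?_
          simp
      have h2 : Continuous (fun u : ℝ => kk a b x * (Real.exp (u * |x|) - 1)) := by fun_prop
      have h3 := (h2.tendsto 0).comp h1
      simp only [zero_mul, Real.exp_zero, sub_self, mul_zero] at h3
      exact h3)
  rw [integral_zero] at hlim
  obtain ⟨n, hn⟩ := (hlim.eventually (gt_mem_nhds hε)).exists
  exact ⟨d / (n + 1), by positivity, hi.mono' (hm n) (Filter.Eventually.of_forall (hle n)), hn⟩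

noncomputable abbrev nu : Measure ℝ := volume.restrict (Set.Ioi (0 : ℝ))

noncomputable def dil (p x : ℝ) (f : ℝ → ℂ) (t : ℝ) : ℂ :=
  ((Real.exp (-(x / p)) : ℝ) : ℂ) * f (Real.exp (-x) * t)

lemma kk_eq (a μ x : ℝ) :
    kk a (μ - a) x = (1 + Real.exp (-x)) ^ (-μ) * Real.exp (-(a * x)) := by
  unfold kk
  have h1 := Real.sigmoid_pos x
  rw [← Real.sigmoid_mul_rexp_neg, Real.mul_rpow h1.le (Real.exp_pos _).le, ← Real.exp_mul,
    ← mul_assoc, ← Real.rpow_add h1, Real.sigmoid_def, Real.inv_rpow (by positivity),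
    Real.rpow_neg (by positivity)]
  congr 2
  · congr 2; ring
  · ring

lemma SOp_eq (p β μ : ℝ) (f : ℝ → ℂ) (t : ℝ) (ht : 0 < t) :
    SOp β μ f t = ∫ x, (kk (β - 1 / p) (μ - (β - 1 / p)) x : ℂ) * dil p x f t := by
  unfold SOp
  have himg : (fun x : ℝ => Real.exp (-x) * t) '' Set.univ = Set.Ioi 0 := by
    ext s
    simp only [Set.image_univ, Set.mem_range, Set.mem_Ioi]
    constructor
    · rintro ⟨x, rfl⟩; positivity
    · intro hs
      refine ⟨-Real.log (s / t), ?_⟩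
      rw [neg_neg, Real.exp_log (by positivity)]
      field_simp
  have hd : ∀ x ∈ Set.univ, HasDerivWithinAt (fun x : ℝ => Real.exp (-x) * t)
      (Real.exp (-x) * (-1) * t) Set.univ x := fun x _ =>
    (((hasDerivAt_neg x).exp).mul_const t).hasDerivWithinAt
  have hinj : Set.InjOn (fun x : ℝ => Real.exp (-x) * t) Set.univ := by
    intro x _ y _ h
    have := mul_right_cancel₀ ht.ne' h
    have := Real.exp_injective this
    linarith
  rw [← himg, integral_image_eq_integral_abs_deriv_smul MeasurableSet.univ hd hinj,
    ← integral_const_mul, Measure.restrict_univ]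
  refine integral_congr_ae (Filter.Eventually.of_forall fun x => ?_)
  simp only [dil, Complex.real_smul]
  rw [← mul_assoc, ← mul_assoc, ← mul_assoc, ← Complex.ofReal_mul, ← Complex.ofReal_mul,
    ← Complex.ofReal_mul]
  congr 2
  rw [kk_eq]
  have hE := Real.exp_pos (-x)
  have habs : |Real.exp (-x) * (-1) * t| = Real.exp (-x) * t := by
    rw [show Real.exp (-x) * (-1) * t = -(Real.exp (-x) * t) by ring, abs_neg,
      abs_of_pos (by positivity)]
  rw [habs, show t + Real.exp (-x) * t = t * (1 + Real.exp (-x)) by ring,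
    Real.mul_rpow hE.le ht.le, Real.mul_rpow ht.le (by positivity),
    mul_assoc (_ ^ (-μ)), ← Real.exp_add, ← Real.exp_mul]
  have e1 : Real.exp (-((β - 1 / p) * x) + -(x / p)) = Real.exp (-x) * Real.exp (-x * (β - 1)) := by
    rw [← Real.exp_add]; congr 1; ring
  have e2 : t ^ (μ - β) * (t * t ^ (β - 1) * t ^ (-μ)) = 1 := by
    nth_rewrite 2 [← Real.rpow_one t]
    rw [← Real.rpow_add ht, ← Real.rpow_add ht, ← Real.rpow_add ht]
    rw [show μ - β + (1 + (β - 1) + -μ) = 0 by ring, Real.rpow_zero]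
  rw [e1]
  linear_combination (Real.exp (-x) * Real.exp (-x * (β - 1)) * (1 + Real.exp (-x)) ^ (-μ)) * e2

lemma map_nu (x : ℝ) : nu.map (fun t => Real.exp (-x) * t) = ENNReal.ofReal (Real.exp x) • nu := by
  have hE := Real.exp_pos (-x)
  have h : (fun t => Real.exp (-x) * t) ⁻¹' Set.Ioi 0 = Set.Ioi (0 : ℝ) := by
    ext t; simp [hE]
  have := Measure.restrict_map (μ := volume) (f := fun t => Real.exp (-x) * t)
    (measurable_const_mul _) (s := Set.Ioi (0 : ℝ)) measurableSet_Ioi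
  rw [h] at this
  rw [nu, ← this, Real.map_volume_mul_left hE.ne', Measure.restrict_smul, ← Real.exp_neg, neg_neg,
    abs_of_pos (Real.exp_pos _)]

lemma qmp_nu (x : ℝ) : Measure.QuasiMeasurePreserving (fun t => Real.exp (-x) * t) nu nu := by
  refine ⟨measurable_const_mul _, ?_⟩
  rw [map_nu]
  exact Measure.smul_absolutelyContinuous

lemma dil_congr (p x : ℝ) {f g : ℝ → ℂ} (h : f =ᵐ[nu] g) : dil p x f =ᵐ[nu] dil p x g := by
  filter_upwards [(qmp_nu x).ae_eq_comp h] with t ht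
  simp only [Function.comp_apply] at ht
  simp only [dil, ht]

lemma dil_aesm (p x : ℝ) {f : ℝ → ℂ} (hf : AEStronglyMeasurable f nu) :
    AEStronglyMeasurable (dil p x f) nu :=
  (hf.comp_quasiMeasurePreserving (qmp_nu x)).const_mul _

lemma dil_eLpNorm (p x : ℝ) (hp : 1 ≤ p) {f : ℝ → ℂ} (hf : AEStronglyMeasurable f nu) :
    eLpNorm (dil p x f) (ENNReal.ofReal p) nu = eLpNorm f (ENNReal.ofReal p) nu := by
  have h1 : dil p x f = ((Real.exp (-(x / p)) : ℝ) : ℂ) • (f ∘ fun t => Real.exp (-x) * t) := rfl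
  have hm : AEStronglyMeasurable f (nu.map (fun t => Real.exp (-x) * t)) := by
    rw [map_nu]; exact hf.smul_measure _
  rw [h1, eLpNorm_const_smul, ← eLpNorm_map_measure hm (by fun_prop), map_nu,
    eLpNorm_smul_measure_of_ne_top ENNReal.ofReal_ne_top, smul_eq_mul, ← mul_assoc]
  have h2 : ‖((Real.exp (-(x / p)) : ℝ) : ℂ)‖ₑ = ENNReal.ofReal (Real.exp (-(x / p))) := by
    rw [← ofReal_norm, Complex.norm_real, Real.norm_of_nonneg (Real.exp_pos _).le]
  rw [h2, ENNReal.toReal_div, ENNReal.toReal_one, ENNReal.toReal_ofReal (by linarith),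
    ENNReal.ofReal_rpow_of_pos (Real.exp_pos _), ← ENNReal.ofReal_mul (Real.exp_pos _).le,
    ← Real.exp_mul, ← Real.exp_add]
  rw [show -(x / p) + x * (1 / p) = 0 by ring]
  simp

lemma dil_memLp (p x : ℝ) (hp : 1 ≤ p) {f : ℝ → ℂ} (hf : MemLp f (ENNReal.ofReal p) nu) :
    MemLp (dil p x f) (ENNReal.ofReal p) nu :=
  ⟨dil_aesm p x hf.1, by rw [dil_eLpNorm p x hp hf.1]; exact hf.2⟩

noncomputable def DD (p : ℝ) (hp : 1 ≤ p) [Fact (1 ≤ ENNReal.ofReal p)] (x : ℝ) :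
    Lp ℂ (ENNReal.ofReal p) nu →L[ℂ] Lp ℂ (ENNReal.ofReal p) nu :=
  LinearMap.mkContinuous
    { toFun := fun f => (dil_memLp p x hp (Lp.memLp f)).toLp _
      map_add' := by
        intro f g
        rw [← MemLp.toLp_add]
        refine MemLp.toLp_congr _ _ ?_
        filter_upwards [dil_congr p x (Lp.coeFn_add f g)] with t ht
        rw [ht]; simp [dil, mul_add]
      map_smul' := by
        intro c f
        simp only [RingHom.id_apply]
        rw [← MemLp.toLp_const_smul]
        refine MemLp.toLp_congr _ _ ?_
        filter_upwards [dil_congr p x (Lp.coeFn_smul c f)] with t ht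
        rw [ht]; simp [dil]; ring } 1 (by
    intro f
    simp only [LinearMap.coe_mk, AddHom.coe_mk, one_mul]
    rw [Lp.norm_toLp, dil_eLpNorm p x hp (Lp.aestronglyMeasurable f), Lp.norm_def])

lemma DD_coe (p : ℝ) (hp : 1 ≤ p) [Fact (1 ≤ ENNReal.ofReal p)] (x : ℝ)
    (f : Lp ℂ (ENNReal.ofReal p) nu) : DD p hp x f =ᵐ[nu] dil p x f :=
  MemLp.coeFn_toLp (dil_memLp p x hp (Lp.memLp f))

lemma DD_norm (p : ℝ) (hp : 1 ≤ p) [Fact (1 ≤ ENNReal.ofReal p)] (x : ℝ) : ‖DD p hp x‖ ≤ 1 :=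
  LinearMap.mkContinuous_norm_le _ zero_le_one _

lemma dil_dil (p x y : ℝ) (f : ℝ → ℂ) (t : ℝ) : dil p x (dil p y f) t = dil p (x + y) f t := by
  simp only [dil]
  rw [← mul_assoc, ← Complex.ofReal_mul, ← Real.exp_add, ← mul_assoc, ← Real.exp_add]
  congr 3
  · ring
  · congr 1; ring

lemma DD_add (p : ℝ) (hp : 1 ≤ p) [Fact (1 ≤ ENNReal.ofReal p)] (x y : ℝ) :
    DD p hp (x + y) = DD p hp x * DD p hp y := by
  ext1 f
  apply Lp.ext
  filter_upwards [DD_coe p hp (x + y) f, DD_coe p hp x (DD p hp y f),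
    dil_congr p x (DD_coe p hp y f)] with t h1 h2 h3
  rw [h1, mul_apply_eq_comp, h2, h3, dil_dil]

lemma DD_zero (p : ℝ) (hp : 1 ≤ p) [Fact (1 ≤ ENNReal.ofReal p)] :
    DD p hp 0 = 1 := by
  ext1 f
  apply Lp.ext
  filter_upwards [DD_coe p hp 0 f] with t h1
  rw [h1, one_apply_eq_self]
  simp [dil]

lemma dil_measurable2 (p : ℝ) {f : ℝ → ℂ} (hf : StronglyMeasurable f) :
    StronglyMeasurable (fun z : ℝ × ℝ => dil p z.1 f z.2) := by
  unfold dil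
  refine StronglyMeasurable.mul ?_ ?_
  · exact Continuous.stronglyMeasurable (by fun_prop)
  · exact hf.comp_measurable (by fun_prop)

lemma lint_le (p : ℝ) (hp : 1 ≤ p) {f : ℝ → ℂ} (hf : AEStronglyMeasurable f nu) (A : Set ℝ) :
    ∫⁻ t in A, ‖f t‖ₑ ∂nu ≤ eLpNorm f (ENNReal.ofReal p) nu *
      nu A ^ (1 - 1 / p) := by
  rw [← eLpNorm_one_eq_lintegral_enorm]
  have h := eLpNorm_le_eLpNorm_mul_rpow_measure_univ (p := 1) (q := ENNReal.ofReal p)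
    (μ := nu.restrict A) (f := f) (by simpa using hp) hf.restrict
  rw [ENNReal.toReal_ofReal (by linarith), ENNReal.toReal_one, Measure.restrict_apply_univ,
    div_one] at h
  refine h.trans (mul_le_mul_left (eLpNorm_mono_measure f Measure.restrict_le_self) _)

lemma fub (p a b : ℝ) (hp : 1 ≤ p) (ha : 0 < a) (hb : 0 < b) {f : ℝ → ℂ}
    (hfm : StronglyMeasurable f)
    (hf : MemLp f (ENNReal.ofReal p) nu) (A : Set ℝ) (hA : nu A < ⊤) :
    Integrable (fun z : ℝ × ℝ => (kk a b z.1 : ℂ) * dil p z.1 f z.2)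
      (volume.prod (nu.restrict A)) := by
  have hm : StronglyMeasurable (fun z : ℝ × ℝ => (kk a b z.1 : ℂ) * dil p z.1 f z.2) := by
    refine StronglyMeasurable.mul ?_ (dil_measurable2 p hfm)
    have := kk_continuous a b
    exact Continuous.stronglyMeasurable (by fun_prop)
  refine ⟨hm.aestronglyMeasurable, ?_⟩
  rw [HasFiniteIntegral, lintegral_prod _ hm.enorm.aemeasurable]
  have hp0 : 0 ≤ 1 - 1 / p := by
    rw [sub_nonneg, div_le_one (by linarith)]; exact hp
  set C := eLpNorm f (ENNReal.ofReal p) nu * nu A ^ (1 - 1 / p) with hC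
  have hCt : C ≠ ⊤ := ENNReal.mul_ne_top hf.2.ne (ENNReal.rpow_ne_top_of_nonneg hp0 hA.ne)
  have hle : ∀ x, ∫⁻ t in A, ‖(kk a b x : ℂ) * dil p x f t‖ₑ ∂nu ≤ ‖kk a b x‖ₑ * C := by
    intro x
    simp_rw [enorm_mul]
    rw [lintegral_const_mul' _ _ enorm_ne_top]
    have h1 : ‖(kk a b x : ℂ)‖ₑ = ‖kk a b x‖ₑ := by
      rw [← ofReal_norm, ← ofReal_norm, Complex.norm_real]
    rw [h1]
    refine mul_le_mul_right ?_ _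
    have := lint_le p hp (dil_aesm p x hf.1) A
    rwa [dil_eLpNorm p x hp hf.1] at this
  refine (lintegral_mono hle).trans_lt ?_
  rw [lintegral_mul_const' _ _ hCt]
  exact ENNReal.mul_lt_top (kk_integrable a b ha hb).2 hCt.lt_top

lemma ae_int (p a b : ℝ) (hp : 1 ≤ p) (ha : 0 < a) (hb : 0 < b) {f : ℝ → ℂ}
    (hfm : StronglyMeasurable f) (hf : MemLp f (ENNReal.ofReal p) nu) :
    ∀ᵐ t ∂nu, Integrable (fun x => (kk a b x : ℂ) * dil p x f t) := by
  refine ae_of_forall_measure_lt_top_ae_restrict _ fun A _ hA' => ?_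
  exact (fub p a b hp ha hb hfm hf A hA').prod_left_ae

noncomputable def cv (p a b : ℝ) (f : ℝ → ℂ) (t : ℝ) : ℂ := ∫ x, (kk a b x : ℂ) * dil p x f t

lemma cv_congr (p a b : ℝ) {f g : ℝ → ℂ} (h : f =ᵐ[nu] g) (t : ℝ) (ht : 0 < t) :
    cv p a b f t = cv p a b g t := by
  have e1 := SOp_eq p (a + 1 / p) (a + b) f t ht
  have e2 := SOp_eq p (a + 1 / p) (a + b) g t ht
  rw [show a + 1 / p - 1 / p = a by ring, show a + b - a = b by ring] at e1 e2
  rw [cv, cv, ← e1, ← e2, SOp, SOp]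
  congr 1
  refine integral_congr_ae ?_
  filter_upwards [h] with s hs
  rw [hs]

lemma dil_cv (p a b y : ℝ) (f : ℝ → ℂ) (t : ℝ) :
    dil p y (cv p a b f) t = ∫ x, (kk a b x : ℂ) * dil p (x + y) f t := by
  conv_lhs => rw [dil, cv, ← integral_const_mul]
  congr 1
  funext x
  rw [add_comm, ← dil_dil, dil.eq_1 p y]
  ring


lemma T_comm (p a b : ℝ) (hp : 1 ≤ p) [Fact (1 ≤ ENNReal.ofReal p)]
    (T : Lp ℂ (ENNReal.ofReal p) nu →L[ℂ] Lp ℂ (ENNReal.ofReal p) nu)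
    (hT : ∀ f : Lp ℂ (ENNReal.ofReal p) nu, T f =ᵐ[nu] cv p a b f) (y : ℝ) : DD p hp y * T = T * DD p hp y := by
  ext1 f
  apply Lp.ext
  filter_upwards [DD_coe p hp y (T f), dil_congr p y (hT f), hT (DD p hp y f),
    ae_restrict_mem measurableSet_Ioi] with t h1 h2 h3 ht
  rw [mul_apply_eq_comp, mul_apply_eq_comp, h1, h2, h3, dil_cv,
    cv_congr p a b (DD_coe p hp y f) t ht, cv]
  simp only [dil_dil]

lemma T_lip0 (p a b : ℝ) (hp : 1 ≤ p) [Fact (1 ≤ ENNReal.ofReal p)] (ha : 0 < a) (hb : 0 < b)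
    (T : Lp ℂ (ENNReal.ofReal p) nu →L[ℂ] Lp ℂ (ENNReal.ofReal p) nu)
    (hT : ∀ f : Lp ℂ (ENNReal.ofReal p) nu, T f =ᵐ[nu] cv p a b f) (y : ℝ) : ‖DD p hp y * T - T‖ ≤ (Real.exp ((a + b) * |y|) - 1) * ‖T‖ := by
  have hE : 0 ≤ Real.exp ((a + b) * |y|) - 1 := by
    rw [sub_nonneg]; exact Real.one_le_exp (by positivity)
  set E := Real.exp ((a + b) * |y|) - 1 with hEdef
  refine ContinuousLinearMap.opNorm_le_bound _ (by positivity) fun f => ?_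
  have hF : MemLp (fun t => ((‖f t‖ : ℝ) : ℂ)) (ENNReal.ofReal p) nu := (Lp.memLp f).norm.ofReal
  let F := hF.toLp _
  have hFf : ‖F‖ ≤ ‖f‖ := by
    apply Lp.norm_le_norm_of_ae_le
    filter_upwards [hF.coeFn_toLp] with t ht
    rw [ht]; simp
  have key : ‖(DD p hp y * T - T) f‖ ≤ E * ‖T F‖ := by
    apply Lp.norm_le_mul_norm_of_ae_le_mul
    filter_upwards [DD_coe p hp y (T f), dil_congr p y (hT f), hT f, hT F,
      ae_restrict_mem measurableSet_Ioi,
      ae_int p a b hp ha hb (Lp.stronglyMeasurable f) (Lp.memLp f),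
      Lp.coeFn_sub (DD p hp y (T f)) (T f)] with t h1 h2 h3 h4 ht hi h5
    rw [sub_apply, mul_apply_eq_comp, h5, Pi.sub_apply, h1, h2, h3, h4,
      cv_congr p a b hF.coeFn_toLp t ht, dil_cv]
    have s1 : ∫ x, (kk a b x : ℂ) * dil p (x + y) f t =
        ∫ x, (kk a b (x - y) : ℂ) * dil p x f t := by
      rw [← integral_add_right_eq_self (fun x => (kk a b (x - y) : ℂ) * dil p x f t) y]
      simp
    have hni : Integrable (fun x => kk a b x * ‖dil p x f t‖) := by
      have := hi.norm
      simpa [abs_of_pos (kk_pos a b _)] using this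
    have hdm : AEStronglyMeasurable (fun x => dil p x f t) volume := by
      exact ((dil_measurable2 p (Lp.stronglyMeasurable f)).comp_measurable
        (g := fun x : ℝ => (x, t)) (by fun_prop)).aestronglyMeasurable
    have hkc := kk_continuous a b
    have hi2 : Integrable (fun x => (kk a b (x - y) : ℂ) * dil p x f t) := by
      refine (hni.const_mul (Real.exp ((a + b) * |y|))).mono' ?_
        (Filter.Eventually.of_forall fun x => ?_)
      · exact (Continuous.aestronglyMeasurable (by fun_prop)).mul hdm
      · rw [norm_mul, Complex.norm_real, Real.norm_of_nonneg (kk_pos _ _ _).le, ← mul_assoc]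
        exact mul_le_mul_of_nonneg_right (kk_shift a b ha hb x y) (norm_nonneg _)
    rw [s1, cv, ← integral_sub hi2 hi]
    have s2 : cv p a b (fun t => ((‖f t‖ : ℝ) : ℂ)) t =
        ((∫ x, kk a b x * ‖dil p x f t‖ : ℝ) : ℂ) := by
      rw [cv, ← integral_complex_ofReal]
      congr 1
      funext x
      simp only [dil, norm_mul, Complex.norm_real, Real.norm_of_nonneg (Real.exp_pos _).le]
      push_cast
      rfl
    rw [s2, Complex.norm_real, Real.norm_of_nonneg
      (integral_nonneg fun x => mul_nonneg (kk_pos _ _ _).le (norm_nonneg _)),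
      ← integral_const_mul]
    refine norm_integral_le_of_norm_le (hni.const_mul _) (Filter.Eventually.of_forall fun x => ?_)
    rw [← sub_mul, norm_mul, ← Complex.ofReal_sub, Complex.norm_real, Real.norm_eq_abs, ← mul_assoc]
    exact mul_le_mul_of_nonneg_right (kk_lip a b ha hb x y) (norm_nonneg _)
  refine key.trans ?_
  rw [mul_assoc]
  exact mul_le_mul_of_nonneg_left
    ((T.le_opNorm F).trans (mul_le_mul_of_nonneg_left hFf (norm_nonneg T))) hE

lemma T_cont (p a b : ℝ) (hp : 1 ≤ p) [Fact (1 ≤ ENNReal.ofReal p)] (ha : 0 < a) (hb : 0 < b)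
    (T : Lp ℂ (ENNReal.ofReal p) nu →L[ℂ] Lp ℂ (ENNReal.ofReal p) nu)
    (hT : ∀ f : Lp ℂ (ENNReal.ofReal p) nu, T f =ᵐ[nu] cv p a b f) : Continuous (fun y => DD p hp y * T) := by
  rw [continuous_iff_continuousAt]
  intro z
  rw [ContinuousAt, tendsto_iff_norm_sub_tendsto_zero]
  have hle : ∀ y, ‖DD p hp y * T - DD p hp z * T‖ ≤
      (Real.exp ((a + b) * |y - z|) - 1) * ‖T‖ := by
    intro y
    have e : DD p hp y * T - DD p hp z * T = DD p hp z * (DD p hp (y - z) * T - T) := by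
      rw [mul_sub, ← mul_assoc, ← DD_add, add_sub_cancel]
    rw [e]
    refine (norm_mul_le _ _).trans ?_
    calc ‖DD p hp z‖ * _ ≤ 1 * _ := mul_le_mul_of_nonneg_right (DD_norm p hp z) (norm_nonneg _)
      _ ≤ _ := by rw [one_mul]; exact T_lip0 p a b hp ha hb T hT _
  refine squeeze_zero (fun _ => norm_nonneg _) hle ?_
  have hc : Continuous fun y => (Real.exp ((a + b) * |y - z|) - 1) * ‖T‖ := by fun_prop
  simpa using hc.tendsto z

lemma T_int (p a b : ℝ) (hp : 1 ≤ p) [Fact (1 ≤ ENNReal.ofReal p)] (ha : 0 < a) (hb : 0 < b)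
    (T : Lp ℂ (ENNReal.ofReal p) nu →L[ℂ] Lp ℂ (ENNReal.ofReal p) nu)
    (hT : ∀ f : Lp ℂ (ENNReal.ofReal p) nu, T f =ᵐ[nu] cv p a b f) : Integrable (fun x => (kk a b x : ℂ) • (DD p hp x * T)) := by
  have hkc := kk_continuous a b
  refine ((kk_integrable a b ha hb).mul_const ‖T‖).mono' ?_ (Filter.Eventually.of_forall fun x => ?_)
  · exact (Continuous.smul (Complex.continuous_ofReal.comp hkc) (T_cont p a b hp ha hb T hT)).aestronglyMeasurable
  · rw [norm_smul, Complex.norm_real, Real.norm_of_nonneg (kk_pos _ _ _).le]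
    refine mul_le_mul_of_nonneg_left ?_ (kk_pos _ _ _).le
    refine (norm_mul_le _ _).trans ?_
    calc _ ≤ 1 * ‖T‖ := mul_le_mul_of_nonneg_right (DD_norm p hp x) (norm_nonneg _)
      _ = _ := one_mul _

lemma exists_setInt (p : ℝ) (hp : 1 ≤ p) [Fact (1 ≤ ENNReal.ofReal p)] (A : Set ℝ)
    (hA : nu A < ⊤) :
    ∃ l : Lp ℂ (ENNReal.ofReal p) nu →L[ℂ] ℂ, ∀ f, l f = ∫ t in A, f t ∂nu := by
  have hp0 : 0 ≤ 1 - 1 / p := by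
    rw [sub_nonneg, div_le_one (by linarith)]; exact hp
  have hAt : nu A ^ (1 - 1 / p) ≠ ⊤ := ENNReal.rpow_ne_top_of_nonneg hp0 hA.ne
  have hint : ∀ f : Lp ℂ (ENNReal.ofReal p) nu, IntegrableOn f A nu := by
    intro f
    refine ⟨(Lp.aestronglyMeasurable f).restrict, ?_⟩
    exact (lint_le p hp (Lp.aestronglyMeasurable f) A).trans_lt
      (ENNReal.mul_lt_top (Lp.memLp f).2 hAt.lt_top)
  refine ⟨LinearMap.mkContinuous
    { toFun := fun f => ∫ t in A, f t ∂nu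
      map_add' := fun f g => by
        rw [← integral_add (hint f) (hint g)]
        exact integral_congr_ae (ae_restrict_of_ae (Lp.coeFn_add f g))
      map_smul' := fun c f => by
        rw [RingHom.id_apply, ← integral_smul]
        exact integral_congr_ae (ae_restrict_of_ae (Lp.coeFn_smul c f)) }
    (nu A ^ (1 - 1 / p)).toReal ?_, fun f => rfl⟩
  intro f
  simp only [LinearMap.coe_mk, AddHom.coe_mk]
  refine (norm_integral_le_integral_norm _).trans ?_
  rw [integral_norm_eq_lintegral_enorm (Lp.aestronglyMeasurable f).restrict, mul_comm,
    Lp.norm_def, ← ENNReal.toReal_mul]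
  exact ENNReal.toReal_mono (ENNReal.mul_ne_top (Lp.memLp f).2.ne hAt)
    (lint_le p hp (Lp.aestronglyMeasurable f) A)

lemma T_sq (p a b : ℝ) (hp : 1 ≤ p) [Fact (1 ≤ ENNReal.ofReal p)] (ha : 0 < a) (hb : 0 < b)
    (T : Lp ℂ (ENNReal.ofReal p) nu →L[ℂ] Lp ℂ (ENNReal.ofReal p) nu)
    (hT : ∀ f : Lp ℂ (ENNReal.ofReal p) nu, T f =ᵐ[nu] cv p a b f) : T * T = ∫ x, (kk a b x : ℂ) • (DD p hp x * T) := by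
  have hI := T_int p a b hp ha hb T hT
  ext1 f
  rw [ContinuousLinearMap.integral_apply hI, mul_apply_eq_comp]
  simp only [smul_apply, mul_apply_eq_comp]
  have hIf : Integrable (fun x => (kk a b x : ℂ) • (DD p hp x (T f))) :=
    (ContinuousLinearMap.apply ℂ _ f).integrable_comp hI
  set g := T f with hg
  have hpos : ENNReal.ofReal p ≠ 0 := by
    rw [Ne, ENNReal.ofReal_eq_zero]; linarith
  have hset : ∀ (u : Lp ℂ (ENNReal.ofReal p) nu) (s : Set ℝ), MeasurableSet s → nu s < ⊤ →
      IntegrableOn u s nu := fun u s hs hs' =>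
    integrableOn_Lp_of_measure_ne_top _ (by simpa using hp) hs'.ne
  apply Lp.ext
  refine Lp.ae_eq_of_forall_setIntegral_eq _ _ hpos ENNReal.ofReal_ne_top (hset _) (hset _) ?_
  intro A hAm hA
  obtain ⟨l, hl⟩ := exists_setInt p hp A hA
  rw [← hl (∫ x, (kk a b x : ℂ) • (DD p hp x g)), ← l.integral_comp_comm hIf]
  have e1 : ∀ x, l ((kk a b x : ℂ) • (DD p hp x g)) =
      ∫ t in A, (kk a b x : ℂ) * dil p x g t ∂nu := by
    intro x
    rw [map_smul, hl, smul_eq_mul, integral_const_mul]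
    congr 1
    exact integral_congr_ae (ae_restrict_of_ae (DD_coe p hp x g))
  simp only [e1]
  rw [integral_integral_swap (f := fun x t => (kk a b x : ℂ) * dil p x g t)
    (fub p a b hp ha hb (Lp.stronglyMeasurable g) (Lp.memLp g) A hA)]
  exact integral_congr_ae (ae_restrict_of_ae (hT g))



lemma spec_sub (p a b : ℝ) (hp : 1 ≤ p) [Fact (1 ≤ ENNReal.ofReal p)] (ha : 0 < a) (hb : 0 < b)
    (T : Lp ℂ (ENNReal.ofReal p) nu →L[ℂ] Lp ℂ (ENNReal.ofReal p) nu)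
    (hT : ∀ f : Lp ℂ (ENNReal.ofReal p) nu, T f =ᵐ[nu] cv p a b f) (z : ℂ) (hz : z ∈ spectrum ℂ T) (hz0 : z ≠ 0) :
    ∃ ξ : ℝ, ∫ x, (kk a b x : ℂ) * Complex.exp (-(Complex.I * ξ * x)) = z := by
  have hDD : ∀ x y, DD p hp x * DD p hp y = DD p hp y * DD p hp x := by
    intro x y
    rw [← DD_add, ← DD_add, add_comm]
  obtain ⟨A, hSA, φ, h1, hmul, hφT, hb'⟩ := aux_exists_char (insert T (Set.range (DD p hp)))
    (by
      rintro x (rfl | ⟨u, rfl⟩) y (rfl | ⟨v, rfl⟩)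
      · rfl
      · exact (T_comm p a b hp _ hT v).symm
      · exact T_comm p a b hp _ hT u
      · exact hDD u v) T (Set.mem_insert _ _) z hz
  have hTA : T ∈ A := hSA (Set.mem_insert _ _)
  have hDA : ∀ x, DD p hp x ∈ A := fun x => hSA (Set.mem_insert_of_mem _ ⟨x, rfl⟩)
  have hc1 : ∀ x, φ (DD p hp x * T) = φ (DD p hp x) * z := fun x => by
    rw [hmul _ (hDA x) _ hTA, hφT]
  obtain ⟨ξ, hξ⟩ := aux_char_real (fun x => φ (DD p hp x)) (by
      have : (fun x => φ (DD p hp x)) = fun x => φ (DD p hp x * T) / z := by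
        funext x
        rw [hc1, mul_div_cancel_right₀ _ hz0]
      rw [this]
      exact (φ.continuous.comp (T_cont p a b hp ha hb T hT)).div_const z)
    (fun x y => by
      simp only [DD_add]
      exact hmul _ (hDA x) _ (hDA y))
    (by simp only [DD_zero]; exact h1)
    (fun x => by
      refine (hb' _ (hDA x)).trans ?_
      have e1 : ‖(1 : Lp ℂ (ENNReal.ofReal p) nu →L[ℂ] Lp ℂ (ENNReal.ofReal p) nu)‖ ≤ 1 :=
        ContinuousLinearMap.norm_id_le
      calc _ ≤ 1 * (1 : ℝ) := mul_le_mul (DD_norm p hp x) e1 (norm_nonneg _) zero_le_one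
        _ = 1 := one_mul 1)
  refine ⟨ξ, ?_⟩
  have hsq := congrArg φ (T_sq p a b hp ha hb T hT)
  rw [hmul _ hTA _ hTA, hφT, ← φ.integral_comp_comm (T_int p a b hp ha hb T hT)] at hsq
  simp only [map_smul, hc1, smul_eq_mul, ← mul_assoc] at hsq
  rw [integral_mul_const] at hsq
  have := mul_right_cancel₀ hz0 hsq
  rw [this]
  simp only [hξ]

noncomputable def gf (p ξ d : ℝ) (t : ℝ) : ℂ :=
  Complex.exp (((-(1 / p) : ℝ) + Complex.I * ξ) * (Real.log t : ℝ)) *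
    ((Real.exp (-(d * |Real.log t|)) : ℝ) : ℂ)

lemma gf_norm (p ξ d t : ℝ) :
    ‖gf p ξ d t‖ = Real.exp (-(1 / p) * Real.log t) * Real.exp (-(d * |Real.log t|)) := by
  rw [gf, norm_mul, Complex.norm_real, Real.norm_of_nonneg (Real.exp_pos _).le, Complex.norm_exp]
  congr 2
  simp

lemma gf_memLp (p ξ d : ℝ) (hp : 1 ≤ p) (hd : 0 < d) : MemLp (gf p ξ d) (ENNReal.ofReal p) nu := by
  have hp0 : 0 < p := by linarith
  have hm : Measurable (gf p ξ d) := by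
    unfold gf
    have := Real.measurable_log
    fun_prop
  rw [← integrable_norm_rpow_iff hm.aestronglyMeasurable
    (by rw [Ne, ENNReal.ofReal_eq_zero]; linarith) ENNReal.ofReal_ne_top,
    ENNReal.toReal_ofReal (by linarith)]
  have hpt : ∀ t : ℝ, 0 < t → ‖gf p ξ d t‖ ^ p = t ^ (-1 : ℝ) * Real.exp (-(p * d * |Real.log t|)) := by
    intro t ht
    rw [gf_norm, ← Real.exp_add, ← Real.exp_mul, Real.rpow_def_of_pos ht, ← Real.exp_add]
    congr 1
    field_simp
  have hmm : AEStronglyMeasurable (fun t => ‖gf p ξ d t‖ ^ p) volume :=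
    (hm.norm.pow_const p).aestronglyMeasurable
  have hu : Set.Ioi (0 : ℝ) = Set.Ioc 0 1 ∪ Set.Ioi 1 := (Set.Ioc_union_Ioi_eq_Ioi zero_le_one).symm
  rw [nu, hu]
  refine IntegrableOn.union ?_ ?_
  · have hi : IntegrableOn (fun t : ℝ => t ^ (-1 + p * d)) (Set.Ioc 0 1) := by
      rw [← intervalIntegrable_iff_integrableOn_Ioc_of_le zero_le_one]
      exact intervalIntegral.intervalIntegrable_rpow' (by nlinarith [mul_pos hp0 hd])
    refine hi.congr_fun (fun t ht => ?_) measurableSet_Ioc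
    simp only
    rw [hpt t ht.1, abs_of_nonpos (Real.log_nonpos ht.1.le ht.2), Real.rpow_add ht.1,
      Real.rpow_def_of_pos ht.1 (p * d)]
    congr 2; ring
  · have hi : IntegrableOn (fun t : ℝ => t ^ (-1 + -(p * d))) (Set.Ioi 1) := by
      exact integrableOn_Ioi_rpow_of_lt (by nlinarith [mul_pos hp0 hd]) zero_lt_one
    refine hi.congr_fun (fun t ht => ?_) measurableSet_Ioi
    simp only
    have ht' : 1 < t := ht
    have ht0 : 0 < t := by linarith
    rw [hpt t ht0, abs_of_nonneg (Real.log_nonneg ht'.le), Real.rpow_add ht0,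
      Real.rpow_def_of_pos ht0 (-(p * d))]
    congr 2; ring

lemma gf_dil (p ξ d x t : ℝ) (ht : 0 < t) : dil p x (gf p ξ d) t =
    Complex.exp (-(Complex.I * ξ * x)) *
      (Complex.exp (((-(1 / p) : ℝ) + Complex.I * ξ) * (Real.log t : ℝ)) *
        ((Real.exp (-(d * |Real.log t - x|)) : ℝ) : ℂ)) := by
  have hl : Real.log (Real.exp (-x) * t) = Real.log t - x := by
    rw [Real.log_mul (Real.exp_pos _).ne' ht.ne', Real.log_exp]; ring
  rw [dil, gf, hl, ← mul_assoc, ← mul_assoc]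
  congr 1
  rw [Complex.ofReal_exp, ← Complex.exp_add, ← Complex.exp_add]
  congr 1
  push_cast
  ring

lemma exp_abs_bound (d x u : ℝ) (hd : 0 < d) :
    |Real.exp (-(d * |u - x|)) - Real.exp (-(d * |u|))| ≤
      (Real.exp (d * |x|) - 1) * Real.exp (-(d * |u|)) := by
  have t1 : |u| - |x| ≤ |u - x| := abs_sub_abs_le_abs_sub u x
  have t2 : |u - x| ≤ |u| + |x| := abs_sub u x
  have h1 : Real.exp (-(d * |u - x|)) ≤ Real.exp (d * |x|) * Real.exp (-(d * |u|)) := by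
    rw [← Real.exp_add, Real.exp_le_exp]; nlinarith
  have h2 : Real.exp (-(d * |u|)) ≤ Real.exp (d * |x|) * Real.exp (-(d * |u - x|)) := by
    rw [← Real.exp_add, Real.exp_le_exp]; nlinarith
  have hE : 1 ≤ Real.exp (d * |x|) := Real.one_le_exp (by positivity)
  have p1 := Real.exp_pos (-(d * |u - x|))
  have p2 := Real.exp_pos (-(d * |u|))
  rw [abs_le]
  constructor
  · by_cases h : Real.exp (-(d * |u|)) ≤ Real.exp (-(d * |u - x|))
    · nlinarith
    · push Not at h
      nlinarith
  · linarith

lemma cv_gf_bound (p a b ξ d : ℝ) (ha : 0 < a) (hb : 0 < b) (hd : 0 < d)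
    (hi : Integrable (fun x => kk a b x * (Real.exp (d * |x|) - 1))) (t : ℝ) (ht : 0 < t) :
    ‖(∫ x, (kk a b x : ℂ) * Complex.exp (-(Complex.I * ξ * x))) * gf p ξ d t -
      cv p a b (gf p ξ d) t‖ ≤
    (∫ x, kk a b x * (Real.exp (d * |x|) - 1)) * ‖gf p ξ d t‖ := by
  have i1 := (kk_integrable_of_eq a b ha hb ξ).1.mul_const (gf p ξ d t)
  have hkc := kk_continuous a b
  have hbd : ∀ x, ‖(kk a b x : ℂ) * Complex.exp (-(Complex.I * ξ * x)) * gf p ξ d t -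
      (kk a b x : ℂ) * dil p x (gf p ξ d) t‖ ≤
      kk a b x * (Real.exp (d * |x|) - 1) * ‖gf p ξ d t‖ := by
    intro x
    rw [gf_dil p ξ d x t ht, gf_norm, gf]
    have e : ∀ k c w r s : ℂ, k * c * (w * r) - k * (c * (w * s)) = k * c * w * (r - s) := by
      intros; ring
    rw [e, norm_mul, norm_mul, norm_mul, Complex.norm_real, ← Complex.ofReal_sub, Complex.norm_real,
      Real.norm_of_nonneg (kk_pos _ _ _).le, Real.norm_eq_abs, abs_sub_comm, Complex.norm_exp,
      Complex.norm_exp]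
    have r1 : (-(Complex.I * ξ * x)).re = 0 := by simp
    have r2 : (((-(1 / p) : ℝ) + Complex.I * ξ) * (Real.log t : ℝ) : ℂ).re =
        -(1 / p) * Real.log t := by simp
    rw [r1, r2, Real.exp_zero, mul_one]
    have := mul_le_mul_of_nonneg_left (exp_abs_bound d x (Real.log t) hd)
      (mul_pos (kk_pos a b x) (Real.exp_pos (-(1 / p) * Real.log t))).le
    refine this.trans (le_of_eq ?_)
    ring
  have hib : Integrable (fun x => kk a b x * (Real.exp (d * |x|) - 1) * ‖gf p ξ d t‖) :=
    hi.mul_const _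
  have i2 : Integrable (fun x => (kk a b x : ℂ) * dil p x (gf p ξ d) t) := by
    have hm : AEStronglyMeasurable (fun x => (kk a b x : ℂ) * dil p x (gf p ξ d) t) volume := by
      simp only [gf_dil p ξ d _ t ht]
      exact Continuous.aestronglyMeasurable (by fun_prop)
    have i3 : Integrable (fun x => (kk a b x : ℂ) * Complex.exp (-(Complex.I * ξ * x)) * gf p ξ d t -
      (kk a b x : ℂ) * dil p x (gf p ξ d) t) :=
      hib.mono' (i1.aestronglyMeasurable.sub hm) (Filter.Eventually.of_forall hbd)
    have := i1.sub i3
    refine this.congr (Filter.Eventually.of_forall fun x => ?_)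
    simp
  rw [cv, ← integral_mul_const, ← integral_sub i1 i2, ← integral_mul_const]
  exact norm_integral_le_of_norm_le hib (Filter.Eventually.of_forall hbd)

lemma spec_sup (p a b : ℝ) (hp : 1 ≤ p) [Fact (1 ≤ ENNReal.ofReal p)] (ha : 0 < a) (hb : 0 < b)
    (T : Lp ℂ (ENNReal.ofReal p) nu →L[ℂ] Lp ℂ (ENNReal.ofReal p) nu)
    (hT : ∀ f : Lp ℂ (ENNReal.ofReal p) nu, T f =ᵐ[nu] cv p a b f) (ξ : ℝ) :
    ∫ x, (kk a b x : ℂ) * Complex.exp (-(Complex.I * ξ * x)) ∈ spectrum ℂ T := by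
  set z := ∫ x, (kk a b x : ℂ) * Complex.exp (-(Complex.I * ξ * x)) with hz
  rw [spectrum.mem_iff]
  rintro ⟨u, hu⟩
  set R : Lp ℂ (ENNReal.ofReal p) nu →L[ℂ] Lp ℂ (ENNReal.ofReal p) nu := ↑u⁻¹ with hR
  obtain ⟨d, hd, hi, hlt⟩ := kk_eps a b ha hb (1 / (‖R‖ + 1)) (by positivity)
  set ε := ∫ x, kk a b x * (Real.exp (d * |x|) - 1) with hε
  have hg := gf_memLp p ξ d hp hd
  let g := hg.toLp _
  have hgae : g =ᵐ[nu] gf p ξ d := hg.coeFn_toLp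
  have hg0 : g ≠ 0 := by
    intro h0
    have h1 : (g : ℝ → ℂ) =ᵐ[nu] 0 := by rw [h0]; exact Lp.coeFn_zero _ _ _
    have h2 : ∀ᵐ t ∂nu, False := by
      filter_upwards [h1, hgae] with t e1 e2
      rw [e2] at e1
      have := gf_norm p ξ d t
      rw [e1] at this
      simp only [Pi.zero_apply, norm_zero] at this
      have h3 : 0 < Real.exp (-(1 / p) * Real.log t) * Real.exp (-(d * |Real.log t|)) := by
        positivity
      linarith
    rw [Filter.eventually_false_iff_eq_bot, ae_eq_bot] at h2
    have h4 : nu Set.univ = ⊤ := by simp [nu]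
    rw [h2] at h4
    simp at h4
  have hbound : ‖(algebraMap ℂ _ z - T) g‖ ≤ ε * ‖g‖ := by
    apply Lp.norm_le_mul_norm_of_ae_le_mul
    have e0 : (algebraMap ℂ (Lp ℂ (ENNReal.ofReal p) nu →L[ℂ] Lp ℂ (ENNReal.ofReal p) nu) z - T) g
        = z • g - T g := by
      rw [sub_apply, Algebra.algebraMap_eq_smul_one]; rfl
    rw [e0]
    filter_upwards [Lp.coeFn_sub (z • g) (T g), Lp.coeFn_smul z g, hgae, hT g,
      ae_restrict_mem measurableSet_Ioi] with t e1 e2 e3 e4 ht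
    rw [e1, Pi.sub_apply, e2, e4, Pi.smul_apply, cv_congr p a b hgae t ht, e3, smul_eq_mul]
    exact cv_gf_bound p a b ξ d ha hb hd hi t ht
  have hRg : g = R ((algebraMap ℂ _ z - T) g) := by
    rw [← hu, hR, ← mul_apply_eq_comp, Units.inv_mul, one_apply_eq_self]
  have hn : 0 < ‖g‖ := norm_pos_iff.2 hg0
  have h5 : ‖g‖ ≤ ‖R‖ * (ε * ‖g‖) := by
    conv_lhs => rw [hRg]
    exact (R.le_opNorm _).trans (mul_le_mul_of_nonneg_left hbound (norm_nonneg _))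
  have hε0 : 0 ≤ ε := integral_nonneg fun x => mul_nonneg (kk_pos _ _ _).le
    (sub_nonneg.2 (Real.one_le_exp (by positivity)))
  rw [lt_div_iff₀ (by positivity)] at hlt
  nlinarith [norm_nonneg R, mul_nonneg hε0 hn.le]

lemma spec_zero (p a b : ℝ) (hp : 1 ≤ p) [Fact (1 ≤ ENNReal.ofReal p)] (ha : 0 < a) (hb : 0 < b)
    (T : Lp ℂ (ENNReal.ofReal p) nu →L[ℂ] Lp ℂ (ENNReal.ofReal p) nu)
    (hT : ∀ f : Lp ℂ (ENNReal.ofReal p) nu, T f =ᵐ[nu] cv p a b f) : (0 : ℂ) ∈ spectrum ℂ T := by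
  have hlim := Real.tendsto_integral_exp_smul_cocompact (fun x => (kk a b x : ℂ))
  have hcl : IsClosed (spectrum ℂ T) := spectrum.isClosed T
  refine hcl.mem_of_tendsto hlim (Filter.Eventually.of_forall fun w => ?_)
  have := spec_sup p a b hp ha hb T hT (2 * Real.pi * w)
  convert this using 1
  refine integral_congr_ae (Filter.Eventually.of_forall fun x => ?_)
  simp only [Circle.smul_def, Real.fourierChar_apply, smul_eq_mul]
  rw [mul_comm]
  congr 2
  push_cast
  ring


theorem stmt13 (p β μ : ℝ) (hp : 1 ≤ p) [Fact (1 ≤ ENNReal.ofReal p)]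
    (h1 : 0 < β - 1 / p) (h2 : β - 1 / p < μ)
    (T : Lp ℂ (ENNReal.ofReal p) (volume.restrict (Set.Ioi (0 : ℝ))) →L[ℂ]
         Lp ℂ (ENNReal.ofReal p) (volume.restrict (Set.Ioi (0 : ℝ))))
    (hT : ∀ f : Lp ℂ (ENNReal.ofReal p) (volume.restrict (Set.Ioi (0 : ℝ))),
      ∀ᵐ t ∂(volume.restrict (Set.Ioi (0 : ℝ))), (T f) t = SOp β μ f t) :
    spectrum ℂ T =
      (Set.range fun ξ : ℝ =>
        Complex.Gamma (((β - 1 / p : ℝ) : ℂ) + Complex.I * ξ) *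
          Complex.Gamma (((μ - β + 1 / p : ℝ) : ℂ) - Complex.I * ξ) /
            Complex.Gamma ((μ : ℝ) : ℂ)) ∪ {0} := by
  have hb : 0 < μ - (β - 1 / p) := by linarith
  have hT' : ∀ f : Lp ℂ (ENNReal.ofReal p) nu,
      T f =ᵐ[nu] cv p (β - 1 / p) (μ - (β - 1 / p)) f := by
    intro f
    filter_upwards [hT f, ae_restrict_mem measurableSet_Ioi] with t e ht
    rw [e, SOp_eq p β μ f t ht, cv]
  have hF : ∀ ξ : ℝ, ∫ x, (kk (β - 1 / p) (μ - (β - 1 / p)) x : ℂ) *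
      Complex.exp (-(Complex.I * ξ * x)) =
      Complex.Gamma (((β - 1 / p : ℝ) : ℂ) + Complex.I * ξ) *
          Complex.Gamma (((μ - β + 1 / p : ℝ) : ℂ) - Complex.I * ξ) /
            Complex.Gamma ((μ : ℝ) : ℂ) := by
    intro ξ
    rw [(kk_integrable_of_eq _ _ h1 hb ξ).2, ← Complex.ofReal_add,
      show μ - (β - 1 / p) = μ - β + 1 / p by ring,
      show β - 1 / p + (μ - β + 1 / p) = μ by ring]
  ext z
  constructor
  · intro hz
    by_cases hz0 : z = 0
    · right; exact hz0
    · left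
      obtain ⟨ξ, hξ⟩ := spec_sub p _ _ hp h1 hb T hT' z hz hz0
      exact ⟨ξ, by rw [← hξ, hF]⟩
  · rintro (⟨ξ, rfl⟩ | rfl)
    · simp only
      rw [← hF]
      exact spec_sup p _ _ hp h1 hb T hT' ξ
    · exact spec_zero p _ _ hp h1 hb T hT'
end

section
/- Let β > 1/2 and let T be a bounded linear operator on the complex Hilbert space L²(0,∞) such that for every f ∈ L²(0,∞), (Tf)(t) = t^{β−1} ∫₀^∞ s^{β−1}(t+s)^{−(2β−1)} f(s) ds for almost every t > 0 (i.e. T agrees with S_{β,2β−1}). Then T is self-adjoint and its spectrum equals the real interval [0, B(β−1/2, β−1/2)] ⊆ ℂ; in particular, for β = 1 the spectrum of the classical Stieltjes operator Sf(t) = ∫₀^∞ f(s)/(t+s) ds on L²(0,∞) is [0, π]. -/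
open MeasureTheory

lemma gam_int {c r : ℝ} (hc : 0 < c) (hr : 0 < r) :
    IntegrableOn (fun x : ℝ => x ^ (c - 1) * Real.exp (-(r * x))) (Set.Ioi 0) := by
  have := integrableOn_rpow_mul_exp_neg_mul_rpow (s := c - 1) (p := 1) (b := r)
    (by linarith) one_pos hr
  simpa using this

lemma beta_aux (p : ℂ) (c t : ℝ) (hp : 0 < p.re) (hpc : p.re < c) (ht : 0 < t) :
    IntegrableOn (fun s : ℝ => (s : ℂ) ^ (p - 1) * (((t + s) ^ (-c) : ℝ) : ℂ)) (Set.Ioi 0) ∧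
    ∫ s in Set.Ioi (0 : ℝ), (s : ℂ) ^ (p - 1) * (((t + s) ^ (-c) : ℝ) : ℂ) =
      (t : ℂ) ^ (p - c) * (Complex.Gamma p * Complex.Gamma (c - p) / Complex.Gamma c) := by
  have hc : 0 < c := hp.trans hpc
  set μ := volume.restrict (Set.Ioi (0 : ℝ)) with hμ
  let F : ℝ → ℝ → ℂ := fun s x =>
    (s : ℂ) ^ (p - 1) * ((x ^ (c - 1) * Real.exp (-((t + s) * x)) : ℝ) : ℂ)
  have hae : ∀ᵐ x ∂μ, 0 < x := ae_restrict_mem measurableSet_Ioi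
  have hmeas : Measurable (Function.uncurry F) := by
    simp only [F, Function.uncurry_def]
    fun_prop
  -- the inner integral in x
  have hx : ∀ s : ℝ, 0 < s → ∫ x, F s x ∂μ =
      Complex.Gamma c * ((s : ℂ) ^ (p - 1) * (((t + s) ^ (-c) : ℝ) : ℂ)) := by
    intro s hs
    have h1 := Real.integral_rpow_mul_exp_neg_mul_Ioi hc (add_pos ht hs)
    simp only [F]
    rw [integral_const_mul, integral_complex_ofReal, h1, Complex.Gamma_ofReal, one_div,
      Real.inv_rpow (by positivity), Real.rpow_neg (by positivity)]
    push_cast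
    ring
  -- the inner integral in s
  have hFs : ∀ s x : ℝ, 0 < s → 0 < x → F s x =
      ((x ^ (c - 1) * Real.exp (-(t * x)) : ℝ) : ℂ) * ((s : ℂ) ^ (p - 1) * Complex.exp (-(x * s))) := by
    intro s x hs hx
    simp only [F]
    have : -((t + s) * x) = -(t * x) + -(x * s) := by ring
    rw [this, Real.exp_add]
    push_cast
    ring
  have hFn : ∀ s x : ℝ, 0 < s → 0 < x → ‖F s x‖ =
      (x ^ (c - 1) * Real.exp (-(t * x))) * (s ^ (p.re - 1) * Real.exp (-(x * s))) := by
    intro s x hs hx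
    rw [hFs s x hs hx, norm_mul, norm_mul, Complex.norm_cpow_eq_rpow_re_of_pos hs,
      Complex.norm_real, Real.norm_of_nonneg (by positivity), Complex.norm_exp]
    simp
  have hs : ∀ x : ℝ, 0 < x → ∫ s, F s x ∂μ =
      Complex.Gamma p * ((x : ℂ) ^ ((c - p) - 1) * Complex.exp (-(t * x))) := by
    intro x hx
    have h1 := Complex.integral_cpow_mul_exp_neg_mul_Ioi hp hx
    rw [integral_congr_ae (g := fun s : ℝ => ((x ^ (c - 1) * Real.exp (-(t * x)) : ℝ) : ℂ) *
      ((s : ℂ) ^ (p - 1) * Complex.exp (-(x * s)))) (hae.mono fun s hs => hFs s x hs hx),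
      integral_const_mul, h1]
    have hx0 : (x : ℂ) ≠ 0 := by exact_mod_cast hx.ne'
    have e1 : (x : ℂ) ^ ((c - p) - 1) = (x : ℂ) ^ ((c : ℂ) - 1) * (1 / (x : ℂ)) ^ p := by
      rw [one_div, Complex.inv_cpow _ _ (by rw [Complex.arg_ofReal_of_nonneg hx.le]; exact Real.pi_pos.ne),
        ← Complex.cpow_neg, ← Complex.cpow_add _ _ hx0]
      congr 1; ring
    rw [e1, Complex.ofReal_mul, Complex.ofReal_cpow hx.le]
    push_cast
    ring
  have hint : Integrable (Function.uncurry F) (μ.prod μ) := by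
    rw [integrable_prod_iff' hmeas.aestronglyMeasurable]
    constructor
    · filter_upwards [hae] with x hx
      have : Integrable (fun s : ℝ => (x ^ (c - 1) * Real.exp (-(t * x))) *
          (s ^ (p.re - 1) * Real.exp (-(x * s)))) μ := (gam_int hp hx).const_mul _
      refine this.mono' ?_ (hae.mono fun s hs => (hFn s x hs hx).le)
      exact (hmeas.comp (measurable_id.prodMk measurable_const)).aestronglyMeasurable
    · have : Integrable (fun x : ℝ => Real.Gamma p.re * (x ^ ((c - p.re) - 1) * Real.exp (-(t * x)))) μ :=
        (gam_int (by linarith) ht).const_mul _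
      refine this.congr ?_
      filter_upwards [hae] with x hx
      simp only [Function.uncurry_apply_pair]
      rw [integral_congr_ae (hae.mono fun s hs => hFn s x hs hx), integral_const_mul,
        Real.integral_rpow_mul_exp_neg_mul_Ioi hp hx, one_div, Real.inv_rpow hx.le,
        ← Real.rpow_neg hx.le]
      have : x ^ ((c - p.re) - 1) = x ^ (c - 1) * x ^ (-p.re) := by
        rw [← Real.rpow_add hx]; congr 1; ring
      rw [this]; ring
  have hG : Complex.Gamma c ≠ 0 := Complex.Gamma_ne_zero_of_re_pos (by simpa using hc)
  constructor
  · have h := (hint.integral_prod_left).const_mul (Complex.Gamma c)⁻¹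
    refine h.congr ?_
    filter_upwards [hae] with s hs
    have := hx s hs
    simp only [Function.uncurry_apply_pair] at *
    rw [this, inv_mul_cancel_left₀ hG]
  · have h := integral_integral_swap hint
    rw [integral_congr_ae (hae.mono fun s hs => hx s hs),
      integral_congr_ae (hae.mono fun x hx => hs x hx), integral_const_mul, integral_const_mul,
      Complex.integral_cpow_mul_exp_neg_mul_Ioi (by simpa using hpc) ht] at h
    have e : (1 / (t : ℂ)) ^ ((c : ℂ) - p) = (t : ℂ) ^ (p - c) := by
      rw [one_div, Complex.inv_cpow _ _ (by rw [Complex.arg_ofReal_of_nonneg ht.le]; exact Real.pi_pos.ne),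
        ← Complex.cpow_neg]
      congr 1; ring
    rw [e] at h
    field_simp
    linear_combination h

noncomputable def stK (β t s : ℝ) : ℝ := t ^ (β - 1) * (s ^ (β - 1) * (t + s) ^ (-(2 * β - 1)))

noncomputable def stB (β : ℝ) : ℝ := Real.Gamma (β - 1 / 2) * Real.Gamma (β - 1 / 2) /
        Real.Gamma ((β - 1 / 2) + (β - 1 / 2))

noncomputable abbrev stμ : Measure ℝ := volume.restrict (Set.Ioi (0 : ℝ))

lemma stμ_pos : ∀ᵐ x ∂stμ, 0 < x := ae_restrict_mem measurableSet_Ioi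

lemma stμ_prod_pos : ∀ᵐ p ∂(stμ.prod stμ), 0 < p.1 ∧ 0 < p.2 := by
  have h1 : ∀ᵐ p ∂(stμ.prod stμ), 0 < p.1 := Measure.quasiMeasurePreserving_fst.ae stμ_pos
  have h2 : ∀ᵐ p ∂(stμ.prod stμ), 0 < p.2 := Measure.quasiMeasurePreserving_snd.ae stμ_pos
  exact h1.and h2

lemma stK_symm (β t s : ℝ) : stK β t s = stK β s t := by
  unfold stK; rw [add_comm]; ring

lemma stK_nonneg {β t s : ℝ} (ht : 0 < t) (hs : 0 < s) : 0 ≤ stK β t s := by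
  unfold stK; positivity

lemma stK_meas (β : ℝ) : Measurable (fun p : ℝ × ℝ => stK β p.1 p.2) := by
  unfold stK; fun_prop

lemma stB_pos {β : ℝ} (hβ : 1 / 2 < β) : 0 < stB β := by
  unfold stB
  have := Real.Gamma_pos_of_pos (s := β - 1 / 2) (by linarith)
  have := Real.Gamma_pos_of_pos (s := (β - 1 / 2) + (β - 1 / 2)) (by linarith)
  positivity

lemma stK_half {β : ℝ} (hβ : 1 / 2 < β) {t : ℝ} (ht : 0 < t) :
    Integrable (fun s => stK β t s * s ^ (-(1 / 2) : ℝ)) stμ ∧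
    ∫ s, stK β t s * s ^ (-(1 / 2) : ℝ) ∂stμ = t ^ (-(1 / 2) : ℝ) * stB β := by
  obtain ⟨h1, h2⟩ := beta_aux ((β - 1 / 2 : ℝ) : ℂ) (2 * β - 1) t
    (by rw [Complex.ofReal_re]; linarith) (by rw [Complex.ofReal_re]; linarith) ht
  have e : ∀ s : ℝ, 0 < s → ((stK β t s * s ^ (-(1 / 2) : ℝ) : ℝ) : ℂ) =
      ((t ^ (β - 1) : ℝ) : ℂ) * ((s : ℂ) ^ (((β - 1 / 2 : ℝ) : ℂ) - 1) *
        (((t + s) ^ (-(2 * β - 1)) : ℝ) : ℂ)) := by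
    intro s hs
    have : ((β - 1 / 2 : ℝ) : ℂ) - 1 = ((β - 1 / 2 - 1 : ℝ) : ℂ) := by push_cast; ring
    rw [this, ← Complex.ofReal_cpow hs.le, ← Complex.ofReal_mul, ← Complex.ofReal_mul]
    congr 1
    unfold stK
    rw [show β - 1 / 2 - 1 = (β - 1) + (-(1 / 2)) by ring, Real.rpow_add hs]
    ring
  constructor
  · have h3 : Integrable (fun s => ((stK β t s * s ^ (-(1 / 2) : ℝ) : ℝ) : ℂ)) stμ :=
      (Integrable.const_mul h1 ((t ^ (β - 1) : ℝ) : ℂ)).congr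
        (stμ_pos.mono fun s hs => (e s hs).symm)
    simpa using h3.re
  · apply Complex.ofReal_injective
    rw [← integral_complex_ofReal, integral_congr_ae (stμ_pos.mono fun s hs => e s hs),
      integral_const_mul, h2]
    have : ((β - 1 / 2 : ℝ) : ℂ) - ((2 * β - 1 : ℝ) : ℂ) = ((-(β - 1 / 2) : ℝ) : ℂ) := by
      push_cast; ring
    have h4 : ((2 * β - 1 : ℝ) : ℂ) - ((β - 1 / 2 : ℝ) : ℂ) = ((β - 1 / 2 : ℝ) : ℂ) := by
      push_cast; ring
    rw [this, h4, ← Complex.ofReal_cpow ht.le, Complex.Gamma_ofReal, Complex.Gamma_ofReal]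
    norm_cast
    unfold stB
    rw [show β - 1 / 2 + (β - 1 / 2) = 2 * β - 1 by ring, ← mul_assoc, ← Real.rpow_add ht]
    congr 2
    ring

lemma st_schur {β : ℝ} (hβ : 1 / 2 < β) {f : ℝ → ℂ} (hf : MemLp f 2 stμ) :
    Integrable (fun p : ℝ × ℝ => ‖f p.1‖ ^ 2 * p.1 ^ (1 / 2 : ℝ) *
      (stK β p.1 p.2 * p.2 ^ (-(1 / 2) : ℝ))) (stμ.prod stμ) ∧
    ∫ p : ℝ × ℝ, ‖f p.1‖ ^ 2 * p.1 ^ (1 / 2 : ℝ) *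
      (stK β p.1 p.2 * p.2 ^ (-(1 / 2) : ℝ)) ∂(stμ.prod stμ) = stB β * ∫ t, ‖f t‖ ^ 2 ∂stμ := by
  have hf2 : Integrable (fun t => ‖f t‖ ^ 2) stμ := by
    simpa using hf.integrable_norm_pow (by norm_num)
  have hm : AEStronglyMeasurable (fun p : ℝ × ℝ => ‖f p.1‖ ^ 2 * p.1 ^ (1 / 2 : ℝ) *
      (stK β p.1 p.2 * p.2 ^ (-(1 / 2) : ℝ))) (stμ.prod stμ) := by
    have h1 : AEStronglyMeasurable (fun p : ℝ × ℝ => ‖f p.1‖ ^ 2) (stμ.prod stμ) :=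
      (hf2.aestronglyMeasurable).comp_quasiMeasurePreserving Measure.quasiMeasurePreserving_fst
    have h2 : Measurable (fun p : ℝ × ℝ => p.1 ^ (1 / 2 : ℝ)) := by fun_prop
    have h3 : Measurable (fun p : ℝ × ℝ => p.2 ^ (-(1 / 2) : ℝ)) := by fun_prop
    exact (h1.mul h2.aestronglyMeasurable).mul ((stK_meas β).mul h3).aestronglyMeasurable
  have hin : ∀ t : ℝ, 0 < t → ∫ s, ‖f t‖ ^ 2 * t ^ (1 / 2 : ℝ) *
      (stK β t s * s ^ (-(1 / 2) : ℝ)) ∂stμ = stB β * ‖f t‖ ^ 2 := by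
    intro t ht
    rw [integral_const_mul, (stK_half hβ ht).2, Real.rpow_neg ht.le]
    have : t ^ (1 / 2 : ℝ) ≠ 0 := by positivity
    field_simp
  have hint : Integrable (fun p : ℝ × ℝ => ‖f p.1‖ ^ 2 * p.1 ^ (1 / 2 : ℝ) *
      (stK β p.1 p.2 * p.2 ^ (-(1 / 2) : ℝ))) (stμ.prod stμ) := by
    rw [integrable_prod_iff hm]
    constructor
    · filter_upwards [stμ_pos] with t ht
      exact (stK_half hβ ht).1.const_mul _
    · refine (hf2.const_mul (stB β)).congr ?_
      filter_upwards [stμ_pos] with t ht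
      rw [← hin t ht]
      refine integral_congr_ae (stμ_pos.mono fun s hs => ?_)
      have := stK_nonneg (β := β) ht hs
      simp only
      rw [Real.norm_of_nonneg (by positivity)]
  refine ⟨hint, ?_⟩
  rw [integral_prod _ hint, integral_congr_ae (stμ_pos.mono fun t ht => hin t ht),
    integral_const_mul]

lemma st_amgm {β : ℝ} {t s : ℝ} (ht : 0 < t) (hs : 0 < s) (a b : ℝ) :
    stK β t s * (a * b) ≤ (1 / 2) * (a ^ 2 * t ^ (1 / 2 : ℝ) * (stK β t s * s ^ (-(1 / 2) : ℝ)) +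
      b ^ 2 * s ^ (1 / 2 : ℝ) * (stK β s t * t ^ (-(1 / 2) : ℝ))) := by
  rw [stK_symm β s t]
  have hk := stK_nonneg (β := β) ht hs
  rw [Real.rpow_neg ht.le, Real.rpow_neg hs.le]
  have hu : 0 < t ^ (1 / 2 : ℝ) := by positivity
  have hv : 0 < s ^ (1 / 2 : ℝ) := by positivity
  set u := t ^ (1 / 2 : ℝ)
  set v := s ^ (1 / 2 : ℝ)
  have : a * b ≤ (1 / 2) * (a ^ 2 * u * v⁻¹ + b ^ 2 * v * u⁻¹) := by
    have e : (1 / 2) * (a ^ 2 * u * v⁻¹ + b ^ 2 * v * u⁻¹) - a * b =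
      (1 / 2) * (a * u - b * v) ^ 2 * (u⁻¹ * v⁻¹) := by
      field_simp; ring
    have : 0 ≤ (1 / 2) * (a * u - b * v) ^ 2 * (u⁻¹ * v⁻¹) := by positivity
    linarith
  nlinarith [mul_le_mul_of_nonneg_left this hk]

lemma st_form {β : ℝ} (hβ : 1 / 2 < β) {f g : ℝ → ℂ} (hf : MemLp f 2 stμ) (hg : MemLp g 2 stμ) :
    Integrable (fun p : ℝ × ℝ => (stK β p.1 p.2 : ℂ) * (star (f p.1) * g p.2)) (stμ.prod stμ) ∧
    ‖∫ p : ℝ × ℝ, (stK β p.1 p.2 : ℂ) * (star (f p.1) * g p.2) ∂(stμ.prod stμ)‖ ≤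
      (1 / 2) * (stB β * ∫ t, ‖f t‖ ^ 2 ∂stμ + stB β * ∫ t, ‖g t‖ ^ 2 ∂stμ) := by
  obtain ⟨h1, h2⟩ := st_schur hβ hf
  obtain ⟨h3, h4⟩ := st_schur hβ hg
  have h5 := h3.swap
  have h6 := integral_prod_swap (μ := stμ) (ν := stμ) (fun p : ℝ × ℝ => ‖g p.1‖ ^ 2 * p.1 ^ (1 / 2 : ℝ) *
      (stK β p.1 p.2 * p.2 ^ (-(1 / 2) : ℝ)))
  rw [h4] at h6
  have hb := (h1.add h5).const_mul (1 / 2)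
  have hle : ∀ᵐ p ∂(stμ.prod stμ), ‖(stK β p.1 p.2 : ℂ) * (star (f p.1) * g p.2)‖ ≤
      (1 / 2) * (‖f p.1‖ ^ 2 * p.1 ^ (1 / 2 : ℝ) * (stK β p.1 p.2 * p.2 ^ (-(1 / 2) : ℝ)) +
      ‖g p.2‖ ^ 2 * p.2 ^ (1 / 2 : ℝ) * (stK β p.2 p.1 * p.1 ^ (-(1 / 2) : ℝ))) := by
    filter_upwards [stμ_prod_pos] with p hp
    rw [norm_mul, norm_mul, norm_star, Complex.norm_real,
      Real.norm_of_nonneg (stK_nonneg hp.1 hp.2)]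
    exact st_amgm hp.1 hp.2 _ _
  have hm : AEStronglyMeasurable (fun p : ℝ × ℝ => (stK β p.1 p.2 : ℂ) * (star (f p.1) * g p.2))
      (stμ.prod stμ) := by
    have m1 : AEStronglyMeasurable (fun p : ℝ × ℝ => f p.1) (stμ.prod stμ) :=
      (hf.1).comp_quasiMeasurePreserving Measure.quasiMeasurePreserving_fst
    have m2 : AEStronglyMeasurable (fun p : ℝ × ℝ => g p.2) (stμ.prod stμ) :=
      (hg.1).comp_quasiMeasurePreserving Measure.quasiMeasurePreserving_snd
    exact (Complex.measurable_ofReal.comp (stK_meas β)).aestronglyMeasurable.mul (m1.star.mul m2)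
  refine ⟨hb.mono' hm hle, ?_⟩
  refine (norm_integral_le_of_norm_le hb hle).trans (le_of_eq ?_)
  rw [integral_const_mul, ← h2, ← h6]
  exact congrArg _ (integral_add h1 h5)

lemma st_pos {β : ℝ} (hβ : 1 / 2 < β) {f : ℝ → ℂ} (hf : MemLp f 2 stμ) :
    ∃ r : ℝ, 0 ≤ r ∧
      ∫ p : ℝ × ℝ, (stK β p.1 p.2 : ℂ) * (star (f p.1) * f p.2) ∂(stμ.prod stμ) = (r : ℂ) := by
  have hc : 0 < 2 * β - 1 := by linarith
  let h : ℝ → ℝ → ℂ := fun x t => ((t ^ (β - 1) * Real.exp (-(t * x)) : ℝ) : ℂ) * f t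
  let G : ℝ × ℝ → ℝ → ℂ := fun p x =>
    ((x ^ (2 * β - 1 - 1) : ℝ) : ℂ) * (star (h x p.1) * h x p.2)
  have hG : ∀ p x, G p x = (((p.1 ^ (β - 1) * p.2 ^ (β - 1) : ℝ) : ℂ) * (star (f p.1) * f p.2)) *
      ((x ^ (2 * β - 1 - 1) * Real.exp (-((p.1 + p.2) * x)) : ℝ) : ℂ) := by
    intro p x
    simp only [G, h]
    rw [show -((p.1 + p.2) * x) = -(p.1 * x) + -(p.2 * x) by ring, Real.exp_add]
    simp only [star_mul', Complex.star_def, Complex.conj_ofReal]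
    push_cast
    ring
  have hGam : ∀ p : ℝ × ℝ, 0 < p.1 → 0 < p.2 →
      (p.1 ^ (β - 1) * p.2 ^ (β - 1)) *
        ∫ x, (x ^ (2 * β - 1 - 1) * Real.exp (-((p.1 + p.2) * x))) ∂stμ =
      Real.Gamma (2 * β - 1) * stK β p.1 p.2 := by
    intro p h1 h2
    rw [Real.integral_rpow_mul_exp_neg_mul_Ioi hc (add_pos h1 h2), one_div,
      Real.inv_rpow (by positivity), ← Real.rpow_neg (by positivity)]
    unfold stK
    ring
  have hGi : ∀ p : ℝ × ℝ, 0 < p.1 → 0 < p.2 → ∫ x, G p x ∂stμ =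
      Complex.Gamma (2 * β - 1 : ℝ) * ((stK β p.1 p.2 : ℂ) * (star (f p.1) * f p.2)) := by
    intro p h1 h2
    simp only [hG]
    rw [integral_const_mul, integral_complex_ofReal, Complex.Gamma_ofReal]
    have := congrArg (fun r : ℝ => (r : ℂ)) (hGam p h1 h2)
    simp only [Complex.ofReal_mul] at this ⊢
    linear_combination (star (f p.1) * f p.2) * this
  have hGn : ∀ p : ℝ × ℝ, 0 < p.1 → 0 < p.2 → ∫ x, ‖G p x‖ ∂stμ =
      Real.Gamma (2 * β - 1) * ‖(stK β p.1 p.2 : ℂ) * (star (f p.1) * f p.2)‖ := by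
    intro p h1 h2
    rw [norm_mul, Complex.norm_real, Real.norm_of_nonneg (stK_nonneg h1 h2), ← mul_assoc,
      ← hGam p h1 h2]
    have : ∀ᵐ x ∂stμ, ‖G p x‖ = ((p.1 ^ (β - 1) * p.2 ^ (β - 1)) * ‖star (f p.1) * f p.2‖) *
        (x ^ (2 * β - 1 - 1) * Real.exp (-((p.1 + p.2) * x))) := by
      filter_upwards [stμ_pos] with x hx
      rw [hG, norm_mul, norm_mul, Complex.norm_real, Complex.norm_real,
        Real.norm_of_nonneg (by positivity), Real.norm_of_nonneg (by positivity)]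
    rw [integral_congr_ae this, integral_const_mul]
    ring
  have hF := st_form hβ hf hf
  have hGint : Integrable (Function.uncurry G) ((stμ.prod stμ).prod stμ) := by
    have hm : AEStronglyMeasurable (Function.uncurry G) ((stμ.prod stμ).prod stμ) := by
      have e : Function.uncurry G = fun q : (ℝ × ℝ) × ℝ =>
        (((q.1.1 ^ (β - 1) * q.1.2 ^ (β - 1) : ℝ) : ℂ) * (star (f q.1.1) * f q.1.2)) *
        ((q.2 ^ (2 * β - 1 - 1) * Real.exp (-((q.1.1 + q.1.2) * q.2)) : ℝ) : ℂ) := by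
        ext q; exact hG q.1 q.2
      rw [e]
      have m1 : AEStronglyMeasurable (fun q : (ℝ × ℝ) × ℝ => f q.1.1) ((stμ.prod stμ).prod stμ) :=
        (hf.1).comp_quasiMeasurePreserving
          (Measure.quasiMeasurePreserving_fst.comp Measure.quasiMeasurePreserving_fst)
      have m2 : AEStronglyMeasurable (fun q : (ℝ × ℝ) × ℝ => f q.1.2) ((stμ.prod stμ).prod stμ) :=
        (hf.1).comp_quasiMeasurePreserving
          (Measure.quasiMeasurePreserving_snd.comp Measure.quasiMeasurePreserving_fst)
      have m3 : Measurable (fun q : (ℝ × ℝ) × ℝ => ((q.1.1 ^ (β - 1) * q.1.2 ^ (β - 1) : ℝ) : ℂ)) := by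
        fun_prop
      have m4 : Measurable (fun q : (ℝ × ℝ) × ℝ =>
        ((q.2 ^ (2 * β - 1 - 1) * Real.exp (-((q.1.1 + q.1.2) * q.2)) : ℝ) : ℂ)) := by
        fun_prop
      exact (m3.aestronglyMeasurable.mul (m1.star.mul m2)).mul m4.aestronglyMeasurable
    rw [integrable_prod_iff hm]
    constructor
    · filter_upwards [stμ_prod_pos] with p hp
      simp only [Function.uncurry_apply_pair, hG]
      exact (Integrable.ofReal (gam_int hc (add_pos hp.1 hp.2))).const_mul _
    · refine (hF.1.norm.const_mul (Real.Gamma (2 * β - 1))).congr ?_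
      filter_upwards [stμ_prod_pos] with p hp
      simp only [Function.uncurry_apply_pair]
      exact (hGn p hp.1 hp.2).symm
  have hsw := integral_integral_swap hGint
  rw [integral_congr_ae (stμ_prod_pos.mono fun p hp => hGi p hp.1 hp.2), integral_const_mul] at hsw
  have hin : ∀ x : ℝ, ∫ p, G p x ∂(stμ.prod stμ) =
      ((x ^ (2 * β - 1 - 1) * ‖∫ t, h x t ∂stμ‖ ^ 2 : ℝ) : ℂ) := by
    intro x
    simp only [G]
    rw [integral_const_mul, integral_prod_mul (fun t => star (h x t)) (fun t => h x t)]
    have : ∫ t, star (h x t) ∂stμ = star (∫ t, h x t ∂stμ) := integral_conj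
    rw [this, Complex.star_def, Complex.conj_mul']
    push_cast; ring
  simp only [hin] at hsw
  rw [integral_complex_ofReal, Complex.Gamma_ofReal] at hsw
  have hGp := Real.Gamma_pos_of_pos hc
  refine ⟨(Real.Gamma (2 * β - 1))⁻¹ * ∫ x, x ^ (2 * β - 1 - 1) * ‖∫ t, h x t ∂stμ‖ ^ 2 ∂stμ,
    mul_nonneg (by positivity) (integral_nonneg_of_ae (stμ_pos.mono fun x hx => ?_)), ?_⟩
  · have : 0 < x := hx
    simp only [Pi.zero_apply]; positivity
  · rw [Complex.ofReal_mul, ← hsw, ← mul_assoc, ← Complex.ofReal_mul, inv_mul_cancel₀ hGp.ne']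
    simp

noncomputable abbrev stL := Lp ℂ 2 stμ

def stT (β : ℝ) (T : stL →L[ℂ] stL) : Prop := ∀ f : stL,
      ∀ᵐ t ∂stμ, (T f) t = ((t ^ (β - 1) : ℝ) : ℂ) *
          ∫ s in Set.Ioi (0 : ℝ),
            ((s ^ (β - 1) * (t + s) ^ (-(2 * β - 1)) : ℝ) : ℂ) * f s

lemma stT_K {β : ℝ} {T : stL →L[ℂ] stL} (hT : stT β T) (f : stL) :
    ∀ᵐ t ∂stμ, (T f) t = ∫ s, (stK β t s : ℂ) * f s ∂stμ := by
  filter_upwards [hT f] with t ht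
  rw [ht, ← integral_const_mul]
  unfold stK
  congr 1; ext s; push_cast; ring

lemma stT_inner {β : ℝ} (hβ : 1 / 2 < β) {T : stL →L[ℂ] stL} (hT : stT β T) (f g : stL) :
    inner ℂ f (T g) =
      ∫ p : ℝ × ℝ, (stK β p.1 p.2 : ℂ) * (star (f p.1) * g p.2) ∂(stμ.prod stμ) := by
  rw [integral_prod _ (st_form hβ (Lp.memLp f) (Lp.memLp g)).1, L2.inner_def]
  refine integral_congr_ae ?_
  filter_upwards [stT_K hT g] with t ht
  rw [RCLike.inner_apply, ht, mul_comm, ← integral_const_mul]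
  congr 1; ext s
  simp only [Complex.star_def]
  ring

lemma st_normsq (f : stL) : ∫ t, ‖f t‖ ^ 2 ∂stμ = ‖f‖ ^ 2 := by
  have h := L2.inner_def (𝕜 := ℂ) f f
  have h2 : ∀ t, inner ℂ (f t) (f t) = ((‖f t‖ ^ 2 : ℝ) : ℂ) := by
    intro t; rw [inner_self_eq_norm_sq_to_K]; simp
  simp only [h2] at h
  rw [integral_complex_ofReal, inner_self_eq_norm_sq_to_K] at h
  exact Complex.ofReal_injective (by simpa using h.symm)

lemma stT_form {β : ℝ} (hβ : 1 / 2 < β) {T : stL →L[ℂ] stL} (hT : stT β T) (f : stL) :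
    ∃ r : ℝ, 0 ≤ r ∧ r ≤ stB β * ‖f‖ ^ 2 ∧ inner ℂ (T f) f = (r : ℂ) := by
  obtain ⟨r, h0, hr⟩ := st_pos hβ (Lp.memLp f)
  have hb := (st_form hβ (Lp.memLp f) (Lp.memLp f)).2
  rw [hr, Complex.norm_real, Real.norm_of_nonneg h0, st_normsq] at hb
  refine ⟨r, h0, by linarith, ?_⟩
  rw [← inner_conj_symm, stT_inner hβ hT, hr, Complex.conj_ofReal]

lemma stT_isPos {β : ℝ} (hβ : 1 / 2 < β) {T : stL →L[ℂ] stL} (hT : stT β T) :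
    T.IsPositive := by
  rw [ContinuousLinearMap.isPositive_iff_complex]
  intro f
  obtain ⟨r, h0, -, hr⟩ := stT_form hβ hT f
  rw [hr]
  simpa using h0

lemma stT_isPos' {β : ℝ} (hβ : 1 / 2 < β) {T : stL →L[ℂ] stL} (hT : stT β T) :
    (algebraMap ℝ (stL →L[ℂ] stL) (stB β) - T).IsPositive := by
  rw [ContinuousLinearMap.isPositive_iff_complex]
  intro f
  obtain ⟨r, h0, h1, hr⟩ := stT_form hβ hT f
  have : inner ℂ ((algebraMap ℝ (stL →L[ℂ] stL) (stB β) - T) f) f =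
      ((stB β * ‖f‖ ^ 2 - r : ℝ) : ℂ) := by
    rw [sub_apply, inner_sub_left, hr, Algebra.algebraMap_eq_smul_one,
      smul_apply, one_apply_eq_self,
      RCLike.real_smul_eq_coe_smul (K := ℂ), inner_smul_left, inner_self_eq_norm_sq_to_K]
    simp
  rw [this]
  refine ⟨by rw [RCLike.re_to_complex, Complex.ofReal_re], ?_⟩
  rw [RCLike.re_to_complex, Complex.ofReal_re]
  linarith

lemma stT_spec_le {β : ℝ} (hβ : 1 / 2 < β) {T : stL →L[ℂ] stL} (hT : stT β T) {z : ℂ}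
    (hz : z ∈ spectrum ℂ T) : z = (z.re : ℂ) ∧ 0 ≤ z.re ∧ z.re ≤ stB β := by
  have hp := stT_isPos hβ hT
  have hp' := stT_isPos' hβ hT
  have hsa := hp.isSelfAdjoint
  have e := hsa.mem_spectrum_eq_re hz
  have hz' : z.re ∈ spectrum ℝ T := by
    rw [← spectrum.algebraMap_mem_iff ℂ]
    simpa using e ▸ hz
  refine ⟨e, ?_, ?_⟩
  · exact spectrum_nonneg_of_nonneg ((ContinuousLinearMap.nonneg_iff_isPositive T).2 hp) hz'
  · have := spectrum.singleton_sub_eq T (stB β)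
    have h2 : stB β - z.re ∈ spectrum ℝ (algebraMap ℝ (stL →L[ℂ] stL) (stB β) - T) := by
      rw [← this]; exact Set.sub_mem_sub rfl hz'
    have := spectrum_nonneg_of_nonneg ((ContinuousLinearMap.nonneg_iff_isPositive _).2 hp') h2
    linarith

lemma st_approx {E : Type*} [NormedAddCommGroup E] [NormedSpace ℂ E] (T : E →L[ℂ] E) (z : ℂ)
    {l : Filter ℝ} [l.NeBot] (x : ℝ → E) (M : ℝ → ℂ) (H : ℝ) (hM : Filter.Tendsto M l (nhds z))
    (hx : Filter.Tendsto (fun e => ‖x e‖) l Filter.atTop)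
    (hH : ∀ᶠ e in l, ‖T (x e) - M e • x e‖ ≤ H) : z ∈ spectrum ℂ T := by
  by_contra hz
  rw [spectrum.mem_iff, not_not] at hz
  obtain ⟨R, hR⟩ := hz.exists_left_inv
  have h1 : Filter.Tendsto (fun e => ‖R‖ * ‖z - M e‖) l (nhds (‖R‖ * ‖z - z‖)) :=
    ((tendsto_const_nhds.sub hM).norm).const_mul _
  rw [sub_self, norm_zero, mul_zero] at h1
  have h2 := h1.eventually (gt_mem_nhds (show (0 : ℝ) < 1 / 2 by norm_num))
  have h3 := hx.eventually_gt_atTop (2 * (‖R‖ * H))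
  obtain ⟨e, a1, a2, a3⟩ := (h2.and (h3.and hH)).exists
  have h4 : R ((algebraMap ℂ (E →L[ℂ] E) z - T) (x e)) = x e := by
    have := congrArg (fun S : E →L[ℂ] E => S (x e)) hR
    simpa using this
  have h5 : (algebraMap ℂ (E →L[ℂ] E) z - T) (x e) =
      (z - M e) • x e - (T (x e) - M e • x e) := by
    rw [sub_apply, Algebra.algebraMap_eq_smul_one, smul_apply, one_apply_eq_self, sub_smul]
    abel
  have h6 : ‖x e‖ ≤ ‖R‖ * (‖z - M e‖ * ‖x e‖ + H) := by
    calc ‖x e‖ = ‖R ((z - M e) • x e - (T (x e) - M e • x e))‖ := by rw [← h5, h4]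
      _ ≤ ‖R‖ * ‖(z - M e) • x e - (T (x e) - M e • x e)‖ := R.le_opNorm _
      _ ≤ ‖R‖ * (‖z - M e‖ * ‖x e‖ + H) := by
        gcongr
        refine (norm_sub_le _ _).trans ?_
        rw [norm_smul]
        gcongr
  have h7 : ‖R‖ * ‖z - M e‖ * ‖x e‖ ≤ 1 / 2 * ‖x e‖ :=
    mul_le_mul_of_nonneg_right a1.le (norm_nonneg _)
  nlinarith

noncomputable def stφ (ξ ε : ℝ) : ℝ → ℂ :=
  Set.indicator (Set.Ioc 0 1) (fun s : ℝ => (s : ℂ) ^ (-(1 / 2) + ε + ξ * Complex.I : ℂ))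

noncomputable def stη (β : ℝ) : ℝ → ℝ := fun t => if t ≤ 1 then t ^ (β - 1) else t ^ (-β)

noncomputable def stSym (β ξ ε : ℝ) : ℂ :=
  Complex.Gamma ((β - 1 / 2 : ℝ) + ε + ξ * Complex.I) *
    Complex.Gamma ((β - 1 / 2 : ℝ) - ε - ξ * Complex.I) / Complex.Gamma (2 * β - 1 : ℝ)

lemma stφ_normsq (ξ ε s : ℝ) :
    ‖stφ ξ ε s‖ ^ 2 = Set.indicator (Set.Ioc 0 1) (fun s : ℝ => s ^ (2 * ε - 1)) s := by
  unfold stφ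
  by_cases hs : s ∈ Set.Ioc (0 : ℝ) 1
  · rw [Set.indicator_of_mem hs, Set.indicator_of_mem hs,
      Complex.norm_cpow_eq_rpow_re_of_pos hs.1, ← Real.rpow_natCast, ← Real.rpow_mul hs.1.le]
    congr 1
    simp
    ring
  · rw [Set.indicator_of_notMem hs, Set.indicator_of_notMem hs]; simp

lemma st_rpow_Ioc {a : ℝ} (ha : 0 < a) : IntegrableOn (fun s : ℝ => s ^ (a - 1)) (Set.Ioc 0 1) ∧
    ∫ s in Set.Ioc (0 : ℝ) 1, s ^ (a - 1) = 1 / a := by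
  constructor
  · rw [← intervalIntegrable_iff_integrableOn_Ioc_of_le zero_le_one]
    exact intervalIntegral.intervalIntegrable_rpow' (by linarith)
  · rw [← intervalIntegral.integral_of_le zero_le_one, integral_rpow (Or.inl (by linarith))]
    simp [ha.ne']

lemma stφ_memLp (ξ : ℝ) {ε : ℝ} (hε : 0 < ε) : MemLp (stφ ξ ε) 2 stμ := by
  have hm : Measurable (stφ ξ ε) := by
    unfold stφ
    exact Measurable.indicator (by fun_prop) measurableSet_Ioc
  rw [memLp_two_iff_integrable_sq_norm hm.aestronglyMeasurable]
  simp only [stφ_normsq]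
  rw [integrable_indicator_iff measurableSet_Ioc]
  exact (st_rpow_Ioc (a := 2 * ε) (by linarith)).1.mono_measure Measure.restrict_le_self

lemma stφ_norm (ξ : ℝ) {ε : ℝ} (hε : 0 < ε) :
    ‖(stφ_memLp ξ hε).toLp (stφ ξ ε)‖ ^ 2 = 1 / (2 * ε) := by
  rw [← st_normsq, integral_congr_ae (g := fun t => ‖stφ ξ ε t‖ ^ 2)]
  · simp only [stφ_normsq]
    rw [integral_indicator measurableSet_Ioc, Measure.restrict_restrict measurableSet_Ioc,
      Set.inter_eq_left.2 (fun x hx => hx.1)]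
    exact (st_rpow_Ioc (by linarith)).2
  · filter_upwards [(stφ_memLp ξ hε).coeFn_toLp] with t ht
    rw [ht]

lemma stη_memLp {β : ℝ} (hβ : 1 / 2 < β) : MemLp (stη β) 2 stμ := by
  have hm : Measurable (stη β) := by
    unfold stη
    exact Measurable.ite measurableSet_Iic (by fun_prop) (by fun_prop)
  rw [memLp_two_iff_integrable_sq hm.aestronglyMeasurable]
  change IntegrableOn _ (Set.Ioi 0) volume
  rw [← Set.Ioc_union_Ioi_eq_Ioi (zero_le_one (α := ℝ))]
  refine IntegrableOn.union ?_ ?_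
  · refine (st_rpow_Ioc (a := 2 * β - 1) (by linarith)).1.congr_fun (fun t ht => ?_) measurableSet_Ioc
    simp only [stη]
    rw [if_pos ht.2, ← Real.rpow_natCast, ← Real.rpow_mul ht.1.le]
    congr 1; push_cast; ring
  · refine (integrableOn_Ioi_rpow_of_lt (a := -(2 * β)) (by linarith) one_pos).congr_fun
      (fun t ht => ?_) measurableSet_Ioi
    have ht' : 1 < t := ht
    simp only [stη]
    rw [if_neg (not_le.2 ht'), ← Real.rpow_natCast, ← Real.rpow_mul (by linarith)]
    congr 1; push_cast; ring

lemma st_ptwise {β : ℝ} (hβ : 1 / 2 < β) (ξ : ℝ) {ε : ℝ} (hε : 0 < ε)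
    (hε' : ε ≤ (β - 1 / 2) / 2) {t : ℝ} (ht : 0 < t) :
    ‖∫ s, (stK β t s : ℂ) * stφ ξ ε s ∂stμ - stSym β ξ ε * stφ ξ ε t‖ ≤
      2 / (β - 1 / 2) * stη β t := by
  set a : ℂ := -(1 / 2) + ε + ξ * Complex.I with ha
  set p : ℂ := (β - 1 / 2 : ℝ) + ε + ξ * Complex.I with hp
  have hare : a.re = -(1 / 2) + ε := by simp [ha]
  have hpre : p.re = β - 1 / 2 + ε := by simp [hp]
  obtain ⟨h1, h2⟩ := beta_aux p (2 * β - 1) t (by rw [hpre]; linarith) (by rw [hpre]; linarith) ht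
  have e : ∀ s : ℝ, 0 < s → (stK β t s : ℂ) * (s : ℂ) ^ a =
      ((t ^ (β - 1) : ℝ) : ℂ) * ((s : ℂ) ^ (p - 1) * (((t + s) ^ (-(2 * β - 1)) : ℝ) : ℂ)) := by
    intro s hs
    have hs0 : (s : ℂ) ≠ 0 := by exact_mod_cast hs.ne'
    have : p - 1 = ((β - 1 : ℝ) : ℂ) + a := by rw [hp, ha]; push_cast; ring
    rw [this, Complex.cpow_add ((β - 1 : ℝ) : ℂ) a hs0, ← Complex.ofReal_cpow hs.le]
    unfold stK
    push_cast
    ring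
  have hI : IntegrableOn (fun s : ℝ => (stK β t s : ℂ) * (s : ℂ) ^ a) (Set.Ioi 0) :=
    (Integrable.const_mul h1 ((t ^ (β - 1) : ℝ) : ℂ)).congr
        (stμ_pos.mono fun s hs => (e s hs).symm)
  have hV : ∫ s in Set.Ioi (0 : ℝ), (stK β t s : ℂ) * (s : ℂ) ^ a = stSym β ξ ε * (t : ℂ) ^ a := by
    have ht0 : (t : ℂ) ≠ 0 := by exact_mod_cast ht.ne'
    rw [integral_congr_ae (stμ_pos.mono fun s hs => e s hs), integral_const_mul, h2,
      Complex.ofReal_cpow ht.le, ← mul_assoc, ← Complex.cpow_add _ _ ht0]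
    have e1 : ((β - 1 : ℝ) : ℂ) + (p - ((2 * β - 1 : ℝ) : ℂ)) = a := by
      rw [hp, ha]; push_cast; ring
    have e2 : ((2 * β - 1 : ℝ) : ℂ) - p = (β - 1 / 2 : ℝ) - ε - ξ * Complex.I := by
      rw [hp]; push_cast; ring
    rw [e1, e2, stSym, mul_comm]
  have hsplit := setIntegral_union (μ := volume) (f := fun s : ℝ => (stK β t s : ℂ) * (s : ℂ) ^ a)
    (Set.Ioc_disjoint_Ioi (a := (0 : ℝ)) (b := 1) (c := 1) le_rfl) measurableSet_Ioi
    (hI.mono_set (fun x hx => hx.1)) (hI.mono_set (fun x (hx : 1 < x) => zero_lt_one.trans hx))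
  rw [Set.Ioc_union_Ioi_eq_Ioi (zero_le_one (α := ℝ)), hV] at hsplit
  have hφ : ∫ s, (stK β t s : ℂ) * stφ ξ ε s ∂stμ =
      ∫ s in Set.Ioc (0 : ℝ) 1, (stK β t s : ℂ) * (s : ℂ) ^ a := by
    have : (fun s => (stK β t s : ℂ) * stφ ξ ε s) =
        Set.indicator (Set.Ioc 0 1) (fun s : ℝ => (stK β t s : ℂ) * (s : ℂ) ^ a) := by
      ext s
      unfold stφ
      by_cases hs : s ∈ Set.Ioc (0 : ℝ) 1
      · rw [Set.indicator_of_mem hs, Set.indicator_of_mem hs]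
      · rw [Set.indicator_of_notMem hs, Set.indicator_of_notMem hs, mul_zero]
    rw [this, integral_indicator measurableSet_Ioc, Measure.restrict_restrict measurableSet_Ioc,
      Set.inter_eq_left.2 (fun x hx => hx.1)]
  have hn : ∀ s : ℝ, 0 < s → ‖(stK β t s : ℂ) * (s : ℂ) ^ a‖ =
      t ^ (β - 1) * (s ^ (β - 1) * (t + s) ^ (-(2 * β - 1))) * s ^ (-(1 / 2) + ε) := by
    intro s hs
    rw [norm_mul, Complex.norm_cpow_eq_rpow_re_of_pos hs, hare, Complex.norm_real,
      Real.norm_of_nonneg (stK_nonneg ht hs), stK]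
  rw [hφ]
  by_cases h : t ≤ 1
  · have e3 : stφ ξ ε t = (t : ℂ) ^ a := by
      unfold stφ; rw [Set.indicator_of_mem (show t ∈ Set.Ioc (0 : ℝ) 1 from ⟨ht, h⟩)]
    rw [e3, hsplit, sub_add_cancel_left, norm_neg, stη, if_pos h]
    have hi : IntegrableOn (fun s : ℝ => t ^ (β - 1) * s ^ (-(β - 1 / 2 - ε) - 1)) (Set.Ioi 1) :=
      (integrableOn_Ioi_rpow_of_lt (by linarith) one_pos).const_mul _
    refine (norm_integral_le_of_norm_le hi ?_).trans ?_
    · filter_upwards [ae_restrict_mem measurableSet_Ioi] with s hs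
      have hs1 : 1 < s := hs
      have hs0 : 0 < s := by linarith
      rw [hn s hs0]
      have : (t + s) ^ (-(2 * β - 1)) ≤ s ^ (-(2 * β - 1)) :=
        Real.rpow_le_rpow_of_nonpos hs0 (by linarith) (by linarith)
      calc _ ≤ t ^ (β - 1) * (s ^ (β - 1) * s ^ (-(2 * β - 1))) * s ^ (-(1 / 2) + ε) := by
            gcongr
        _ = _ := by
          rw [mul_assoc, ← Real.rpow_add hs0, ← Real.rpow_add hs0]
          congr 2; ring
    · rw [integral_const_mul, integral_Ioi_rpow_of_lt (by linarith) one_pos, mul_comm]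
      refine mul_le_mul_of_nonneg_right ?_ (by positivity)
      rw [Real.one_rpow, sub_add_cancel, neg_div_neg_eq, div_le_div_iff₀ (by linarith) (by linarith)]
      linarith
  · have e3 : stφ ξ ε t = 0 := by
      unfold stφ; rw [Set.indicator_of_notMem (fun hh => h hh.2)]
    rw [e3, mul_zero, sub_zero, stη, if_neg h]
    have hi : IntegrableOn (fun s : ℝ => t ^ (-β) * s ^ ((β - 1 / 2 + ε) - 1)) (Set.Ioc 0 1) :=
      (st_rpow_Ioc (by linarith)).1.const_mul _
    refine (norm_integral_le_of_norm_le hi ?_).trans ?_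
    · filter_upwards [ae_restrict_mem measurableSet_Ioc] with s hs
      have hs0 : 0 < s := hs.1
      rw [hn s hs0]
      have : (t + s) ^ (-(2 * β - 1)) ≤ t ^ (-(2 * β - 1)) :=
        Real.rpow_le_rpow_of_nonpos ht (by linarith) (by linarith)
      calc _ ≤ t ^ (β - 1) * (s ^ (β - 1) * t ^ (-(2 * β - 1))) * s ^ (-(1 / 2) + ε) := by
            gcongr
        _ = (t ^ (β - 1) * t ^ (-(2 * β - 1))) * (s ^ (β - 1) * s ^ (-(1 / 2) + ε)) := by ring
        _ = _ := by
          rw [← Real.rpow_add hs0, ← Real.rpow_add ht]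
          congr 2 <;> ring
    · rw [integral_const_mul, (st_rpow_Ioc (by linarith)).2, mul_comm]
      refine mul_le_mul_of_nonneg_right ?_ (by positivity)
      rw [div_le_div_iff₀ (by linarith) (by linarith)]
      linarith

lemma stSym_spec {β : ℝ} (hβ : 1 / 2 < β) {T : stL →L[ℂ] stL} (hT : stT β T) (ξ : ℝ) :
    stSym β ξ 0 ∈ spectrum ℂ T := by
  let x : ℝ → stL := fun ε => if h : 0 < ε then (stφ_memLp ξ h).toLp (stφ ξ ε) else 0
  have hηm : MemLp (fun t => 2 / (β - 1 / 2) * stη β t) 2 stμ := (stη_memLp hβ).const_mul _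
  refine st_approx (l := nhdsWithin 0 (Set.Ioi 0)) T _ x (stSym β ξ) ‖hηm.toLp _‖ ?_ ?_ ?_
  · have : ContinuousAt (stSym β ξ) 0 := by
      unfold stSym
      refine ContinuousAt.div_const (ContinuousAt.mul ?_ ?_) _
      · refine ContinuousAt.comp (f := fun ε : ℝ => ((β - 1 / 2 : ℝ) : ℂ) + ε + ξ * Complex.I)
          (g := Complex.Gamma) ?_ (by fun_prop)
        refine (Complex.differentiableAt_Gamma _ fun m hm => ?_).continuousAt
        have := congrArg Complex.re hm
        simp at this
        have : (0 : ℝ) ≤ m := Nat.cast_nonneg m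
        linarith
      · refine ContinuousAt.comp (f := fun ε : ℝ => ((β - 1 / 2 : ℝ) : ℂ) - ε - ξ * Complex.I)
          (g := Complex.Gamma) ?_ (by fun_prop)
        refine (Complex.differentiableAt_Gamma _ fun m hm => ?_).continuousAt
        have := congrArg Complex.re hm
        simp at this
        have : (0 : ℝ) ≤ m := Nat.cast_nonneg m
        linarith
    exact this.tendsto.mono_left nhdsWithin_le_nhds
  · have h1 : ∀ᶠ ε : ℝ in nhdsWithin 0 (Set.Ioi 0), Real.sqrt (1 / 2 * ε⁻¹) = ‖x ε‖ := by
      filter_upwards [self_mem_nhdsWithin] with ε hε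
      have hε' : 0 < ε := hε
      simp only [x, dif_pos hε']
      rw [Real.sqrt_eq_iff_mul_self_eq (by positivity) (norm_nonneg _), ← sq, stφ_norm ξ hε']
      field_simp
    refine Filter.Tendsto.congr' h1 (Real.tendsto_sqrt_atTop.comp ?_)
    exact (tendsto_inv_nhdsGT_zero).const_mul_atTop (by norm_num)
  · have hb : 0 < (β - 1 / 2) / 2 := by linarith
    filter_upwards [self_mem_nhdsWithin, nhdsWithin_le_nhds (Iio_mem_nhds hb)] with ε hε hε2
    have hε' : 0 < ε := hε
    have hε2' : ε < (β - 1 / 2) / 2 := hε2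
    simp only [x, dif_pos hε']
    set φ := (stφ_memLp ξ hε').toLp (stφ ξ ε) with hφ
    have hφe : φ =ᵐ[stμ] stφ ξ ε := (stφ_memLp ξ hε').coeFn_toLp
    refine Lp.norm_le_norm_of_ae_le ?_
    filter_upwards [Lp.coeFn_sub (T φ) (stSym β ξ ε • φ), Lp.coeFn_smul (stSym β ξ ε) φ, hφe,
      stT_K hT φ, stμ_pos, hηm.coeFn_toLp] with t a1 a2 a3 a4 a5 a6
    rw [a1, Pi.sub_apply, a2, Pi.smul_apply, a3, a4, a6, smul_eq_mul]
    have : ∫ s, (stK β t s : ℂ) * φ s ∂stμ = ∫ s, (stK β t s : ℂ) * stφ ξ ε s ∂stμ :=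
      integral_congr_ae (hφe.mono fun s hs => by simp only [hs])
    rw [this]
    exact (st_ptwise hβ ξ hε' hε2'.le a5).trans (Real.le_norm_self _)

lemma st_norm_Gamma_le {z : ℂ} (hz : 0 < z.re) : ‖Complex.Gamma z‖ ≤ Real.Gamma z.re := by
  have h1 := Complex.integral_cpow_mul_exp_neg_mul_Ioi hz one_pos
  have h2 := Real.integral_rpow_mul_exp_neg_mul_Ioi hz one_pos
  simp only [Complex.ofReal_one, div_one, Complex.one_cpow, one_mul, Real.one_rpow] at h1 h2
  rw [← h1, ← h2]
  have h3 := gam_int hz one_pos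
  simp only [one_mul] at h3
  refine norm_integral_le_of_norm_le h3 ?_
  filter_upwards [stμ_pos] with x hx
  rw [norm_mul, Complex.norm_cpow_eq_rpow_re_of_pos hx, Complex.norm_exp]
  simp

lemma stSym_zero (β : ℝ) : stSym β 0 0 = (stB β : ℂ) := by
  unfold stSym stB
  rw [show β - 1 / 2 + (β - 1 / 2) = 2 * β - 1 by ring]
  push_cast [Complex.Gamma_ofReal, ← Complex.Gamma_ofReal]
  simp

lemma stSym_cont {β : ℝ} (hβ : 1 / 2 < β) : Continuous (fun ξ => stSym β ξ 0) := by
  rw [continuous_iff_continuousAt]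
  intro ξ₀
  unfold stSym
  refine ContinuousAt.div_const (ContinuousAt.mul ?_ ?_) _
  · refine ContinuousAt.comp (f := fun ξ : ℝ => ((β - 1 / 2 : ℝ) : ℂ) + (0 : ℝ) + ξ * Complex.I)
      (g := Complex.Gamma) ?_ (by fun_prop)
    refine (Complex.differentiableAt_Gamma _ fun m hm => ?_).continuousAt
    have := congrArg Complex.re hm
    simp at this
    have : (0 : ℝ) ≤ m := Nat.cast_nonneg m
    linarith
  · refine ContinuousAt.comp (f := fun ξ : ℝ => ((β - 1 / 2 : ℝ) : ℂ) - (0 : ℝ) - ξ * Complex.I)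
      (g := Complex.Gamma) ?_ (by fun_prop)
    refine (Complex.differentiableAt_Gamma _ fun m hm => ?_).continuousAt
    have := congrArg Complex.re hm
    simp at this
    have : (0 : ℝ) ≤ m := Nat.cast_nonneg m
    linarith

lemma stSym_small {β : ℝ} (hβ : 1 / 2 < β) {y : ℝ} (hy : 0 < y) : ∃ ξ, (stSym β ξ 0).re < y := by
  set b := β - 1 / 2 with hb
  have hb0 : 0 < b := by linarith
  have hG := Real.Gamma_pos_of_pos (s := 2 * β - 1) (by linarith)
  have hG1 := Real.Gamma_pos_of_pos (s := b + 1) (by linarith)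
  have hG2 := Real.Gamma_pos_of_pos hb0
  set C := Real.Gamma (b + 1) * Real.Gamma b / Real.Gamma (2 * β - 1) with hC
  have hC0 : 0 < C := by positivity
  refine ⟨2 * C / y, ?_⟩
  have hξ : 0 < 2 * C / y := by positivity
  set ξ := 2 * C / y with hξd
  set z : ℂ := (b : ℂ) + ξ * Complex.I with hz
  have hzre : z.re = b := by simp [hz]
  have hzim : z.im = ξ := by simp [hz]
  have hz0 : z ≠ 0 := fun h => by rw [h] at hzre; simp at hzre; linarith
  have h1 : ‖Complex.Gamma z‖ * ξ ≤ Real.Gamma (b + 1) := by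
    have h2 := st_norm_Gamma_le (z := z + 1) (by simp [hzre]; linarith)
    rw [Complex.Gamma_add_one z hz0, norm_mul, Complex.add_re, hzre, Complex.one_re] at h2
    have h3 : ξ ≤ ‖z‖ := by
      have := Complex.abs_im_le_norm z
      rwa [hzim, abs_of_pos hξ] at this
    nlinarith [mul_le_mul_of_nonneg_right h3 (norm_nonneg (Complex.Gamma z))]
  have h2 : ‖Complex.Gamma ((b : ℂ) - ξ * Complex.I)‖ ≤ Real.Gamma b := by
    have := st_norm_Gamma_le (z := (b : ℂ) - ξ * Complex.I) (by simpa using hb0)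
    simpa using this
  have h3 : ‖stSym β ξ 0‖ * ξ ≤ C := by
    unfold stSym
    rw [← hb]
    simp only [Complex.ofReal_zero, add_zero, sub_zero]
    rw [← hz, norm_div, norm_mul, Complex.Gamma_ofReal, Complex.norm_real, Real.norm_of_nonneg hG.le,
      hC, div_mul_eq_mul_div]
    refine div_le_div_of_nonneg_right ?_ hG.le
    calc _ = ‖Complex.Gamma z‖ * ξ * ‖Complex.Gamma ((b : ℂ) - ξ * Complex.I)‖ := by ring
      _ ≤ _ := by gcongr
  have h4 : ξ * y = 2 * C := by rw [hξd]; field_simp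
  have h5 := Complex.re_le_norm (stSym β ξ 0)
  by_contra h6
  rw [not_lt] at h6
  have : y * ξ ≤ ‖stSym β ξ 0‖ * ξ := by gcongr; linarith
  linarith

lemma stT_spec {β : ℝ} (hβ : 1 / 2 < β) {T : stL →L[ℂ] stL} (hT : stT β T) :
    spectrum ℂ T = (fun x : ℝ => (x : ℂ)) '' Set.Icc 0 (stB β) := by
  apply Set.Subset.antisymm
  · intro z hz
    obtain ⟨h1, h2, h3⟩ := stT_spec_le hβ hT hz
    exact ⟨z.re, ⟨h2, h3⟩, h1.symm⟩
  · have hcl : IsClosed {x : ℝ | (x : ℂ) ∈ spectrum ℂ T} :=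
      (spectrum.isClosed T).preimage Complex.continuous_ofReal
    have hsub : Set.Ioc 0 (stB β) ⊆ {x : ℝ | (x : ℂ) ∈ spectrum ℂ T} := by
      intro y hy
      obtain ⟨ξ, hξ⟩ := stSym_small hβ hy.1
      have hc : Continuous (fun ξ => (stSym β ξ 0).re) :=
        Complex.continuous_re.comp (stSym_cont hβ)
      have h0 : (stSym β 0 0).re = stB β := by rw [stSym_zero, Complex.ofReal_re]
      obtain ⟨x, hx⟩ := mem_range_of_exists_le_of_exists_ge hc ⟨ξ, hξ.le⟩ ⟨0, by rw [h0]; exact hy.2⟩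
      have hm := stSym_spec hβ hT x
      have := (stT_spec_le hβ hT hm).1
      simp only at hx
      rw [this, hx] at hm
      exact hm
    have := closure_minimal hsub hcl
    rw [closure_Ioc (stB_pos hβ).ne] at this
    rintro _ ⟨x, hx, rfl⟩
    exact this hx

theorem stmt16 (β : ℝ) (hβ : 1 / 2 < β)
    (T : Lp ℂ 2 (volume.restrict (Set.Ioi (0 : ℝ))) →L[ℂ]
         Lp ℂ 2 (volume.restrict (Set.Ioi (0 : ℝ))))
    (hT : ∀ f : Lp ℂ 2 (volume.restrict (Set.Ioi (0 : ℝ))),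
      ∀ᵐ t ∂(volume.restrict (Set.Ioi (0 : ℝ))),
        (T f) t = ((t ^ (β - 1) : ℝ) : ℂ) *
          ∫ s in Set.Ioi (0 : ℝ),
            ((s ^ (β - 1) * (t + s) ^ (-(2 * β - 1)) : ℝ) : ℂ) * f s) :
    IsSelfAdjoint T ∧
    spectrum ℂ T = (fun x : ℝ => (x : ℂ)) ''
      Set.Icc 0 (Real.Gamma (β - 1 / 2) * Real.Gamma (β - 1 / 2) /
        Real.Gamma ((β - 1 / 2) + (β - 1 / 2))) ∧
    (β = 1 → spectrum ℂ T = (fun x : ℝ => (x : ℂ)) '' Set.Icc 0 Real.pi) := by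
  have h : spectrum ℂ T = (fun x : ℝ => (x : ℂ)) '' Set.Icc 0 (stB β) := stT_spec hβ hT
  refine ⟨(stT_isPos hβ hT).isSelfAdjoint, h, fun h1 => ?_⟩
  have h2 : stB β = Real.pi := by
    subst h1
    unfold stB
    rw [show (1 : ℝ) - 1 / 2 = 1 / 2 by norm_num, show (1 : ℝ) / 2 + 1 / 2 = 1 by norm_num,
      Real.Gamma_one_half_eq, Real.Gamma_one, div_one, Real.mul_self_sqrt Real.pi_pos.le]
  rw [h, h2]
end
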